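/- Let t ∈ (0,∞), β > -1, and let w be a non-negative function in L^1(|dz|) on 𝕋. Then there exists a sequence of polynomials {p_k}_k with ∫_𝕋 |p_k|^t w |dz| → 0 and ∫_𝔻 |p_k - 1|^t (1-|z|)^β dA(z) → 0 (equivalently, the space P^t(μ) with dμ = (1-|z|)^β dA + w |dz| splits) if and only if ∫_E log w |dz| = -∞ for every Carleson set E ⊂ 𝕋 of positive arclength measure. -/

import Mathlib

open MeasureTheory Set Filter Topology

noncomputable section

local instance : Fact (0 < 2 * Real.pi) := ⟨by positivity⟩

/-- The unit circle `𝕋`, modelled as `ℝ / 2πℤ` with its arclength (Haar) measure,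
of total mass `2π`. -/
abbrev UnitCircle := AddCircle (2 * Real.pi)

/-- A gauge function: continuous, increasing on `[0,∞)`, vanishing at `0`, with
`(R1)` `h x / x` decreasing and `(R2)` `h x / x → ∞` as `x → 0+`. -/
structure IsGauge (h : ℝ → ℝ) : Prop where
  continuousOn : ContinuousOn h (Set.Ici 0)
  mono : MonotoneOn h (Set.Ici 0)
  zero : h 0 = 0
  r1 : ∀ ⦃x y : ℝ⦄, 0 < x → x ≤ y → h y / y ≤ h x / x
  r2 : Filter.Tendsto (fun x => h x / x) (nhdsWithin 0 (Set.Ioi 0)) Filter.atTop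

/-- An arc of the circle: a connected subset (the empty set is allowed as a
degenerate arc). -/
def IsArc (I : Set UnitCircle) : Prop := IsPreconnected I

/-- An `h`-Carleson set: a closed subset of the circle whose complement is a countable
disjoint union of open arcs `I_k` (namely its maximal complementary arcs) with
`Σ_k h(|I_k|) < ∞`. -/
def IsHCarleson (h : ℝ → ℝ) (E : Set UnitCircle) : Prop :=
  IsClosed E ∧ ∃ I : ℕ → Set UnitCircle,
    (∀ k, IsOpen (I k) ∧ IsPreconnected (I k)) ∧
    (∀ k l, k ≠ l → Disjoint (I k) (I l)) ∧
    (⋃ k, I k) = Eᶜ ∧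
    (∑' k, ENNReal.ofReal (h (volume (I k)).toReal)) < ⊤

/-- `nlog t = log⁺(1/t)`, valued in `[0,∞]`, with `nlog 0 = ∞`. For `w ≥ 0` this is
the function `R = log⁺(1/w)` of Khrushchev; moreover, since the positive part of
`log w` is automatically integrable for `w ∈ L¹`, the divergence condition
`∫_E log w |dζ| = -∞` is faithfully expressed as `∫⁻_E nlog (w ζ) |dζ| = ∞`. -/
def nlog (t : ℝ) : ENNReal := if t = 0 then ⊤ else ENNReal.ofReal (Real.log t⁻¹)

/-- The embedding of `𝕋 = ℝ/2πℤ` into `ℂ`, `θ ↦ e^{iθ}`. -/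
def circleEmbed (ζ : UnitCircle) : ℂ := (AddCircle.toCircle ζ : ℂ)

/-- A classical Carleson set: a closed subset of the circle whose maximal
complementary open arcs `I_k` satisfy `Σ_k |I_k| log(1/|I_k|) < ∞`. -/
def IsCarlesonSet (E : Set UnitCircle) : Prop :=
  IsClosed E ∧ ∃ I : ℕ → Set UnitCircle,
    (∀ k, IsOpen (I k) ∧ IsPreconnected (I k)) ∧
    (∀ k l, k ≠ l → Disjoint (I k) (I l)) ∧
    (⋃ k, I k) = Eᶜ ∧
    (∑' k, ENNReal.ofReal
      ((volume (I k)).toReal * Real.log (1 / (volume (I k)).toReal))) < ⊤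

/-- The derivation `z d/dz` on polynomials. -/
def eulerOp (p : Polynomial ℂ) : Polynomial ℂ := Polynomial.X * Polynomial.derivative p

/-- The polynomial `p` in logarithmic coordinates `z = exp (-s + i θ)`. -/
def logEval (p : Polynomial ℂ) (s θ : ℝ) : ℂ := p.eval (Complex.exp (-(s : ℂ) + θ * Complex.I))

lemma hasDerivAt_logEval_fst (p : Polynomial ℂ) (s θ : ℝ) :
    HasDerivAt (fun s => logEval p s θ) (-logEval (eulerOp p) s θ) s := by
  have h1 : HasDerivAt (fun s : ℝ => -(s : ℂ) + θ * Complex.I) (-1) s := by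
    simpa using (Complex.ofRealCLM.hasDerivAt (x := s)).neg.add_const (θ * Complex.I)
  have h2 := (p.hasDerivAt (Complex.exp (-(s : ℂ) + θ * Complex.I))).comp s h1.cexp
  refine h2.congr_deriv ?_
  simp [logEval, eulerOp]; ring

lemma hasDerivAt_logEval_snd (p : Polynomial ℂ) (s θ : ℝ) :
    HasDerivAt (fun θ => logEval p s θ) (Complex.I * logEval (eulerOp p) s θ) θ := by
  have h1 : HasDerivAt (fun θ : ℝ => -(s : ℂ) + θ * Complex.I) (Complex.I) θ := by
    simpa using ((Complex.ofRealCLM.hasDerivAt (x := θ)).mul_const Complex.I).const_add (-(s : ℂ))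
  have h2 := (p.hasDerivAt (Complex.exp (-(s : ℂ) + θ * Complex.I))).comp θ h1.cexp
  refine h2.congr_deriv ?_
  simp [logEval, eulerOp]; ring

lemma continuous_logEval (p : Polynomial ℂ) :
    Continuous (fun x : ℝ × ℝ => logEval p x.1 x.2) := by
  unfold logEval
  exact p.continuous.comp (by fun_prop)

lemma logEval_add_two_pi (p : Polynomial ℂ) (s θ : ℝ) :
    logEval p s (θ + 2 * Real.pi) = logEval p s θ := by
  unfold logEval
  congr 1
  rw [Complex.exp_eq_exp_iff_exists_int]
  exact ⟨1, by push_cast; ring⟩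

/-- Real inner product of complex numbers. -/
def reDot (a b : ℂ) : ℝ := a.re * b.re + a.im * b.im

lemma reDot_self_nonneg (a : ℂ) : 0 ≤ reDot a a :=
  add_nonneg (mul_self_nonneg _) (mul_self_nonneg _)

lemma continuous_reDot {X : Type*} [TopologicalSpace X] {f g : X → ℂ} (hf : Continuous f)
    (hg : Continuous g) : Continuous fun x => reDot (f x) (g x) :=
  ((Complex.continuous_re.comp hf).mul (Complex.continuous_re.comp hg)).add
    ((Complex.continuous_im.comp hf).mul (Complex.continuous_im.comp hg))

lemma hasDerivAt_reDot {f g : ℝ → ℂ} {f' g' : ℂ} {x : ℝ} (hf : HasDerivAt f f' x)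
    (hg : HasDerivAt g g' x) :
    HasDerivAt (fun y => reDot (f y) (g y)) (reDot f' (g x) + reDot (f x) g') x := by
  have e1 := Complex.reCLM.hasFDerivAt.comp_hasDerivAt x hf
  have e2 := Complex.imCLM.hasFDerivAt.comp_hasDerivAt x hf
  have e3 := Complex.reCLM.hasFDerivAt.comp_hasDerivAt x hg
  have e4 := Complex.imCLM.hasFDerivAt.comp_hasDerivAt x hg
  refine ((e1.mul e3).add (e2.mul e4)).congr_deriv ?_
  simp [reDot]; ring

lemma hasDerivAt_half_log {f : ℝ → ℂ} {f' : ℂ} {x δ : ℝ} (hδ : 0 < δ) (hf : HasDerivAt f f' x) :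
    HasDerivAt (fun y => Real.log (reDot (f y) (f y) + δ) / 2)
      (reDot (f x) f' / (reDot (f x) (f x) + δ)) x := by
  have hp : reDot (f x) (f x) + δ ≠ 0 := by have := reDot_self_nonneg (f x); positivity
  refine ((((hasDerivAt_reDot hf hf).add_const δ).log hp).div_const 2).congr_deriv ?_
  field_simp
  simp only [reDot]; ring

lemma hasDerivAt_reDot_div {f f1 : ℝ → ℂ} {f2 : ℂ} {x δ : ℝ} (hδ : 0 < δ)
    (hf : HasDerivAt f (f1 x) x) (hf1 : HasDerivAt f1 f2 x) :
    HasDerivAt (fun y => reDot (f y) (f1 y) / (reDot (f y) (f y) + δ))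
      ((reDot (f1 x) (f1 x) + reDot (f x) f2) / (reDot (f x) (f x) + δ)
        - 2 * reDot (f x) (f1 x) ^ 2 / (reDot (f x) (f x) + δ) ^ 2) x := by
  have hp : reDot (f x) (f x) + δ ≠ 0 := by have := reDot_self_nonneg (f x); positivity
  refine ((hasDerivAt_reDot hf hf1).div ((hasDerivAt_reDot hf hf).add_const δ) hp).congr_deriv ?_
  field_simp
  simp only [reDot]; ring

/-- The data of a smooth function on the cylinder with its partial derivatives up to order two,
nonnegative Laplacian and period `2π` in the second variable. -/
structure CylinderSubharmonic (u us uss ut utt : ℝ → ℝ → ℝ) : Prop where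
  cu : Continuous fun x : ℝ × ℝ => u x.1 x.2
  cus : Continuous fun x : ℝ × ℝ => us x.1 x.2
  cuss : Continuous fun x : ℝ × ℝ => uss x.1 x.2
  cut : Continuous fun x : ℝ × ℝ => ut x.1 x.2
  cutt : Continuous fun x : ℝ × ℝ => utt x.1 x.2
  du : ∀ s θ, HasDerivAt (fun s => u s θ) (us s θ) s
  dus : ∀ s θ, HasDerivAt (fun s => us s θ) (uss s θ) s
  dt : ∀ s θ, HasDerivAt (fun θ => u s θ) (ut s θ) θ
  dtt : ∀ s θ, HasDerivAt (fun θ => ut s θ) (utt s θ) θ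
  lap : ∀ s θ, 0 ≤ uss s θ + utt s θ
  peru : ∀ s θ, u s (θ + 2 * Real.pi) = u s θ
  perut : ∀ s θ, ut s (θ + 2 * Real.pi) = ut s θ

/-- `log √(|p|² + δ)` in logarithmic coordinates. -/
def smoothLog (p : Polynomial ℂ) (δ s θ : ℝ) : ℝ :=
  Real.log (reDot (logEval p s θ) (logEval p s θ) + δ) / 2

/-- The derivative of `smoothLog` in the first variable. -/
def smoothLogDeriv (p : Polynomial ℂ) (δ s θ : ℝ) : ℝ :=
  reDot (logEval p s θ) (-logEval (eulerOp p) s θ) /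
    (reDot (logEval p s θ) (logEval p s θ) + δ)

lemma exists_cylinderSubharmonic (p : Polynomial ℂ) {δ : ℝ} (hδ : 0 < δ) :
    ∃ uss ut utt, CylinderSubharmonic (smoothLog p δ) (smoothLogDeriv p δ) uss ut utt := by
  have hpos : ∀ z : ℂ, 0 < reDot z z + δ := fun z => by have := reDot_self_nonneg z; positivity
  have c0 := continuous_logEval p
  have c1 := continuous_logEval (eulerOp p)
  have c2 := continuous_logEval (eulerOp (eulerOp p))
  have hc := (continuous_reDot c0 c0).add_const δ
  have cI := c1.const_mul Complex.I
  have k1 := continuous_reDot c0 c1.neg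
  have k2 := continuous_reDot c0 cI
  have k3 := continuous_reDot c0 c2
  have k4 := continuous_reDot c1.neg c1.neg
  have k5 := continuous_reDot cI cI
  have k6 := continuous_reDot c0 c2.neg
  refine ⟨fun s θ => (reDot (-logEval (eulerOp p) s θ) (-logEval (eulerOp p) s θ)
      + reDot (logEval p s θ) (logEval (eulerOp (eulerOp p)) s θ)) /
        (reDot (logEval p s θ) (logEval p s θ) + δ)
        - 2 * reDot (logEval p s θ) (-logEval (eulerOp p) s θ) ^ 2 /
          (reDot (logEval p s θ) (logEval p s θ) + δ) ^ 2,
    fun s θ => reDot (logEval p s θ) (Complex.I * logEval (eulerOp p) s θ) /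
      (reDot (logEval p s θ) (logEval p s θ) + δ),
    fun s θ => (reDot (Complex.I * logEval (eulerOp p) s θ) (Complex.I * logEval (eulerOp p) s θ)
      + reDot (logEval p s θ) (-logEval (eulerOp (eulerOp p)) s θ)) /
        (reDot (logEval p s θ) (logEval p s θ) + δ)
        - 2 * reDot (logEval p s θ) (Complex.I * logEval (eulerOp p) s θ) ^ 2 /
          (reDot (logEval p s θ) (logEval p s θ) + δ) ^ 2, ?_⟩
  have kq := fun x : ℝ × ℝ => (hpos (logEval p x.1 x.2)).ne'
  have kq2 := fun x : ℝ × ℝ => pow_ne_zero 2 (hpos (logEval p x.1 x.2)).ne'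
  refine ⟨(hc.log kq).div_const 2, k1.div hc kq,
    ((k4.add k3).div hc kq).sub (((k1.pow 2).const_mul 2).div (hc.pow 2) kq2),
    k2.div hc kq,
    ((k5.add k6).div hc kq).sub (((k2.pow 2).const_mul 2).div (hc.pow 2) kq2),
    fun s θ => hasDerivAt_half_log hδ (hasDerivAt_logEval_fst p s θ),
    fun s θ => ?_, fun s θ => hasDerivAt_half_log hδ (hasDerivAt_logEval_snd p s θ),
    fun s θ => ?_, fun s θ => ?_, fun s θ => by simp [smoothLog, logEval_add_two_pi],
    fun s θ => by simp [logEval_add_two_pi]⟩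
  · exact hasDerivAt_reDot_div hδ (f1 := fun s => -logEval (eulerOp p) s θ)
      (hasDerivAt_logEval_fst p s θ)
      ((hasDerivAt_logEval_fst (eulerOp p) s θ).fun_neg.congr_deriv (neg_neg _))
  · refine hasDerivAt_reDot_div hδ (f1 := fun θ => Complex.I * logEval (eulerOp p) s θ)
      (hasDerivAt_logEval_snd p s θ) ?_
    have := (hasDerivAt_logEval_snd (eulerOp p) s θ).const_mul Complex.I
    rwa [← mul_assoc, Complex.I_mul_I, neg_one_mul] at this
  · have hq := hpos (logEval p s θ)
    generalize logEval p s θ = a at *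
    generalize logEval (eulerOp p) s θ = b
    generalize logEval (eulerOp (eulerOp p)) s θ = c
    have : (0:ℝ) ≤ 2 * δ * reDot b b / (reDot a a + δ) ^ 2 := by
      have := reDot_self_nonneg b
      positivity
    convert this using 1
    field_simp
    simp [reDot]
    ring

/-- A nonnegative twice differentiable function on the line, with explicit derivatives, vanishing to
second order at both ends of a period. -/
structure GreenWeight (x₀ A C : ℝ) (v v1 v2 : ℝ → ℝ) : Prop where
  nonneg : ∀ θ, 0 ≤ v θ
  d1 : ∀ θ, HasDerivAt v (v1 θ) θ
  d2 : ∀ θ, HasDerivAt v1 (v2 θ) θ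
  meas : Measurable v2
  bound : ∀ θ, |v2 θ| ≤ 2 * A
  sq : ∀ θ, v1 θ ^ 2 ≤ C * v θ
  left : v x₀ = 0
  right : v (x₀ + 2 * Real.pi) = 0
  left' : v1 x₀ = 0
  right' : v1 (x₀ + 2 * Real.pi) = 0

/-- The Green test function `s²/(s+v) + A s²`. -/
def gPhi (A s v : ℝ) : ℝ := s ^ 2 / (s + v) + A * s ^ 2
/-- First `s`-derivative of `gPhi`. -/
def gPhiS (A s v : ℝ) : ℝ := 1 - v ^ 2 / (s + v) ^ 2 + 2 * A * s
/-- Second `s`-derivative of `gPhi`. -/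
def gPhiSS (A s v : ℝ) : ℝ := 2 * v ^ 2 / (s + v) ^ 3 + 2 * A
/-- First `θ`-derivative of `gPhi`. -/
def gPhiT (s v v1 : ℝ) : ℝ := -(s ^ 2 * v1) / (s + v) ^ 2
/-- Second `θ`-derivative of `gPhi`. -/
def gPhiTT (s v v1 v2 : ℝ) : ℝ := 2 * s ^ 2 * v1 ^ 2 / (s + v) ^ 3 - s ^ 2 * v2 / (s + v) ^ 2

lemma hasDerivAt_gPhi (A : ℝ) {s v : ℝ} (hs : 0 < s) (hv : 0 ≤ v) :
    HasDerivAt (fun s => gPhi A s v) (gPhiS A s v) s := by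
  have h : s + v ≠ 0 := by positivity
  have h1 := (hasDerivAt_pow 2 s).div ((hasDerivAt_id s).add_const v) h
  refine (h1.add ((hasDerivAt_pow 2 s).const_mul A)).congr_deriv ?_
  simp [gPhiS]; field_simp; ring

lemma hasDerivAt_gPhiS (A : ℝ) {s v : ℝ} (hs : 0 < s) (hv : 0 ≤ v) :
    HasDerivAt (fun s => gPhiS A s v) (gPhiSS A s v) s := by
  have h : (s + v) ^ 2 ≠ 0 := by positivity
  have h1 := (hasDerivAt_const s (v ^ 2)).div (((hasDerivAt_id s).add_const v).pow 2) h
  refine ((h1.const_sub 1).add ((hasDerivAt_id s).const_mul (2 * A))).congr_deriv ?_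
  simp [gPhiSS]; field_simp

lemma hasDerivAt_gPhi_snd (A : ℝ) {s θ : ℝ} {v v1 : ℝ → ℝ} (hs : 0 < s) (hv : 0 ≤ v θ)
    (h : HasDerivAt v (v1 θ) θ) :
    HasDerivAt (fun θ => gPhi A s (v θ)) (gPhiT s (v θ) (v1 θ)) θ := by
  have h' : s + v θ ≠ 0 := by positivity
  have h1 := (hasDerivAt_const θ (s ^ 2)).div (h.const_add s) h'
  refine (h1.add_const (A * s ^ 2)).congr_deriv ?_
  simp [gPhiT]

lemma hasDerivAt_gPhiT {s θ : ℝ} {v v1 v2 : ℝ → ℝ} (hs : 0 < s) (hv : 0 ≤ v θ)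
    (h : HasDerivAt v (v1 θ) θ) (h2 : HasDerivAt v1 (v2 θ) θ) :
    HasDerivAt (fun θ => gPhiT s (v θ) (v1 θ)) (gPhiTT s (v θ) (v1 θ) (v2 θ)) θ := by
  have h' : (s + v θ) ^ 2 ≠ 0 := by positivity
  have h1 := (h2.const_mul (s ^ 2)).neg.div ((h.const_add s).pow 2) h'
  refine h1.congr_deriv ?_
  simp [gPhiTT]; field_simp; ring

lemma gPhi_nonneg {A s v : ℝ} (hA : 0 ≤ A) (hs : 0 < s) (hv : 0 ≤ v) : 0 ≤ gPhi A s v := by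
  unfold gPhi; positivity

lemma gPhi_le {A s v : ℝ} (hs : 0 < s) (hv : 0 ≤ v) : gPhi A s v ≤ s + A * s ^ 2 := by
  unfold gPhi
  have : s ^ 2 / (s + v) ≤ s := by
    rw [div_le_iff₀ (by positivity)]; nlinarith
  linarith

lemma gPhiS_nonneg {A s v : ℝ} (hA : 0 ≤ A) (hs : 0 < s) (hv : 0 ≤ v) : 0 ≤ gPhiS A s v := by
  unfold gPhiS
  have : v ^ 2 / (s + v) ^ 2 ≤ 1 := by
    rw [div_le_iff₀ (by positivity)]; nlinarith
  have : 0 ≤ 2 * A * s := by positivity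
  linarith

lemma gPhiS_le {A s v : ℝ} : gPhiS A s v ≤ 1 + 2 * A * s := by
  unfold gPhiS
  have : 0 ≤ v ^ 2 / (s + v) ^ 2 := by positivity
  linarith

lemma sq_div_add_sq_le_one {s v : ℝ} (hs : 0 < s) (hv : 0 ≤ v) : s ^ 2 / (s + v) ^ 2 ≤ 1 := by
  rw [div_le_iff₀ (by positivity)]; nlinarith

lemma abs_gPhiTT_le {A C s v v1 v2 : ℝ} (hC : 0 ≤ C) (hs : 0 < s) (hv : 0 ≤ v)
    (h1 : v1 ^ 2 ≤ C * v) (h2 : |v2| ≤ 2 * A) :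
    -(2 * A) ≤ gPhiTT s v v1 v2 ∧ gPhiTT s v v1 v2 ≤ 2 * C + 2 * A := by
  have e := sq_div_add_sq_le_one hs hv
  have e0 : 0 ≤ s ^ 2 / (s + v) ^ 2 := by positivity
  have e1 : |s ^ 2 * v2 / (s + v) ^ 2| ≤ 2 * A := by
    rw [mul_div_right_comm, abs_mul, abs_of_nonneg e0]
    nlinarith [abs_nonneg v2]
  have e2 : 0 ≤ 2 * s ^ 2 * v1 ^ 2 / (s + v) ^ 3 := by positivity
  have e3 : 2 * s ^ 2 * v1 ^ 2 / (s + v) ^ 3 ≤ 2 * C := by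
    rw [div_le_iff₀ (by positivity)]
    have : 2 * s ^ 2 * v1 ^ 2 ≤ 2 * s ^ 2 * (C * v) := by gcongr
    have : s ^ 2 * v ≤ (s + v) ^ 3 := by
      have : 0 ≤ s ^ 3 + 2 * s ^ 2 * v + 3 * s * v ^ 2 + v ^ 3 := by positivity
      nlinarith
    nlinarith
  rw [abs_le] at e1
  unfold gPhiTT
  constructor <;> linarith [e1.1, e1.2]

/-- Primitive dominating the integral of the logarithmically weighted Laplacian of `gPhi`. -/
lemma integral_log_weight_le {K σ v : ℝ} (hK : 0 ≤ K) (hσ : 0 < σ) (hσ1 : σ ≤ 1) (hv : 0 ≤ v) :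
    ∫ s in σ..1, (1 - Real.log s) * (K + 2 * v ^ 2 / (s + v) ^ 3) ≤
      2 * K + 1 + 2 * (if v = 0 then 0 else Real.log ((1 + v) / v)) := by
  have hpos : ∀ s ∈ Set.Icc σ 1, 0 < s := fun s hs => hσ.trans_le hs.1
  have hcont : ContinuousOn (fun s => (1 - Real.log s) * (K + 2 * v ^ 2 / (s + v) ^ 3))
      (Set.uIcc σ 1) := by
    rw [Set.uIcc_of_le hσ1]
    refine ContinuousOn.mul (continuousOn_const.sub
      (Real.continuousOn_log.mono fun s hs => (hpos s hs).ne')) ?_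
    refine continuousOn_const.add (continuousOn_const.div (by fun_prop) fun s hs => ?_)
    have := hpos s hs; positivity
  have hl : ∀ s ∈ Set.Icc σ 1, Real.log s ≤ 0 := fun s hs => Real.log_nonpos (hpos s hs).le hs.2
  rcases eq_or_lt_of_le hv with h0 | hv'
  · subst h0
    have : ∀ s ∈ Set.uIcc σ 1, HasDerivAt (fun s => K * (2 * s - s * Real.log s))
        ((1 - Real.log s) * (K + 2 * 0 ^ 2 / (s + 0) ^ 3)) s := by
      intro s hs
      rw [Set.uIcc_of_le hσ1] at hs
      have hs0 := hpos s hs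
      refine ((((hasDerivAt_id s).const_mul 2).sub
        ((hasDerivAt_id s).mul (Real.hasDerivAt_log hs0.ne'))).const_mul K).congr_deriv ?_
      simp; field_simp; ring
    rw [intervalIntegral.integral_eq_sub_of_hasDerivAt this hcont.intervalIntegrable]
    have : 0 ≤ K * (2 * σ - σ * Real.log σ) := by
      have := hl σ ⟨le_rfl, hσ1⟩
      apply mul_nonneg hK; nlinarith
    simp at this ⊢; linarith
  · rw [if_neg hv'.ne']
    set D : ℝ → ℝ := fun s => K * (2 * s - s * Real.log s) + (1 - v ^ 2 / (s + v) ^ 2)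
      - Real.log s * (1 - v ^ 2 / (s + v) ^ 2) + 2 * Real.log (s + v) with hD
    have hd : ∀ s ∈ Set.uIcc σ 1, HasDerivAt D
        ((1 - Real.log s) * (K + 2 * v ^ 2 / (s + v) ^ 3) +
          (2 / (s + v) - (1 - v ^ 2 / (s + v) ^ 2) / s)) s := by
      intro s hs
      rw [Set.uIcc_of_le hσ1] at hs
      have hs0 := hpos s hs
      have hsv : s + v ≠ 0 := by positivity
      have hB : HasDerivAt (fun s => 1 - v ^ 2 / (s + v) ^ 2) (2 * v ^ 2 / (s + v) ^ 3) s := by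
        have h : (s + v) ^ 2 ≠ 0 := by positivity
        have h1 := (hasDerivAt_const s (v ^ 2)).div (((hasDerivAt_id s).add_const v).pow 2) h
        refine (h1.const_sub 1).congr_deriv ?_
        simp; field_simp
      have h1 := (((hasDerivAt_id s).const_mul 2).sub
        ((hasDerivAt_id s).mul (Real.hasDerivAt_log hs0.ne'))).const_mul K
      have h2 := (((h1.add hB).sub ((Real.hasDerivAt_log hs0.ne').mul hB)).add
        ((((hasDerivAt_id s).add_const v).log hsv).const_mul 2))
      refine h2.congr_deriv ?_
      simp; field_simp; ring
    have hc2 : ContinuousOn (fun s => (1 - Real.log s) * (K + 2 * v ^ 2 / (s + v) ^ 3) +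
          (2 / (s + v) - (1 - v ^ 2 / (s + v) ^ 2) / s)) (Set.uIcc σ 1) := by
      refine hcont.add ?_
      rw [Set.uIcc_of_le hσ1]
      refine ContinuousOn.sub (continuousOn_const.div (by fun_prop) fun s hs => ?_)
        (ContinuousOn.div (continuousOn_const.sub
          (continuousOn_const.div (by fun_prop) fun s hs => ?_)) continuousOn_id fun s hs => ?_)
      · have := hpos s hs; positivity
      · have := hpos s hs; positivity
      · exact (hpos s hs).ne'
    have hle : ∫ s in σ..1, (1 - Real.log s) * (K + 2 * v ^ 2 / (s + v) ^ 3) ≤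
        ∫ s in σ..1, ((1 - Real.log s) * (K + 2 * v ^ 2 / (s + v) ^ 3) +
          (2 / (s + v) - (1 - v ^ 2 / (s + v) ^ 2) / s)) := by
      refine intervalIntegral.integral_mono_on hσ1 hcont.intervalIntegrable hc2.intervalIntegrable
        fun s hs => ?_
      have hs0 := hpos s hs
      have : (1 - v ^ 2 / (s + v) ^ 2) / s ≤ 2 / (s + v) := by
        rw [one_sub_div (by positivity), div_div, div_le_div_iff₀ (by positivity) (by positivity)]
        have : 0 ≤ s ^ 3 + s ^ 2 * v := by positivity
        nlinarith
      linarith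
    rw [intervalIntegral.integral_eq_sub_of_hasDerivAt hd hc2.intervalIntegrable] at hle
    refine hle.trans ?_
    have hB0 : ∀ s : ℝ, 0 < s → 0 ≤ 1 - v ^ 2 / (s + v) ^ 2 := fun s hs => by
      rw [sub_nonneg, div_le_iff₀ (by positivity)]; nlinarith
    have hB1 : 1 - v ^ 2 / (1 + v) ^ 2 ≤ 1 := by
      have : 0 ≤ v ^ 2 / (1 + v) ^ 2 := by positivity
      linarith
    have hlσ := hl σ ⟨le_rfl, hσ1⟩
    have : Real.log v ≤ Real.log (σ + v) := Real.log_le_log hv' (by linarith)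
    rw [Real.log_div (by positivity) hv'.ne']
    have h3 : 0 ≤ K * (2 * σ - σ * Real.log σ) := mul_nonneg hK (by nlinarith)
    have h4 := hB0 σ hσ
    have h5 : 0 ≤ -Real.log σ * (1 - v ^ 2 / (σ + v) ^ 2) := mul_nonneg (by linarith) h4
    simp only [hD, Real.log_one]
    linarith

section

/-- The boundary pairing in Green's formula. -/
def gPair (A : ℝ) (u us : ℝ → ℝ → ℝ) (v : ℝ → ℝ) (s θ : ℝ) : ℝ :=
  u s θ * gPhiS A s (v θ) - us s θ * gPhi A s (v θ)

/-- The tangential part of the Laplacian pairing in Green's formula. -/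
def gTan (A : ℝ) (u utt : ℝ → ℝ → ℝ) (v v1 v2 : ℝ → ℝ) (s θ : ℝ) : ℝ :=
  u s θ * gPhiTT s (v θ) (v1 θ) (v2 θ) - utt s θ * gPhi A s (v θ)

/-- The logarithmic majorant attached to a weight. -/
def logMajorant (v : ℝ → ℝ) (θ : ℝ) : ℝ := if v θ = 0 then 0 else Real.log ((1 + v θ) / v θ)

section
variable {u us uss ut utt : ℝ → ℝ → ℝ} {x₀ A C B : ℝ} {v v1 v2 : ℝ → ℝ}

lemma GreenWeight.A_nonneg (hv : GreenWeight x₀ A C v v1 v2) : 0 ≤ A := by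
  have := (abs_nonneg _).trans (hv.bound 0); linarith

lemma GreenWeight.continuous (hv : GreenWeight x₀ A C v v1 v2) : Continuous v :=
  continuous_iff_continuousAt.2 fun θ => (hv.d1 θ).continuousAt

lemma GreenWeight.continuous' (hv : GreenWeight x₀ A C v v1 v2) : Continuous v1 :=
  continuous_iff_continuousAt.2 fun θ => (hv.d2 θ).continuousAt

lemma measurable_gTan (hu : CylinderSubharmonic u us uss ut utt)
    (hv : GreenWeight x₀ A C v v1 v2) :
    Measurable fun x : ℝ × ℝ => gTan A u utt v v1 v2 x.1 x.2 := by
  have h0 := hu.cu.measurable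
  have h1 := hu.cutt.measurable
  have m0 := hv.continuous.measurable
  have m1 := hv.continuous'.measurable
  have m2 := hv.meas
  unfold gTan gPhiTT gPhi
  fun_prop

lemma abs_gTan_le (hC : 0 ≤ C) (hu : CylinderSubharmonic u us uss ut utt)
    (hv : GreenWeight x₀ A C v v1 v2) :
    ∃ M, ∀ s ∈ Ioc (0:ℝ) 1, ∀ θ ∈ Icc x₀ (x₀ + 2 * Real.pi), |gTan A u utt v v1 v2 s θ| ≤ M := by
  have hA := hv.A_nonneg
  have hK : IsCompact (Icc (0:ℝ) 1 ×ˢ Icc x₀ (x₀ + 2 * Real.pi)) := isCompact_Icc.prod isCompact_Icc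
  obtain ⟨M1, h1⟩ := hK.exists_bound_of_continuousOn hu.cu.continuousOn
  obtain ⟨M2, h2⟩ := hK.exists_bound_of_continuousOn hu.cutt.continuousOn
  refine ⟨M1 * (2 * C + 2 * A) + M2 * (1 + A), fun s hs θ hθ => ?_⟩
  have b1 := h1 (s, θ) ⟨⟨hs.1.le, hs.2⟩, hθ⟩
  have b2 := h2 (s, θ) ⟨⟨hs.1.le, hs.2⟩, hθ⟩
  rw [Real.norm_eq_abs] at b1 b2
  have e1 := abs_gPhiTT_le hC hs.1 (hv.nonneg θ) (hv.sq θ) (hv.bound θ)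
  have e2 : |gPhiTT s (v θ) (v1 θ) (v2 θ)| ≤ 2 * C + 2 * A := abs_le.2 ⟨by linarith, e1.2⟩
  have e3 := gPhi_nonneg hA hs.1 (hv.nonneg θ)
  have e4 : gPhi A s (v θ) ≤ 1 + A := by
    refine (gPhi_le hs.1 (hv.nonneg θ)).trans ?_
    have : s ^ 2 ≤ 1 := by nlinarith [hs.1, hs.2]
    nlinarith [hs.2]
  unfold gTan
  refine (abs_sub _ _).trans ?_
  rw [abs_mul, abs_mul, abs_of_nonneg e3]
  gcongr
  · exact (abs_nonneg _).trans b1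
  · exact (abs_nonneg _).trans b2

lemma integral_gTan (hC : 0 ≤ C) (hu : CylinderSubharmonic u us uss ut utt)
    (hv : GreenWeight x₀ A C v v1 v2) {s : ℝ} (hs : s ∈ Ioc (0:ℝ) 1) :
    ∫ θ in x₀..(x₀ + 2 * Real.pi), gTan A u utt v v1 v2 s θ = 0 := by
  have hd : ∀ θ ∈ uIcc x₀ (x₀ + 2 * Real.pi), HasDerivAt
      (fun θ => u s θ * gPhiT s (v θ) (v1 θ) - ut s θ * gPhi A s (v θ))
      (gTan A u utt v v1 v2 s θ) θ := by
    intro θ _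
    refine (((hu.dt s θ).mul (hasDerivAt_gPhiT hs.1 (hv.nonneg θ) (hv.d1 θ) (hv.d2 θ))).sub
      ((hu.dtt s θ).mul (hasDerivAt_gPhi_snd A hs.1 (hv.nonneg θ) (hv.d1 θ)))).congr_deriv ?_
    unfold gTan; ring
  have hle : x₀ ≤ x₀ + 2 * Real.pi := by linarith [Real.pi_pos]
  obtain ⟨M, hM⟩ := abs_gTan_le hC hu hv
  have hint : IntervalIntegrable (gTan A u utt v v1 v2 s) volume x₀ (x₀ + 2 * Real.pi) := by
    rw [intervalIntegrable_iff_integrableOn_Ioc_of_le hle]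
    refine Measure.integrableOn_of_bounded (M := M) measure_Ioc_lt_top.ne
      ((measurable_gTan hu hv).comp (by fun_prop : Measurable fun θ : ℝ => (s, θ))).aestronglyMeasurable ?_
    refine (ae_restrict_iff' measurableSet_Ioc).2 (Eventually.of_forall fun θ hθ => ?_)
    exact hM s hs θ ⟨hθ.1.le, hθ.2⟩
  rw [intervalIntegral.integral_eq_sub_of_hasDerivAt hd hint]
  simp only [hv.left, hv.right, hv.left', hv.right', hu.peru]
  have : ut s (x₀ + 2 * Real.pi) = ut s x₀ := hu.perut s x₀
  rw [this]; ring

lemma integral_integral_gTan (hC : 0 ≤ C) (hu : CylinderSubharmonic u us uss ut utt)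
    (hv : GreenWeight x₀ A C v v1 v2) {σ : ℝ} (hσ : σ ∈ Ioc (0:ℝ) 1) :
    IntervalIntegrable (fun θ => ∫ s in σ..1, gTan A u utt v v1 v2 s θ) volume
      x₀ (x₀ + 2 * Real.pi) ∧
    ∫ θ in x₀..(x₀ + 2 * Real.pi), ∫ s in σ..1, gTan A u utt v v1 v2 s θ = 0 := by
  have hle : x₀ ≤ x₀ + 2 * Real.pi := by linarith [Real.pi_pos]
  obtain ⟨M, hM⟩ := abs_gTan_le hC hu hv
  have hI : Integrable (fun x : ℝ × ℝ => gTan A u utt v v1 v2 x.2 x.1)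
      ((volume.restrict (Ioc x₀ (x₀ + 2 * Real.pi))).prod (volume.restrict (Ioc σ 1))) := by
    rw [Measure.prod_restrict]
    refine Measure.integrableOn_of_bounded (M := M) ?_
      ((measurable_gTan hu hv).comp measurable_swap).aestronglyMeasurable ?_
    · rw [Measure.prod_prod]; exact ENNReal.mul_ne_top measure_Ioc_lt_top.ne measure_Ioc_lt_top.ne
    · refine (ae_restrict_iff' (measurableSet_Ioc.prod measurableSet_Ioc)).2
        (Eventually.of_forall fun x hx => ?_)
      exact hM x.2 ⟨hσ.1.trans hx.2.1, hx.2.2⟩ x.1 ⟨hx.1.1.le, hx.1.2⟩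
  constructor
  · rw [intervalIntegrable_iff_integrableOn_Ioc_of_le hle]
    simp_rw [intervalIntegral.integral_of_le hσ.2]
    exact hI.integral_prod_left
  · simp_rw [intervalIntegral.integral_of_le hσ.2, intervalIntegral.integral_of_le hle]
    rw [integral_integral_swap hI]
    refine (setIntegral_congr_fun (g := fun _ => 0) measurableSet_Ioc fun s hs => ?_).trans (by simp)
    have := integral_gTan hC hu hv (s := s) ⟨hσ.1.trans hs.1, hs.2⟩
    rwa [intervalIntegral.integral_of_le hle] at this

lemma continuous_gPair (hu : CylinderSubharmonic u us uss ut utt)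
    (hv : GreenWeight x₀ A C v v1 v2) {s : ℝ} (hs : 0 < s) :
    Continuous (gPair A u us v s) := by
  have h0 : Continuous fun θ => u s θ := hu.cu.comp (by fun_prop : Continuous fun θ : ℝ => (s, θ))
  have h1 : Continuous fun θ => us s θ := hu.cus.comp (by fun_prop : Continuous fun θ : ℝ => (s, θ))
  have h2 := hv.continuous
  have h3 : ∀ θ, s + v θ ≠ 0 := fun θ => by have := hv.nonneg θ; positivity
  unfold gPair gPhiS gPhi
  have k1 : Continuous fun θ => v θ ^ 2 / (s + v θ) ^ 2 :=
    (h2.pow 2).div ((h2.const_add s).pow 2) fun θ => pow_ne_zero 2 (h3 θ)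
  have k2 : Continuous fun θ => s ^ 2 / (s + v θ) := continuous_const.div (h2.const_add s) h3
  fun_prop

lemma gPair_sub_le (hC : 0 ≤ C) (hB : 0 ≤ B) (hu : CylinderSubharmonic u us uss ut utt)
    (hv : GreenWeight x₀ A C v v1 v2)
    (hub : ∀ s ∈ Ioc (0:ℝ) 1, ∀ θ, u s θ ≤ B * (1 - Real.log s)) {σ : ℝ} (hσ : σ ∈ Ioc (0:ℝ) 1)
    {θ : ℝ} (hθ : θ ∈ Icc x₀ (x₀ + 2 * Real.pi)) :
    gPair A u us v 1 θ - gPair A u us v σ θ ≤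
      B * (2 * (2 * C + 4 * A) + 1 + 2 * logMajorant v θ)
        - ∫ s in σ..1, gTan A u utt v v1 v2 s θ := by
  have hA := hv.A_nonneg
  have hpos : ∀ s ∈ Icc σ 1, 0 < s := fun s hs => hσ.1.trans_le hs.1
  have hv0 := hv.nonneg θ
  have hsv : ∀ s ∈ Icc σ 1, s + v θ ≠ 0 := fun s hs => by have := hpos s hs; positivity
  have cu : Continuous fun s => u s θ := hu.cu.comp (by fun_prop : Continuous fun s : ℝ => (s, θ))
  have cuss : Continuous fun s => uss s θ :=
    hu.cuss.comp (by fun_prop : Continuous fun s : ℝ => (s, θ))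
  have hd : ∀ s ∈ uIcc σ 1, HasDerivAt (fun s => gPair A u us v s θ)
      (u s θ * gPhiSS A s (v θ) - uss s θ * gPhi A s (v θ)) s := by
    intro s hs
    rw [uIcc_of_le hσ.2] at hs
    refine (((hu.du s θ).mul (hasDerivAt_gPhiS A (hpos s hs) hv0)).sub
      ((hu.dus s θ).mul (hasDerivAt_gPhi A (hpos s hs) hv0))).congr_deriv ?_
    ring
  have hc1 : ContinuousOn (fun s => u s θ * gPhiSS A s (v θ) - uss s θ * gPhi A s (v θ))
      (Icc σ 1) := by
    refine (cu.continuousOn.mul ?_).sub (cuss.continuousOn.mul ?_)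
    · exact (continuousOn_const.div (by fun_prop) fun s hs => pow_ne_zero 3 (hsv s hs)).add
        continuousOn_const
    · exact (ContinuousOn.div (by fun_prop) (by fun_prop) hsv).add (by fun_prop)
  have hc2 : ContinuousOn (fun s => (1 - Real.log s) * ((2 * C + 4 * A) + 2 * v θ ^ 2 / (s + v θ) ^ 3))
      (Icc σ 1) := by
    refine ContinuousOn.mul (continuousOn_const.sub
      (Real.continuousOn_log.mono fun s hs => (hpos s hs).ne')) ?_
    exact continuousOn_const.add (continuousOn_const.div (by fun_prop) fun s hs =>
      pow_ne_zero 3 (hsv s hs))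
  rw [← uIcc_of_le hσ.2] at hc1 hc2
  have i1 := hc1.intervalIntegrable (μ := volume)
  have i2 := hc2.intervalIntegrable (μ := volume)
  obtain ⟨M, hM⟩ := abs_gTan_le hC hu hv
  have i3 : IntervalIntegrable (fun s => gTan A u utt v v1 v2 s θ) volume σ 1 := by
    rw [intervalIntegrable_iff_integrableOn_Ioc_of_le hσ.2]
    refine Measure.integrableOn_of_bounded (M := M) measure_Ioc_lt_top.ne
      ((measurable_gTan hu hv).comp (by fun_prop : Measurable fun s : ℝ => (s, θ))).aestronglyMeasurable ?_
    refine (ae_restrict_iff' measurableSet_Ioc).2 (Eventually.of_forall fun s hs => ?_)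
    exact hM s ⟨hσ.1.trans hs.1, hs.2⟩ θ hθ
  rw [← intervalIntegral.integral_eq_sub_of_hasDerivAt hd i1]
  have key := integral_log_weight_le (K := 2 * C + 4 * A) (by positivity) hσ.1 hσ.2 hv0
  have hmono := intervalIntegral.integral_mono_on hσ.2 i1 ((i2.const_mul B).sub i3) fun s hs => by
    have hs0 := hpos s hs
    have h1 := hub s ⟨hs0, hs.2⟩ θ
    have h2 := abs_gPhiTT_le hC hs0 hv0 (hv.sq θ) (hv.bound θ)
    have h3 := gPhi_nonneg hA hs0 hv0
    have h4 := hu.lap s θ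
    have h5 : 0 ≤ 2 * v θ ^ 2 / (s + v θ) ^ 3 := by positivity
    have h6 : 0 ≤ 1 - Real.log s := by
      have := Real.log_nonpos hs0.le hs.2; linarith
    have h7 : 0 ≤ gPhiSS A s (v θ) + gPhiTT s (v θ) (v1 θ) (v2 θ) := by
      unfold gPhiSS; linarith [h2.1]
    have h8 : gPhiSS A s (v θ) + gPhiTT s (v θ) (v1 θ) (v2 θ) ≤
        2 * C + 4 * A + 2 * v θ ^ 2 / (s + v θ) ^ 3 := by
      unfold gPhiSS; linarith [h2.2]
    have h9 : u s θ * (gPhiSS A s (v θ) + gPhiTT s (v θ) (v1 θ) (v2 θ)) ≤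
        B * (1 - Real.log s) * (2 * C + 4 * A + 2 * v θ ^ 2 / (s + v θ) ^ 3) := by
      refine (mul_le_mul_of_nonneg_right h1 h7).trans ?_
      exact mul_le_mul_of_nonneg_left h8 (by positivity)
    have h10 := mul_nonneg h4 h3
    show _ ≤ B * _ - gTan A u utt v v1 v2 s θ
    unfold gTan
    linarith
  refine hmono.trans ?_
  rw [intervalIntegral.integral_sub (i2.const_mul B) i3, intervalIntegral.integral_const_mul]
  have := mul_le_mul_of_nonneg_left key hB
  unfold logMajorant
  linarith

/-- Green's inequality on the annulus in logarithmic coordinates. -/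
lemma integral_gPair_ge (hC : 0 ≤ C) (hB : 0 ≤ B) (hu : CylinderSubharmonic u us uss ut utt)
    (hv : GreenWeight x₀ A C v v1 v2)
    (hub : ∀ s ∈ Ioc (0:ℝ) 1, ∀ θ, u s θ ≤ B * (1 - Real.log s))
    (hΛ : IntervalIntegrable (logMajorant v) volume x₀ (x₀ + 2 * Real.pi))
    {c : ℝ} (hc : ∀ θ, |u 1 θ| ≤ c ∧ |us 1 θ| ≤ c) {σ : ℝ} (hσ : σ ∈ Ioc (0:ℝ) 1) :
    -(2 * Real.pi * c * (2 + 3 * A)) - B * (2 * Real.pi * (2 * (2 * C + 4 * A) + 1)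
      + 2 * ∫ θ in x₀..(x₀ + 2 * Real.pi), logMajorant v θ) ≤
      ∫ θ in x₀..(x₀ + 2 * Real.pi), gPair A u us v σ θ := by
  have hA := hv.A_nonneg
  have hle : x₀ ≤ x₀ + 2 * Real.pi := by linarith [Real.pi_pos]
  have i1 := (continuous_gPair hu hv one_pos).intervalIntegrable (μ := volume) x₀ (x₀ + 2 * Real.pi)
  have iσ := (continuous_gPair hu hv hσ.1).intervalIntegrable (μ := volume) x₀ (x₀ + 2 * Real.pi)
  obtain ⟨iT, hT⟩ := integral_integral_gTan hC hu hv hσ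
  have iL : IntervalIntegrable (fun θ => B * (2 * (2 * C + 4 * A) + 1 + 2 * logMajorant v θ))
      volume x₀ (x₀ + 2 * Real.pi) :=
    (intervalIntegrable_const.add (hΛ.const_mul 2)).const_mul B
  have hm := intervalIntegral.integral_mono_on hle (i1.sub iσ) (iL.sub iT)
    fun θ hθ => gPair_sub_le hC hB hu hv hub hσ hθ
  rw [intervalIntegral.integral_sub i1 iσ, intervalIntegral.integral_sub iL iT, hT,
    intervalIntegral.integral_const_mul,
    intervalIntegral.integral_add intervalIntegrable_const (hΛ.const_mul 2),
    intervalIntegral.integral_const, intervalIntegral.integral_const_mul] at hm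
  have h1 : ∫ θ in x₀..(x₀ + 2 * Real.pi), -(c * (2 + 3 * A)) ≤
      ∫ θ in x₀..(x₀ + 2 * Real.pi), gPair A u us v 1 θ := by
    refine intervalIntegral.integral_mono_on hle intervalIntegrable_const i1 fun θ _ => ?_
    have k1 := gPhi_nonneg hA one_pos (hv.nonneg θ)
    have k2 := gPhi_le (A := A) one_pos (hv.nonneg θ)
    have k3 := gPhiS_nonneg hA one_pos (hv.nonneg θ)
    have k4 := gPhiS_le (A := A) (s := 1) (v := v θ)
    obtain ⟨c1, c2⟩ := hc θ
    have hc0 := (abs_nonneg _).trans c1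
    rw [abs_le] at c1 c2
    unfold gPair
    have e1 : -(c * (1 + 2 * A)) ≤ u 1 θ * gPhiS A 1 (v θ) := by nlinarith
    have e2 : us 1 θ * gPhi A 1 (v θ) ≤ c * (1 + A) := by nlinarith
    nlinarith
  rw [intervalIntegral.integral_const] at h1
  simp only [smul_eq_mul, add_sub_cancel_left] at h1 hm
  nlinarith

lemma tendsto_integral_gPair (hu : CylinderSubharmonic u us uss ut utt)
    (hv : GreenWeight x₀ A C v v1 v2) :
    Tendsto (fun n : ℕ => ∫ θ in x₀..(x₀ + 2 * Real.pi), gPair A u us v (1 / ((n : ℝ) + 1)) θ) atTop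
      (𝓝 (∫ θ in x₀..(x₀ + 2 * Real.pi), if v θ = 0 then u 0 θ else 0)) := by
  have hA := hv.A_nonneg
  have hle : x₀ ≤ x₀ + 2 * Real.pi := by linarith [Real.pi_pos]
  have hK : IsCompact (Icc (0:ℝ) 1 ×ˢ Icc x₀ (x₀ + 2 * Real.pi)) := isCompact_Icc.prod isCompact_Icc
  obtain ⟨M1, h1⟩ := hK.exists_bound_of_continuousOn hu.cu.continuousOn
  obtain ⟨M2, h2⟩ := hK.exists_bound_of_continuousOn hu.cus.continuousOn
  have hs : ∀ n : ℕ, (1 / ((n : ℝ) + 1)) ∈ Ioc (0:ℝ) 1 := fun n =>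
    ⟨by positivity, by rw [div_le_one (by positivity)]; linarith [(Nat.cast_nonneg n : (0:ℝ) ≤ n)]⟩
  have hlim := tendsto_one_div_add_atTop_nhds_zero_nat (𝕜 := ℝ)
  refine intervalIntegral.tendsto_integral_filter_of_dominated_convergence
    (fun _ => M1 * (1 + 2 * A) + M2 * (1 + A)) ?_ ?_ intervalIntegrable_const ?_
  · exact Eventually.of_forall fun n => (continuous_gPair hu hv (hs n).1).aestronglyMeasurable
  · refine Eventually.of_forall fun n => Eventually.of_forall fun θ hθ => ?_
    rw [uIoc_of_le hle] at hθ
    set s := 1 / ((n : ℝ) + 1)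
    have hsn := hs n
    have b1 := h1 (s, θ) ⟨⟨hsn.1.le, hsn.2⟩, hθ.1.le, hθ.2⟩
    have b2 := h2 (s, θ) ⟨⟨hsn.1.le, hsn.2⟩, hθ.1.le, hθ.2⟩
    have k1 := gPhi_nonneg hA hsn.1 (hv.nonneg θ)
    have k2 := gPhi_le (A := A) hsn.1 (hv.nonneg θ)
    have k3 := gPhiS_nonneg hA hsn.1 (hv.nonneg θ)
    have k4 := gPhiS_le (A := A) (s := s) (v := v θ)
    rw [Real.norm_eq_abs] at b1 b2 ⊢
    have hs2 : s ^ 2 ≤ 1 := by nlinarith [hsn.1, hsn.2]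
    unfold gPair
    refine (abs_sub _ _).trans ?_
    rw [abs_mul, abs_mul, abs_of_nonneg k1, abs_of_nonneg k3]
    refine add_le_add (mul_le_mul b1 ?_ k3 ((abs_nonneg _).trans b1))
      (mul_le_mul b2 ?_ k1 ((abs_nonneg _).trans b2))
    · nlinarith [hsn.2]
    · nlinarith [hsn.2]
  · refine Eventually.of_forall fun θ _ => ?_
    have cu : Continuous fun s => u s θ := hu.cu.comp (by fun_prop : Continuous fun s : ℝ => (s, θ))
    have cus : Continuous fun s => us s θ :=
      hu.cus.comp (by fun_prop : Continuous fun s : ℝ => (s, θ))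
    by_cases h0 : v θ = 0
    · have e : ∀ n : ℕ, gPair A u us v (1 / ((n : ℝ) + 1)) θ =
          (fun s => u s θ * (1 + 2 * A * s) - us s θ * (s + A * s ^ 2)) (1 / ((n : ℝ) + 1)) := by
        intro n
        have := (hs n).1.ne'
        simp only [gPair, gPhi, gPhiS, h0, add_zero]
        congr 2
        · simp
        · rw [pow_two, mul_div_assoc, div_self this, mul_one]
      simp_rw [e, if_pos h0]
      have hc : Continuous fun s => u s θ * (1 + 2 * A * s) - us s θ * (s + A * s ^ 2) := by fun_prop
      exact (hc.tendsto' 0 (u 0 θ) (by simp)).comp hlim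
    · have hvp : 0 < v θ := lt_of_le_of_ne (hv.nonneg θ) (Ne.symm h0)
      rw [if_neg h0]
      have hc : ContinuousAt (fun s => gPair A u us v s θ) 0 := by
        unfold gPair gPhiS gPhi
        have k1 : ContinuousAt (fun s : ℝ => v θ ^ 2 / (s + v θ) ^ 2) 0 :=
          ContinuousAt.div (by fun_prop) (by fun_prop) (by simpa using h0)
        have k2 : ContinuousAt (fun s : ℝ => s ^ 2 / (s + v θ)) 0 :=
          ContinuousAt.div (by fun_prop) (by fun_prop) (by simpa using h0)
        exact (cu.continuousAt.mul ((continuousAt_const.sub k1).add (by fun_prop))).sub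
          (cus.continuousAt.mul (k2.add (by fun_prop)))
      have := hc.tendsto.comp hlim
      have e0 : gPair A u us v 0 θ = 0 := by
        simp [gPair, gPhiS, gPhi, h0]
      rwa [e0] at this

/-- Lower bound for the boundary integral of a subharmonic function over the zero set of `v`. -/
theorem integral_zero_set_ge (hC : 0 ≤ C) (hB : 0 ≤ B) (hu : CylinderSubharmonic u us uss ut utt)
    (hv : GreenWeight x₀ A C v v1 v2)
    (hub : ∀ s ∈ Ioc (0:ℝ) 1, ∀ θ, u s θ ≤ B * (1 - Real.log s))
    (hΛ : IntervalIntegrable (logMajorant v) volume x₀ (x₀ + 2 * Real.pi))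
    {c : ℝ} (hc : ∀ θ, |u 1 θ| ≤ c ∧ |us 1 θ| ≤ c) :
    -(2 * Real.pi * c * (2 + 3 * A)) - B * (2 * Real.pi * (2 * (2 * C + 4 * A) + 1)
      + 2 * ∫ θ in x₀..(x₀ + 2 * Real.pi), logMajorant v θ) ≤
      ∫ θ in x₀..(x₀ + 2 * Real.pi), if v θ = 0 then u 0 θ else 0 :=
  ge_of_tendsto' (tendsto_integral_gPair hu hv) fun n =>
    integral_gPair_ge hC hB hu hv hub hΛ hc ⟨by positivity, by
      rw [div_le_one (by positivity)]; linarith [(Nat.cast_nonneg n : (0:ℝ) ≤ n)]⟩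
end

end

section

/-- The parabola `(x - a k) (b k - x)` on each interval `(a k, b k)`, extended by zero. -/
def bump (a b : ℕ → ℝ) (x : ℝ) : ℝ :=
  open Classical in if h : ∃ k, x ∈ Ioo (a k) (b k) then
    (x - a h.choose) * (b h.choose - x) else 0

/-- The derivative of `bump` inside the intervals, extended by zero. -/
def bumpDeriv (a b : ℕ → ℝ) (x : ℝ) : ℝ :=
  open Classical in if h : ∃ k, x ∈ Ioo (a k) (b k) then a h.choose + b h.choose - 2 * x else 0

section bump

variable {a b : ℕ → ℝ} {x₀ : ℝ}

lemma bump_of_mem (hd : Pairwise (Function.onFun Disjoint fun k => Ioo (a k) (b k))) {k : ℕ} {x : ℝ}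
    (hx : x ∈ Ioo (a k) (b k)) :
    bump a b x = (x - a k) * (b k - x) ∧ bumpDeriv a b x = a k + b k - 2 * x := by
  have h : ∃ k, x ∈ Ioo (a k) (b k) := ⟨k, hx⟩
  have e : h.choose = k := by
    by_contra hne
    exact disjoint_left.1 (hd hne) h.choose_spec hx
  simp only [bump, bumpDeriv, dif_pos h, e, and_self]

lemma bump_of_notMem {x : ℝ} (hx : ∀ k, x ∉ Ioo (a k) (b k)) :
    bump a b x = 0 ∧ bumpDeriv a b x = 0 := by
  have h : ¬ ∃ k, x ∈ Ioo (a k) (b k) := by simpa using hx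
  simp only [bump, bumpDeriv, dif_neg h, and_self]

lemma bump_eq_zero_iff (hd : Pairwise (Function.onFun Disjoint fun k => Ioo (a k) (b k))) {x : ℝ} :
    bump a b x = 0 ↔ ∀ k, x ∉ Ioo (a k) (b k) := by
  refine ⟨fun h k hk => ?_, fun h => (bump_of_notMem h).1⟩
  rw [(bump_of_mem hd hk).1] at h
  exact (mul_pos (sub_pos.2 hk.1) (sub_pos.2 hk.2)).ne' h

lemma bump_bounds (ha : ∀ k, x₀ ≤ a k) (hb : ∀ k, b k ≤ x₀ + 2 * Real.pi)
    (hd : Pairwise (Function.onFun Disjoint fun k => Ioo (a k) (b k))) (x : ℝ) :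
    0 ≤ bump a b x ∧ bump a b x ≤ 10 ∧ bumpDeriv a b x ^ 2 ≤ 40 := by
  by_cases h : ∃ k, x ∈ Ioo (a k) (b k)
  · obtain ⟨k, hk⟩ := h
    rw [(bump_of_mem hd hk).1, (bump_of_mem hd hk).2]
    have h1 := hk.1
    have h2 := hk.2
    have hl : b k - a k ≤ 6.3 := by linarith [ha k, hb k, Real.pi_lt_d2]
    refine ⟨mul_nonneg (by linarith) (by linarith), ?_, ?_⟩ <;> nlinarith [sq_nonneg (a k + b k - 2 * x)]
  · push Not at h
    rw [(bump_of_notMem h).1, (bump_of_notMem h).2]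
    norm_num

lemma bump_le_mul_abs (ha : ∀ k, x₀ ≤ a k) (hb : ∀ k, b k ≤ x₀ + 2 * Real.pi)
    (hd : Pairwise (Function.onFun Disjoint fun k => Ioo (a k) (b k))) {e : ℝ}
    (he : ∀ k, e ∉ Ioo (a k) (b k)) (x : ℝ) : bump a b x ≤ 7 * |x - e| := by
  by_cases h : ∃ k, x ∈ Ioo (a k) (b k)
  · obtain ⟨k, hk⟩ := h
    rw [(bump_of_mem hd hk).1]
    have h1 := hk.1
    have h2 := hk.2
    have hl : b k - a k ≤ 7 := by linarith [ha k, hb k, Real.pi_lt_d2]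
    have he' : e ≤ a k ∨ b k ≤ e := by
      have := he k
      rw [mem_Ioo, not_and_or] at this
      rcases this with h | h
      · exact Or.inl (not_lt.1 h)
      · exact Or.inr (not_lt.1 h)
    rcases he' with h | h
    · have := le_abs_self (x - e)
      nlinarith
    · have := neg_abs_le (x - e)
      nlinarith
  · push Not at h
    rw [(bump_of_notMem h).1]
    positivity

lemma hasDerivAt_zero_of_quadratic {f : ℝ → ℝ} {e M : ℝ} (h : ∀ x, |f x| ≤ M * |x - e| ^ 2) :
    HasDerivAt f 0 e := by
  have he : f e = 0 := by simpa using h e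
  rw [hasDerivAt_iff_isLittleO]
  simp only [he, sub_zero, smul_zero]
  have h1 : f =O[𝓝 e] fun x => (x - e) ^ 2 :=
    Asymptotics.IsBigO.of_bound M (Eventually.of_forall fun x => by simpa using h x)
  refine h1.trans_isLittleO ?_
  have := (Asymptotics.isLittleO_pow_id (𝕜 := ℝ) one_lt_two).comp_tendsto
    (show Tendsto (fun x : ℝ => x - e) (𝓝 e) (𝓝 0) from
      (by fun_prop : Continuous fun x : ℝ => x - e).tendsto' _ _ (by simp))
  exact this

lemma hasDerivAt_bump_pow_three (ha : ∀ k, x₀ ≤ a k) (hb : ∀ k, b k ≤ x₀ + 2 * Real.pi)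
    (hd : Pairwise (Function.onFun Disjoint fun k => Ioo (a k) (b k))) (x : ℝ) :
    HasDerivAt (fun x => bump a b x ^ 3) (3 * bump a b x ^ 2 * bumpDeriv a b x) x := by
  by_cases h : ∃ k, x ∈ Ioo (a k) (b k)
  · obtain ⟨k, hk⟩ := h
    rw [(bump_of_mem hd hk).1, (bump_of_mem hd hk).2]
    have e : (fun x => bump a b x ^ 3) =ᶠ[𝓝 x] fun x => ((x - a k) * (b k - x)) ^ 3 := by
      filter_upwards [isOpen_Ioo.mem_nhds hk] with y hy
      rw [(bump_of_mem hd hy).1]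
    refine HasDerivAt.congr_of_eventuallyEq ?_ e
    have := ((((hasDerivAt_id x).sub_const (a k)).mul ((hasDerivAt_id x).const_sub (b k))).pow 3)
    refine this.congr_deriv ?_
    simp only [Pi.mul_apply, id_eq]
    push_cast
    ring
  · push Not at h
    rw [(bump_of_notMem h).1, (bump_of_notMem h).2]
    norm_num
    refine hasDerivAt_zero_of_quadratic (M := 490) fun y => ?_
    have b1 := bump_bounds ha hb hd y
    have b2 := bump_le_mul_abs ha hb hd h y
    rw [abs_of_nonneg (pow_nonneg b1.1 3)]
    calc bump a b y ^ 3 = bump a b y * bump a b y ^ 2 := by ring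
      _ ≤ 10 * (7 * |y - x|) ^ 2 := by
        gcongr
        · exact b1.2.1
        · exact b1.1
      _ = _ := by ring

lemma hasDerivAt_bump_sq_mul (ha : ∀ k, x₀ ≤ a k) (hb : ∀ k, b k ≤ x₀ + 2 * Real.pi)
    (hd : Pairwise (Function.onFun Disjoint fun k => Ioo (a k) (b k))) (x : ℝ) :
    HasDerivAt (fun x => 3 * bump a b x ^ 2 * bumpDeriv a b x)
      (6 * bump a b x * bumpDeriv a b x ^ 2 - 6 * bump a b x ^ 2) x := by
  by_cases h : ∃ k, x ∈ Ioo (a k) (b k)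
  · obtain ⟨k, hk⟩ := h
    rw [(bump_of_mem hd hk).1, (bump_of_mem hd hk).2]
    have e : (fun x => 3 * bump a b x ^ 2 * bumpDeriv a b x) =ᶠ[𝓝 x]
        fun x => 3 * ((x - a k) * (b k - x)) ^ 2 * (a k + b k - 2 * x) := by
      filter_upwards [isOpen_Ioo.mem_nhds hk] with y hy
      rw [(bump_of_mem hd hy).1, (bump_of_mem hd hy).2]
    refine HasDerivAt.congr_of_eventuallyEq ?_ e
    have := ((((((hasDerivAt_id x).sub_const (a k)).mul
      ((hasDerivAt_id x).const_sub (b k))).pow 2).const_mul 3).mul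
      (((hasDerivAt_id x).const_mul 2).const_sub (a k + b k)))
    refine this.congr_deriv ?_
    simp; ring
  · push Not at h
    rw [(bump_of_notMem h).1, (bump_of_notMem h).2]
    norm_num
    refine hasDerivAt_zero_of_quadratic (M := 1029) fun y => ?_
    have b1 := bump_bounds ha hb hd y
    have b2 := bump_le_mul_abs ha hb hd h y
    have b3 : |bumpDeriv a b y| ≤ 7 := abs_le_of_sq_le_sq (by linarith [b1.2.2]) (by norm_num)
    rw [abs_mul, abs_mul, abs_of_nonneg (pow_nonneg b1.1 2)]
    calc |(3:ℝ)| * bump a b y ^ 2 * |bumpDeriv a b y| ≤ 3 * (7 * |y - x|) ^ 2 * 7 := by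
          gcongr
          · norm_num
          · exact b1.1
      _ = _ := by ring

lemma greenWeight_bump (ha : ∀ k, x₀ ≤ a k) (hb : ∀ k, b k ≤ x₀ + 2 * Real.pi)
    (hd : Pairwise (Function.onFun Disjoint fun k => Ioo (a k) (b k))) :
    GreenWeight x₀ 1500 3600 (fun x => bump a b x ^ 3)
      (fun x => 3 * bump a b x ^ 2 * bumpDeriv a b x)
      (fun x => 6 * bump a b x * bumpDeriv a b x ^ 2 - 6 * bump a b x ^ 2) := by
  have hl := bump_of_notMem (a := a) (b := b) (x := x₀) fun k hk => (ha k).not_gt hk.1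
  have hr := bump_of_notMem (a := a) (b := b) (x := x₀ + 2 * Real.pi) fun k hk => (hb k).not_gt hk.2
  refine ⟨fun x => pow_nonneg (bump_bounds ha hb hd x).1 3, hasDerivAt_bump_pow_three ha hb hd,
    hasDerivAt_bump_sq_mul ha hb hd, ?_, fun x => ?_, fun x => ?_, ?_, ?_, ?_, ?_⟩
  · rw [show (fun x => 6 * bump a b x * bumpDeriv a b x ^ 2 - 6 * bump a b x ^ 2) =
      deriv fun x => 3 * bump a b x ^ 2 * bumpDeriv a b x from
      funext fun x => (hasDerivAt_bump_sq_mul ha hb hd x).deriv.symm]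
    exact measurable_deriv _
  · obtain ⟨h1, h2, h3⟩ := bump_bounds ha hb hd x
    have h4 := sq_nonneg (bumpDeriv a b x)
    rw [abs_le]
    constructor <;> nlinarith [mul_nonneg h1 h4, mul_le_mul h2 h3 h4 (by norm_num)]
  · obtain ⟨h1, h2, h3⟩ := bump_bounds ha hb hd x
    calc (3 * bump a b x ^ 2 * bumpDeriv a b x) ^ 2
        = 9 * bump a b x * bumpDeriv a b x ^ 2 * bump a b x ^ 3 := by ring
      _ ≤ 9 * 10 * 40 * bump a b x ^ 3 := by gcongr
      _ = _ := by norm_num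
  all_goals simp [hl, hr]

lemma logMajorant_bump_le (ha : ∀ k, x₀ ≤ a k) (hb : ∀ k, b k ≤ x₀ + 2 * Real.pi)
    (hd : Pairwise (Function.onFun Disjoint fun k => Ioo (a k) (b k))) {k : ℕ} {x : ℝ}
    (hx : x ∈ Ioo (a k) (b k)) :
    logMajorant (fun x => bump a b x ^ 3) x ≤
      1000 - 3 * Real.log (x - a k) - 3 * Real.log (b k - x) := by
  have h1 : 0 < x - a k := sub_pos.2 hx.1
  have h2 : 0 < b k - x := sub_pos.2 hx.2
  have hy := (bump_of_mem hd hx).1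
  have hp : 0 < bump a b x := hy ▸ mul_pos h1 h2
  have h10 := (bump_bounds ha hb hd x).2.1
  have h3 : bump a b x ^ 3 ≤ 1000 := by
    calc bump a b x ^ 3 ≤ 10 ^ 3 := by gcongr
      _ = _ := by norm_num
  have hl : Real.log (1 + bump a b x ^ 3) ≤ 1000 := by
    have := Real.log_le_sub_one_of_pos (show 0 < 1 + bump a b x ^ 3 by positivity)
    linarith
  simp only [logMajorant, if_neg (pow_pos hp 3).ne']
  rw [Real.log_div (by positivity) (by positivity), Real.log_pow, hy,
    Real.log_mul h1.ne' h2.ne', ← hy]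
  push_cast
  linarith

lemma logMajorant_nonneg {v : ℝ → ℝ} {x : ℝ} (hv : 0 ≤ v x) : 0 ≤ logMajorant v x := by
  unfold logMajorant
  split_ifs with h
  · exact le_rfl
  · have : 0 < v x := lt_of_le_of_ne hv (Ne.symm h)
    exact Real.log_nonneg ((one_le_div this).2 (by linarith))

lemma lintegral_log_ends {a b : ℝ} (hab : a ≤ b)
    (hpos : ∀ x ∈ Ioo a b, 0 ≤ 1000 - 3 * Real.log (x - a) - 3 * Real.log (b - x)) :
    ∫⁻ x in Ioo a b, ENNReal.ofReal (1000 - 3 * Real.log (x - a) - 3 * Real.log (b - x)) ≤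
      1006 * ENNReal.ofReal (b - a) + 6 * ENNReal.ofReal ((b - a) * Real.log (1 / (b - a))) := by
  have i1 : IntervalIntegrable (fun x => Real.log (x - a)) volume a b := by
    have := (intervalIntegral.intervalIntegrable_log' (a := 0) (b := b - a)).comp_sub_right a
    simpa using this
  have i2 : IntervalIntegrable (fun x => Real.log (b - x)) volume a b := by
    have := (intervalIntegral.intervalIntegrable_log' (a := b - a) (b := 0)).comp_sub_left b
    simpa using this
  have i3 : IntervalIntegrable (fun x => 1000 - 3 * Real.log (x - a) - 3 * Real.log (b - x))
      volume a b := (intervalIntegrable_const.sub (i1.const_mul 3)).sub (i2.const_mul 3)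
  rw [← ofReal_integral_eq_lintegral_ofReal, ← integral_Ioc_eq_integral_Ioo,
    ← intervalIntegral.integral_of_le hab, intervalIntegral.integral_sub, intervalIntegral.integral_sub,
    intervalIntegral.integral_const, intervalIntegral.integral_const_mul,
    intervalIntegral.integral_const_mul, intervalIntegral.integral_comp_sub_right,
    intervalIntegral.integral_comp_sub_left, sub_self, integral_log]
  · rw [show (1006 : ENNReal) = ENNReal.ofReal 1006 by simp, show (6 : ENNReal) = ENNReal.ofReal 6 by simp,
      ← ENNReal.ofReal_mul (by norm_num), ← ENNReal.ofReal_mul (by norm_num)]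
    refine le_trans (ENNReal.ofReal_le_ofReal ?_) ENNReal.ofReal_add_le
    rw [one_div, Real.log_inv]
    simp; linarith
  · exact intervalIntegrable_const
  · exact i1.const_mul 3
  · exact intervalIntegrable_const.sub (i1.const_mul 3)
  · exact i2.const_mul 3
  · exact ((intervalIntegrable_iff_integrableOn_Ioo_of_le hab).1 i3)
  · exact (ae_restrict_iff' measurableSet_Ioo).2 (Eventually.of_forall hpos)

lemma intervalIntegrable_logMajorant_bump (ha : ∀ k, x₀ ≤ a k) (hab : ∀ k, a k ≤ b k)
    (hb : ∀ k, b k ≤ x₀ + 2 * Real.pi)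
    (hd : Pairwise (Function.onFun Disjoint fun k => Ioo (a k) (b k)))
    (hsum : ∑' k, ENNReal.ofReal ((b k - a k) * Real.log (1 / (b k - a k))) < ⊤) :
    IntervalIntegrable (logMajorant fun x => bump a b x ^ 3) volume x₀ (x₀ + 2 * Real.pi) := by
  have hle : x₀ ≤ x₀ + 2 * Real.pi := by linarith [Real.pi_pos]
  have hv := greenWeight_bump ha hb hd
  have hm : Measurable (logMajorant fun x => bump a b x ^ 3) := by
    have := hv.continuous.measurable
    exact Measurable.ite (measurableSet_eq_fun this measurable_const) measurable_const
      (Real.measurable_log.comp ((measurable_const.add this).div this))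
  rw [intervalIntegrable_iff_integrableOn_Ioc_of_le hle]
  refine ⟨hm.aestronglyMeasurable, ?_⟩
  have h0 : ∀ x, 0 ≤ logMajorant (fun x => bump a b x ^ 3) x :=
    fun x => logMajorant_nonneg (hv.nonneg x)
  rw [hasFiniteIntegral_iff_ofReal (Eventually.of_forall h0)]
  have hU : MeasurableSet (⋃ k, Ioo (a k) (b k)) := MeasurableSet.iUnion fun k => measurableSet_Ioo
  have hsub : (⋃ k, Ioo (a k) (b k)) ⊆ Ioc x₀ (x₀ + 2 * Real.pi) :=
    iUnion_subset fun k x hx => ⟨(ha k).trans_lt hx.1, hx.2.le.trans (hb k)⟩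
  have hlen : ∑' k, ENNReal.ofReal (b k - a k) ≤ ENNReal.ofReal (2 * Real.pi) := by
    simp_rw [← Real.volume_Ioo]
    rw [← measure_iUnion hd fun k => measurableSet_Ioo]
    refine (measure_mono hsub).trans ?_
    rw [Real.volume_Ioc]; simp
  calc ∫⁻ x in Ioc x₀ (x₀ + 2 * Real.pi), ENNReal.ofReal (logMajorant (fun x => bump a b x ^ 3) x)
      ≤ ∫⁻ x in ⋃ k, Ioo (a k) (b k), ENNReal.ofReal (logMajorant (fun x => bump a b x ^ 3) x) := by
        rw [← lintegral_indicator hU]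
        refine (setLIntegral_le_lintegral _ _).trans (lintegral_mono fun x => ?_)
        by_cases hx : x ∈ ⋃ k, Ioo (a k) (b k)
        · rw [indicator_of_mem hx]
        · rw [indicator_of_notMem hx]
          have : bump a b x = 0 := (bump_of_notMem (by simpa using hx)).1
          simp [logMajorant, this]
    _ = ∑' k, ∫⁻ x in Ioo (a k) (b k), ENNReal.ofReal (logMajorant (fun x => bump a b x ^ 3) x) :=
        lintegral_iUnion (fun k => measurableSet_Ioo) hd _
    _ ≤ ∑' k, (1006 * ENNReal.ofReal (b k - a k) +
          6 * ENNReal.ofReal ((b k - a k) * Real.log (1 / (b k - a k)))) := by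
        refine ENNReal.tsum_le_tsum fun k => le_trans (setLIntegral_mono' measurableSet_Ioo
          fun x hx => ENNReal.ofReal_le_ofReal (logMajorant_bump_le ha hb hd hx))
          (lintegral_log_ends (hab k) fun x hx =>
            (h0 x).trans (logMajorant_bump_le ha hb hd hx))
    _ < ⊤ := by
        rw [ENNReal.tsum_add, ENNReal.tsum_mul_left, ENNReal.tsum_mul_left]
        refine ENNReal.add_lt_top.2 ⟨ENNReal.mul_lt_top (by simp) (hlen.trans_lt ENNReal.ofReal_lt_top),
          ENNReal.mul_lt_top (by simp) hsum⟩

end bump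

end

lemma exists_eq_Ioo_of_isOpen_of_isPreconnected {S : Set ℝ} {l r : ℝ} (hlr : l ≤ r) (ho : IsOpen S)
    (hc : IsPreconnected S) (hS : S ⊆ Ioo l r) :
    ∃ a b, l ≤ a ∧ a ≤ b ∧ b ≤ r ∧ S = Ioo a b := by
  rcases S.eq_empty_or_nonempty with rfl | hne
  · exact ⟨l, l, le_rfl, le_rfl, hlr, by simp⟩
  have hb : BddBelow S := ⟨l, fun x hx => (hS hx).1.le⟩
  have ha : BddAbove S := ⟨r, fun x hx => (hS hx).2.le⟩
  refine ⟨sInf S, sSup S, le_csInf hne fun x hx => (hS hx).1.le, csInf_le_csSup hne hb ha,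
    csSup_le hne fun x hx => (hS hx).2.le, Subset.antisymm (fun x hx => ?_)
      (IsConnected.Ioo_csInf_csSup_subset ⟨hne, hc⟩ hb ha)⟩
  obtain ⟨ε, hε, hball⟩ := Metric.isOpen_iff.1 ho x hx
  have h1 : x - ε / 2 ∈ S := hball (by simp [abs_of_pos hε, hε])
  have h2 : x + ε / 2 ∈ S := hball (by simp [abs_of_pos hε, hε])
  exact ⟨(csInf_le hb h1).trans_lt (by linarith), lt_of_lt_of_le (by linarith) (le_csSup ha h2)⟩

lemma exists_Ioo_of_arc {x₀ : ℝ} {I : Set UnitCircle} (ho : IsOpen I) (hc : IsPreconnected I)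
    (hx₀ : (x₀ : UnitCircle) ∉ I) :
    ∃ a b, x₀ ≤ a ∧ a ≤ b ∧ b ≤ x₀ + 2 * Real.pi ∧ (volume I).toReal = b - a ∧
      {x | x ∈ Ioo x₀ (x₀ + 2 * Real.pi) ∧ (x : UnitCircle) ∈ I} = Ioo a b := by
  have hle : x₀ ≤ x₀ + 2 * Real.pi := by linarith [Real.pi_pos]
  set S : Set ℝ := {x | x ∈ Ioo x₀ (x₀ + 2 * Real.pi) ∧ (x : UnitCircle) ∈ I} with hS
  set Φ := AddCircle.openPartialHomeomorphCoe (2 * Real.pi) x₀ with hΦ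
  have hsub : I ⊆ Φ.target := fun x hx h => hx₀ (by rwa [mem_singleton_iff.1 h] at hx)
  have himg : S = Φ.symm '' I := by
    ext x
    constructor
    · rintro ⟨hx, hxI⟩
      exact ⟨x, hxI, Φ.left_inv hx⟩
    · rintro ⟨y, hy, rfl⟩
      refine ⟨Φ.map_target (hsub hy), ?_⟩
      have : (Φ (Φ.symm y)) = y := Φ.right_inv (hsub hy)
      rw [show ((Φ.symm y : ℝ) : UnitCircle) = Φ (Φ.symm y) from rfl, this]
      exact hy
  have hSc : IsPreconnected S := by
    rw [himg]
    exact hc.image _ (Φ.continuousOn_symm.mono hsub)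
  have hSo : IsOpen S := isOpen_Ioo.inter (ho.preimage (AddCircle.continuous_mk' _))
  obtain ⟨a, b, h1, h2, h3, h4⟩ := exists_eq_Ioo_of_isOpen_of_isPreconnected hle hSo hSc fun x hx => hx.1
  refine ⟨a, b, h1, h2, h3, ?_, h4⟩
  have hmp := AddCircle.measurePreserving_mk (2 * Real.pi) x₀
  rw [← hmp.measure_preimage ho.measurableSet.nullMeasurableSet,
    Measure.restrict_apply (hmp.measurable ho.measurableSet)]
  have : ((↑) : ℝ → UnitCircle) ⁻¹' I ∩ Ioc x₀ (x₀ + 2 * Real.pi) = Ioo a b := by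
    rw [← h4]
    ext x
    refine ⟨fun hx => ⟨⟨hx.2.1, lt_of_le_of_ne hx.2.2 ?_⟩, hx.1⟩, fun hx => ⟨hx.2, hx.1.1, hx.1.2.le⟩⟩
    rintro rfl
    have := hx.1
    rw [mem_preimage, AddCircle.coe_add_period] at this
    exact hx₀ this
  rw [this, Real.volume_Ioo, ENNReal.toReal_ofReal (by linarith)]

/-- Lifting the complementary arcs of a Carleson set to intervals of a period. -/
lemma IsCarlesonSet.exists_intervals {E : Set UnitCircle} (hE : IsCarlesonSet E) (hne : E.Nonempty) :
    ∃ (x₀ : ℝ) (a b : ℕ → ℝ), (∀ k, x₀ ≤ a k) ∧ (∀ k, a k ≤ b k) ∧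
      (∀ k, b k ≤ x₀ + 2 * Real.pi) ∧
      Pairwise (Function.onFun Disjoint fun k => Ioo (a k) (b k)) ∧
      ∑' k, ENNReal.ofReal ((b k - a k) * Real.log (1 / (b k - a k))) < ⊤ ∧
      ∀ x ∈ Ioc x₀ (x₀ + 2 * Real.pi), (x : UnitCircle) ∈ E ↔ ∀ k, x ∉ Ioo (a k) (b k) := by
  obtain ⟨-, I, hI, hdis, hU, hsum⟩ := hE
  obtain ⟨e, he⟩ := hne
  obtain ⟨x₀, rfl⟩ := QuotientAddGroup.mk_surjective e
  have hx₀ : ∀ k, (x₀ : UnitCircle) ∉ I k := fun k hk => by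
    have : (x₀ : UnitCircle) ∈ Eᶜ := hU ▸ mem_iUnion.2 ⟨k, hk⟩
    exact this he
  choose a b h1 h2 h3 h4 h5 using fun k => exists_Ioo_of_arc (hI k).1 (hI k).2 (hx₀ k)
  refine ⟨x₀, a, b, h1, h2, h3, fun k l hkl => ?_, by simpa only [h4] using hsum, fun x hx => ?_⟩
  · refine disjoint_left.2 fun x hx hx' => ?_
    simp only [← h5] at hx hx'
    exact disjoint_left.1 (hdis k l hkl) hx.2 hx'.2
  · constructor
    · intro hxE k hk
      rw [← h5] at hk
      have : (x : UnitCircle) ∈ Eᶜ := hU ▸ mem_iUnion.2 ⟨k, hk.2⟩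
      exact this hxE
    · intro h
      by_contra hxE
      have : (x : UnitCircle) ∈ ⋃ k, I k := hU ▸ hxE
      obtain ⟨k, hk⟩ := mem_iUnion.1 this
      refine h k ?_
      rw [← h5]
      refine ⟨⟨hx.1, lt_of_le_of_ne hx.2 ?_⟩, hk⟩
      rintro rfl
      rw [AddCircle.coe_add_period] at hk
      exact hx₀ k hk

lemma coe_nnnorm_rpow {z : ℂ} {t : ℝ} (ht : 0 ≤ t) :
    (‖z‖₊ : ENNReal) ^ t = ENNReal.ofReal (‖z‖ ^ t) := by
  rw [← ENNReal.ofReal_rpow_of_nonneg (norm_nonneg z) ht, ofReal_norm]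
  rfl

lemma Polynomial.log_norm_le_circleAverage (q : Polynomial ℂ) {c : ℂ} {r : ℝ} (hr : 0 < r)
    (hc : q.eval c ≠ 0) :
    Real.log ‖q.eval c‖ ≤ Real.circleAverage (fun z => Real.log ‖q.eval z‖) c r := by
  have hq : AnalyticOnNhd ℂ (fun z => q.eval z) (Metric.closedBall c |r|) :=
    fun z _ => AnalyticAt.aeval_polynomial analyticAt_id q
  rw [hq.circleAverage_log_norm hr.ne' hc]
  refine le_add_of_nonneg_left (finsum_nonneg fun u => ?_)
  by_cases hu : u ∈ Metric.closedBall c |r|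
  · refine mul_nonneg (by exact_mod_cast MeromorphicOn.AnalyticOnNhd.divisor_nonneg hq u) ?_
    rw [Metric.mem_closedBall, dist_comm, dist_eq_norm, abs_of_pos hr] at hu
    rcases (norm_nonneg (c - u)).eq_or_lt with h | h
    · simp [← h]
    · refine Real.log_nonneg ?_
      rw [← div_eq_mul_inv]
      exact (one_le_div h).2 hu
  · rw [Function.locallyFinsuppWithin.apply_eq_zero_of_notMem _ hu]
    simp

lemma Polynomial.norm_rpow_le_integral_circle (q : Polynomial ℂ) {c : ℂ} {r t : ℝ} (hr : 0 < r)
    (ht : 0 < t) :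
    2 * Real.pi * ‖q.eval c‖ ^ t ≤
      ∫ θ in (-Real.pi)..Real.pi, ‖q.eval (circleMap c r θ)‖ ^ t := by
  have hpi := Real.pi_pos
  by_cases hc : q.eval c = 0
  · rw [hc, norm_zero, Real.zero_rpow ht.ne', mul_zero]
    exact intervalIntegral.integral_nonneg (by linarith) fun θ _ => by positivity
  have hshift : ∀ f : ℂ → ℝ, ∫ θ in (-Real.pi)..Real.pi, f (circleMap c r θ) =
      ∫ θ in (0:ℝ)..(2 * Real.pi), f (circleMap c r θ) := by
    intro f
    have hper : Function.Periodic (fun θ => f (circleMap c r θ)) (2 * Real.pi) :=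
      fun θ => by simp only [periodic_circleMap c r θ]
    have := hper.intervalIntegral_add_eq (-Real.pi) 0
    rw [zero_add] at this
    rw [← this]; congr 1; ring
  rw [hshift fun z => ‖q.eval z‖ ^ t]
  have hq : ContinuousOn (fun z => q.eval z) univ := q.continuous.continuousOn
  have hmer : MeromorphicOn (fun z => q.eval z) (Metric.sphere c |r|) :=
    fun z _ => (AnalyticAt.aeval_polynomial analyticAt_id q).meromorphicAt
  have hlogi : IntervalIntegrable (fun θ => Real.log ‖q.eval (circleMap c r θ)‖) volume 0
      (2 * Real.pi) := hmer.circleIntegrable_log_norm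
  have hJ := q.log_norm_le_circleAverage hr hc
  rw [Real.circleAverage_def, smul_eq_mul, inv_mul_eq_div, le_div_iff₀ (by positivity)] at hJ
  set L := Real.log ‖q.eval c‖ with hL
  have hexp : ‖q.eval c‖ ^ t = Real.exp (t * L) := by
    rw [Real.rpow_def_of_pos (norm_pos_iff.2 hc), mul_comm]
  have hi2 : IntervalIntegrable (fun θ => ‖q.eval (circleMap c r θ)‖ ^ t) volume 0
      (2 * Real.pi) := by
    refine Continuous.intervalIntegrable ?_ _ _
    exact (q.continuous.comp (continuous_circleMap c r)).norm.rpow_const fun _ => Or.inr ht.le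
  have hi1 : IntervalIntegrable (fun θ => Real.exp (t * L) *
      (1 + (t * Real.log ‖q.eval (circleMap c r θ)‖ - t * L))) volume 0 (2 * Real.pi) :=
    (intervalIntegrable_const.add ((hlogi.const_mul t).sub intervalIntegrable_const)).const_mul _
  have hae : ∀ᵐ θ, q.eval (circleMap c r θ) ≠ 0 := by
    have hq0 : q ≠ 0 := fun h => hc (by simp [h])
    have : ((fun θ => circleMap c r θ) ⁻¹' {z | q.eval z = 0}).Countable := by
      refine Set.Countable.preimage_circleMap ?_ c hr.ne'
      exact (Polynomial.finite_setOfPred_isRoot hq0).countable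
    rw [ae_iff]
    simpa using this.measure_zero volume
  have hmono := intervalIntegral.integral_mono_ae (μ := volume) (by positivity : (0:ℝ) ≤ 2 * Real.pi)
    hi1 hi2 (by
      filter_upwards [hae] with θ hθ
      rw [Real.rpow_def_of_pos (norm_pos_iff.2 hθ)]
      have := Real.add_one_le_exp (t * Real.log ‖q.eval (circleMap c r θ)‖ - t * L)
      calc Real.exp (t * L) * (1 + (t * Real.log ‖q.eval (circleMap c r θ)‖ - t * L))
          ≤ Real.exp (t * L) * Real.exp (t * Real.log ‖q.eval (circleMap c r θ)‖ - t * L) := by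
            gcongr; linarith
        _ = _ := by rw [← Real.exp_add]; congr 1; ring)
  refine le_trans ?_ hmono
  rw [intervalIntegral.integral_const_mul, intervalIntegral.integral_add intervalIntegrable_const
    ((hlogi.const_mul t).sub intervalIntegrable_const), intervalIntegral.integral_sub
    (hlogi.const_mul t) intervalIntegrable_const, intervalIntegral.integral_const_mul,
    intervalIntegral.integral_const, intervalIntegral.integral_const, hexp]
  have h0 : 0 ≤ t * ((∫ θ in (0:ℝ)..(2 * Real.pi), Real.log ‖q.eval (circleMap c r θ)‖) -
      L * (2 * Real.pi)) := mul_nonneg ht.le (by linarith)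
  have h1 := mul_nonneg (Real.exp_pos (t * L)).le h0
  simp only [sub_zero, smul_eq_mul]
  nlinarith

lemma Polynomial.norm_rpow_le_lintegral_ball (q : Polynomial ℂ) {c : ℂ} {ρ t : ℝ} (hρ : 0 < ρ)
    (ht : 0 < t) :
    ENNReal.ofReal (Real.pi * ρ ^ 2 * ‖q.eval c‖ ^ t) ≤
      ∫⁻ z in Metric.ball c ρ, ENNReal.ofReal (‖q.eval z‖ ^ t) := by
  have hpi := Real.pi_pos
  have hcont : Continuous fun z => ‖q.eval z‖ ^ t :=
    q.continuous.norm.rpow_const fun _ => Or.inr ht.le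
  set F : ℂ → ENNReal := (Metric.ball (0:ℂ) ρ).indicator fun z => ENNReal.ofReal (‖q.eval (c + z)‖ ^ t)
    with hF
  have e1 : ∫⁻ z in Metric.ball c ρ, ENNReal.ofReal (‖q.eval z‖ ^ t) = ∫⁻ z, F z := by
    rw [← lintegral_indicator Metric.isOpen_ball.measurableSet, ← lintegral_add_left_eq_self _ c]
    refine lintegral_congr fun z => ?_
    simp only [hF, indicator, Metric.mem_ball, dist_eq_norm, add_sub_cancel_left, sub_zero]
  have hsub : Ioo (0:ℝ) ρ ×ˢ Ioo (-Real.pi) Real.pi ⊆ polarCoord.target :=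
    prod_mono (fun x hx => hx.1) (fun x hx => hx)
  rw [e1, ← Complex.lintegral_comp_polarCoord_symm]
  refine le_trans ?_ (lintegral_mono_set hsub)
  have e2 : ∫⁻ p in Ioo (0:ℝ) ρ ×ˢ Ioo (-Real.pi) Real.pi,
      ENNReal.ofReal p.1 • F (Complex.polarCoord.symm p) =
      ∫⁻ p in Ioo (0:ℝ) ρ ×ˢ Ioo (-Real.pi) Real.pi,
        ENNReal.ofReal p.1 * ENNReal.ofReal (‖q.eval (circleMap c p.1 p.2)‖ ^ t) := by
    refine setLIntegral_congr_fun (measurableSet_Ioo.prod measurableSet_Ioo) fun p hp => ?_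
    have hmem : Complex.polarCoord.symm p ∈ Metric.ball (0:ℂ) ρ := by
      rw [mem_ball_zero_iff, Complex.norm_polarCoord_symm, abs_of_pos hp.1.1]
      exact hp.1.2
    simp only [hF, indicator_of_mem hmem, smul_eq_mul]
    rw [Complex.polarCoord_symm_apply, circleMap, Complex.exp_mul_I]
    push_cast
    rfl
  have hmeas : Measurable fun p : ℝ × ℝ =>
      ENNReal.ofReal p.1 * ENNReal.ofReal (‖q.eval (circleMap c p.1 p.2)‖ ^ t) := by
    have : Continuous fun p : ℝ × ℝ => circleMap c p.1 p.2 := by unfold circleMap; fun_prop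
    exact (ENNReal.measurable_ofReal.comp measurable_fst).mul
      (ENNReal.measurable_ofReal.comp (hcont.comp this).measurable)
  rw [e2, Measure.volume_eq_prod, ← Measure.prod_restrict, lintegral_prod _ hmeas.aemeasurable]
  have e3 : ∫⁻ r in Ioo (0:ℝ) ρ, ENNReal.ofReal (r * (2 * Real.pi * ‖q.eval c‖ ^ t)) =
      ENNReal.ofReal (Real.pi * ρ ^ 2 * ‖q.eval c‖ ^ t) := by
    rw [← ofReal_integral_eq_lintegral_ofReal, ← integral_Ioc_eq_integral_Ioo,
      ← intervalIntegral.integral_of_le hρ.le, intervalIntegral.integral_mul_const, integral_id]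
    · congr 1; ring
    · exact ((intervalIntegrable_iff_integrableOn_Ioo_of_le hρ.le).1
        (Continuous.intervalIntegrable (by fun_prop) _ _))
    · exact (ae_restrict_iff' measurableSet_Ioo).2 (Eventually.of_forall fun r hr =>
        mul_nonneg hr.1.le (by positivity))
  rw [← e3]
  refine setLIntegral_mono' measurableSet_Ioo fun r hr => ?_
  rw [lintegral_const_mul' _ _ ENNReal.ofReal_ne_top, ENNReal.ofReal_mul hr.1.le]
  gcongr
  have hci : Continuous fun θ => ‖q.eval (circleMap c r θ)‖ ^ t :=
    hcont.comp (continuous_circleMap c r)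
  rw [← ofReal_integral_eq_lintegral_ofReal, ← integral_Ioc_eq_integral_Ioo,
    ← intervalIntegral.integral_of_le (by linarith)]
  · exact ENNReal.ofReal_le_ofReal (q.norm_rpow_le_integral_circle hr.1 ht)
  · exact ((intervalIntegrable_iff_integrableOn_Ioo_of_le (by linarith)).1
      (hci.intervalIntegrable _ _))
  · exact Eventually.of_forall fun θ => by positivity

/-- Pointwise growth of polynomials in the weighted Bergman metric. -/
lemma exists_growth_bound {t : ℝ} (β : ℝ) (ht : 0 < t) :
    ∃ K : ℝ, 0 < K ∧ ∀ (q : Polynomial ℂ) (z : ℂ), ‖z‖ < 1 →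
      ENNReal.ofReal (‖q.eval z‖ ^ t * (1 - ‖z‖) ^ (β + 2)) ≤ ENNReal.ofReal K *
        ∫⁻ z in Metric.ball (0 : ℂ) 1,
          (‖q.eval z‖₊ : ENNReal) ^ t * ENNReal.ofReal ((1 - ‖z‖) ^ β) := by
  have hpi := Real.pi_pos
  set κ := min ((1 / 2 : ℝ) ^ β) ((3 / 2 : ℝ) ^ β) with hκ
  have hκ0 : 0 < κ := lt_min (by positivity) (by positivity)
  refine ⟨4 / (Real.pi * κ), by positivity, fun q z hz => ?_⟩
  set h := 1 - ‖z‖ with hh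
  have h0 : 0 < h := by linarith
  have hcomp : ∀ ξ ∈ Metric.ball z (h / 2), κ * h ^ β ≤ (1 - ‖ξ‖) ^ β ∧ ξ ∈ Metric.ball (0:ℂ) 1 := by
    intro ξ hξ
    rw [Metric.mem_ball, dist_eq_norm] at hξ
    have a1 := abs_norm_sub_norm_le ξ z
    have a2 := abs_le.1 (a1.trans hξ.le)
    have l1 : 1 / 2 * h ≤ 1 - ‖ξ‖ := by linarith [a2.2]
    have l2 : 1 - ‖ξ‖ ≤ 3 / 2 * h := by linarith [a2.1]
    refine ⟨?_, mem_ball_zero_iff.2 (by linarith)⟩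
    rcases le_total 0 β with hb | hb
    · calc κ * h ^ β ≤ (1 / 2) ^ β * h ^ β := by gcongr; exact min_le_left _ _
        _ = (1 / 2 * h) ^ β := (Real.mul_rpow (by norm_num) h0.le).symm
        _ ≤ _ := Real.rpow_le_rpow (by positivity) l1 hb
    · calc κ * h ^ β ≤ (3 / 2) ^ β * h ^ β := by gcongr; exact min_le_right _ _
        _ = (3 / 2 * h) ^ β := (Real.mul_rpow (by norm_num) h0.le).symm
        _ ≤ _ := Real.rpow_le_rpow_of_nonpos (by linarith) l2 hb
  have hb := q.norm_rpow_le_lintegral_ball (c := z) (half_pos h0) ht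
  calc ENNReal.ofReal (‖q.eval z‖ ^ t * h ^ (β + 2))
      = ENNReal.ofReal (4 / (Real.pi * κ)) * (ENNReal.ofReal (κ * h ^ β) *
          ENNReal.ofReal (Real.pi * (h / 2) ^ 2 * ‖q.eval z‖ ^ t)) := by
        rw [← ENNReal.ofReal_mul (by positivity), ← ENNReal.ofReal_mul (by positivity)]
        congr 1
        rw [Real.rpow_add h0, Real.rpow_two]
        field_simp
        ring
    _ ≤ ENNReal.ofReal (4 / (Real.pi * κ)) * (ENNReal.ofReal (κ * h ^ β) *
          ∫⁻ ξ in Metric.ball z (h / 2), ENNReal.ofReal (‖q.eval ξ‖ ^ t)) := by gcongr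
    _ = ENNReal.ofReal (4 / (Real.pi * κ)) *
          ∫⁻ ξ in Metric.ball z (h / 2), ENNReal.ofReal (‖q.eval ξ‖ ^ t) *
            ENNReal.ofReal (κ * h ^ β) := by
        rw [lintegral_mul_const' _ _ ENNReal.ofReal_ne_top, mul_comm (ENNReal.ofReal (κ * h ^ β))]
    _ ≤ ENNReal.ofReal (4 / (Real.pi * κ)) *
          ∫⁻ ξ in Metric.ball z (h / 2), (‖q.eval ξ‖₊ : ENNReal) ^ t *
            ENNReal.ofReal ((1 - ‖ξ‖) ^ β) := by
        refine mul_le_mul_right (setLIntegral_mono' Metric.isOpen_ball.measurableSet fun ξ hξ => ?_) _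
        rw [coe_nnnorm_rpow ht.le]
        gcongr
        exact (hcomp ξ hξ).1
    _ ≤ _ := by
        gcongr
        exact fun ξ hξ => (hcomp ξ hξ).2

section

lemma reDot_self (a : ℂ) : reDot a a = ‖a‖ ^ 2 := by
  rw [Complex.sq_norm, Complex.normSq_apply, reDot]

lemma abs_reDot_le (a b : ℂ) : |reDot a b| ≤ ‖a‖ * ‖b‖ := by
  refine abs_le_of_sq_le_sq ?_ (by positivity)
  rw [mul_pow, Complex.sq_norm, Complex.sq_norm, Complex.normSq_apply, Complex.normSq_apply, reDot]
  nlinarith [sq_nonneg (a.re * b.im - a.im * b.re)]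

lemma norm_exp_neg_add_mul_I (s θ : ℝ) :
    ‖Complex.exp (-(s : ℂ) + θ * Complex.I)‖ = Real.exp (-s) := by
  rw [Complex.norm_exp]; simp

lemma half_le_one_sub_exp_neg {s : ℝ} (h0 : 0 ≤ s) (h1 : s ≤ 1) : s / 2 ≤ 1 - Real.exp (-s) := by
  have h2 := Real.add_one_le_exp s
  have h3 : Real.exp (-s) * Real.exp s = 1 := by rw [← Real.exp_add]; simp
  have h4 := Real.exp_pos (-s)
  nlinarith

variable {t β : ℝ}

/-- The weighted area integral of `|q|^t`. -/
def bergmanIntegral (t β : ℝ) (q : ℂ → ℂ) : ENNReal :=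
  ∫⁻ z in Metric.ball (0 : ℂ) 1, (‖q z‖₊ : ENNReal) ^ t * ENNReal.ofReal ((1 - ‖z‖) ^ β)

lemma exists_growth_bound_sub_one (β : ℝ) (ht : 0 < t) :
    ∃ K : ℝ, 1 ≤ K ∧ ∀ (p : Polynomial ℂ) (z : ℂ) (ε : ℝ), ‖z‖ < 1 → 0 ≤ ε →
      bergmanIntegral t β (fun z => p.eval z - 1) ≤ ENNReal.ofReal ε →
      ‖p.eval z - 1‖ ^ t * (1 - ‖z‖) ^ (β + 2) ≤ K * ε := by
  obtain ⟨K, hK, h⟩ := exists_growth_bound β ht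
  refine ⟨max K 1, le_max_right _ _, fun p z ε hz hε hp => ?_⟩
  have h1 := h (p - 1) z hz
  simp only [Polynomial.eval_sub, Polynomial.eval_one] at h1
  have h2 : ENNReal.ofReal (‖p.eval z - 1‖ ^ t * (1 - ‖z‖) ^ (β + 2)) ≤ ENNReal.ofReal (K * ε) := by
    refine h1.trans ?_
    rw [ENNReal.ofReal_mul hK.le]
    exact mul_le_mul_right hp _
  refine ((ENNReal.ofReal_le_ofReal_iff (by positivity)).1 h2).trans ?_
  gcongr
  exact le_max_left _ _

lemma exists_smoothLog_le (ht : 0 < t) (hβ : -1 < β) :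
    ∃ B : ℝ, 0 ≤ B ∧ ∀ (p : Polynomial ℂ), bergmanIntegral t β (fun z => p.eval z - 1) ≤ 1 →
      ∀ δ ∈ Ioc (0:ℝ) 1, ∀ s ∈ Ioc (0:ℝ) 1, ∀ θ, smoothLog p δ s θ ≤ B * (1 - Real.log s) := by
  obtain ⟨K, hK, h⟩ := exists_growth_bound_sub_one β ht
  have hlK := Real.log_nonneg hK
  have hl2 := Real.log_nonneg (one_le_two (α := ℝ))
  refine ⟨2 + (Real.log K + 2 * (β + 2)) / t, add_nonneg zero_le_two
    (div_nonneg (by linarith) ht.le), fun p hp δ hδ s hs θ => ?_⟩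
  set z := Complex.exp (-(s : ℂ) + θ * Complex.I) with hz
  have hnz : ‖z‖ = Real.exp (-s) := norm_exp_neg_add_mul_I s θ
  have hz1 : ‖z‖ < 1 := by rw [hnz]; simpa using hs.1
  have hlow : s / 2 ≤ 1 - ‖z‖ := by rw [hnz]; exact half_le_one_sub_exp_neg hs.1.le hs.2
  have hs2 : 0 < s / 2 := half_pos hs.1
  have hq := h p z 1 hz1 zero_le_one (by simpa using hp)
  rw [mul_one] at hq
  have hls : Real.log s ≤ 0 := Real.log_nonpos hs.1.le hs.2
  set x := ‖p.eval z - 1‖ with hx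
  have hx0 : 0 ≤ x := norm_nonneg _
  have hq2 : x ^ t * (s / 2) ^ (β + 2) ≤ K := by
    refine le_trans ?_ hq
    gcongr
    linarith
  have hlogx : 1 ≤ x → t * Real.log x ≤ Real.log K + (β + 2) * (1 - Real.log s) := by
    intro h1
    have hxp : 0 < x := by linarith
    have := Real.log_le_log (by positivity) hq2
    rw [Real.log_mul (by positivity) (by positivity), Real.log_rpow hxp, Real.log_rpow hs2,
      Real.log_div hs.1.ne' two_ne_zero] at this
    have l2 : Real.log 2 ≤ 1 := by linarith [Real.log_two_lt_d9]
    nlinarith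
  have hpz : ‖p.eval z‖ ≤ 1 + x := by
    calc ‖p.eval z‖ = ‖1 + (p.eval z - 1)‖ := by congr 1; ring
      _ ≤ _ := (norm_add_le _ _).trans (by simp [hx])
  have hval : reDot (logEval p s θ) (logEval p s θ) + δ ≤ 5 * max x 1 ^ 2 := by
    rw [reDot_self, logEval]
    have h1 : ‖p.eval z‖ ≤ 2 * max x 1 := by linarith [le_max_left x 1, le_max_right x 1]
    have h2 : ‖p.eval z‖ ^ 2 ≤ (2 * max x 1) ^ 2 := by gcongr
    have h3 : (1:ℝ) ≤ max x 1 ^ 2 := one_le_pow₀ (le_max_right _ _)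
    have := hδ.2
    nlinarith
  have hmax : 0 < max x 1 := lt_max_of_lt_right one_pos
  have hlm : t * Real.log (max x 1) ≤ Real.log K + (β + 2) * (1 - Real.log s) := by
    rcases le_total x 1 with h1 | h1
    · rw [max_eq_right h1, Real.log_one, mul_zero]
      exact add_nonneg hlK (mul_nonneg (by linarith) (by linarith))
    · rw [max_eq_left h1]; exact hlogx h1
  have hl5 : Real.log 5 ≤ 4 := by linarith [Real.log_le_sub_one_of_pos (show (0:ℝ) < 5 by norm_num)]
  have hmain : smoothLog p δ s θ ≤ 2 + Real.log (max x 1) := by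
    have := Real.log_le_log (by linarith [reDot_self_nonneg (logEval p s θ), hδ.1]) hval
    rw [Real.log_mul (by norm_num) (by positivity), Real.log_pow] at this
    unfold smoothLog
    push_cast at this
    linarith
  refine hmain.trans ?_
  have hlm' : Real.log (max x 1) ≤ (Real.log K + (β + 2) * (1 - Real.log s)) / t := by
    rw [le_div_iff₀ ht]; linarith
  have : (Real.log K + (β + 2) * (1 - Real.log s)) / t ≤
      (Real.log K + 2 * (β + 2)) / t * (1 - Real.log s) := by
    rw [div_mul_eq_mul_div]
    gcongr
    nlinarith
  nlinarith

lemma exists_smoothLog_one_bound (ht : 0 < t) (hβ : -1 < β) :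
    ∃ ε : ℝ, 0 < ε ∧ ∀ (p : Polynomial ℂ),
      bergmanIntegral t β (fun z => p.eval z - 1) ≤ ENNReal.ofReal ε →
      ∀ δ ∈ Ioc (0:ℝ) 1, ∀ θ, |smoothLog p δ 1 θ| ≤ 10 ∧ |smoothLogDeriv p δ 1 θ| ≤ 10 := by
  obtain ⟨K, hK, h⟩ := exists_growth_bound_sub_one β ht
  have hK0 : 0 < K := by linarith
  refine ⟨(1 / 2) ^ t * (1 / 2) ^ (β + 2) / K, by positivity, fun p hp δ hδ θ => ?_⟩
  have hsmall : ∀ z : ℂ, ‖z‖ ≤ 1 / 2 → ‖p.eval z - 1‖ ≤ 1 / 2 := by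
    intro z hz
    have h1 := h p z _ (by linarith) (by positivity) hp
    rw [mul_div_cancel₀ _ hK0.ne'] at h1
    have h2 : (1 / 2 : ℝ) ^ (β + 2) ≤ (1 - ‖z‖) ^ (β + 2) :=
      Real.rpow_le_rpow (by norm_num) (by linarith) (by linarith)
    have h3 : ‖p.eval z - 1‖ ^ t ≤ (1 / 2) ^ t := by
      have hp : (0:ℝ) < (1 / 2) ^ (β + 2) := by positivity
      refine le_of_mul_le_mul_right ?_ hp
      exact (mul_le_mul_of_nonneg_left h2 (by positivity)).trans h1
    exact (Real.rpow_le_rpow_iff (norm_nonneg _) (by norm_num) ht).1 h3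
  set z := Complex.exp (-((1:ℝ) : ℂ) + θ * Complex.I) with hz
  have hnz : ‖z‖ = Real.exp (-1) := norm_exp_neg_add_mul_I 1 θ
  have hz4 : ‖z‖ ≤ 2 / 5 := by
    rw [hnz, Real.exp_neg, inv_le_comm₀ (Real.exp_pos _) (by norm_num)]
    linarith [Real.exp_one_gt_d9]
  have hd : ‖(Polynomial.derivative p).eval z‖ ≤ 5 := by
    have := Complex.norm_deriv_le_of_forall_mem_sphere_norm_le (c := z) (R := 1 / 10) (C := 1 / 2)
      (f := fun z => p.eval z - 1) (by norm_num)
      ((p.differentiable.sub_const 1).diffContOnCl) (fun y hy => hsmall y ?_)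
    · rw [deriv_sub_const, Polynomial.deriv] at this
      linarith
    · rw [mem_sphere_iff_norm] at hy
      have := norm_add_le (y - z) z
      rw [sub_add_cancel] at this
      linarith
  have hq := hsmall z (by linarith)
  have hlow : 1 / 2 ≤ ‖p.eval z‖ := by
    have := norm_sub_norm_le (1 : ℂ) (p.eval z)
    rw [norm_sub_rev] at this
    simp at this; linarith
  have hup : ‖p.eval z‖ ≤ 3 / 2 := by
    have := norm_sub_norm_le (p.eval z) (1 : ℂ)
    simp at this; linarith
  have hδ1 := hδ.1
  have hδ2 := hδ.2
  have hden : reDot (logEval p 1 θ) (logEval p 1 θ) + δ = ‖p.eval z‖ ^ 2 + δ := by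
    rw [reDot_self, logEval]
  have hden1 : 1 / 4 ≤ ‖p.eval z‖ ^ 2 + δ := by nlinarith
  have hden2 : ‖p.eval z‖ ^ 2 + δ ≤ 4 := by nlinarith
  constructor
  · rw [smoothLog, hden, abs_le]
    have l1 := Real.log_le_sub_one_of_pos (show 0 < ‖p.eval z‖ ^ 2 + δ by linarith)
    have l2 := Real.one_sub_inv_le_log_of_pos (show 0 < ‖p.eval z‖ ^ 2 + δ by linarith)
    have l3 : (‖p.eval z‖ ^ 2 + δ)⁻¹ ≤ 4 := by
      rw [inv_le_comm₀ (by linarith) (by norm_num)]; linarith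
    constructor <;> linarith
  · rw [smoothLogDeriv, hden, abs_div, abs_of_pos (show 0 < ‖p.eval z‖ ^ 2 + δ by linarith),
      div_le_iff₀ (by linarith)]
    refine (abs_reDot_le _ _).trans ?_
    have e : ‖-logEval (eulerOp p) 1 θ‖ ≤ 2 := by
      rw [norm_neg, logEval, eulerOp, Polynomial.eval_mul, Polynomial.eval_X, norm_mul]
      calc ‖z‖ * ‖(Polynomial.derivative p).eval z‖ ≤ 2 / 5 * 5 := by gcongr
        _ = 2 := by norm_num
    have e2 : ‖logEval p 1 θ‖ = ‖p.eval z‖ := rfl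
    rw [e2]
    nlinarith [norm_nonneg (-logEval (eulerOp p) 1 θ)]

end

lemma circleEmbed_coe (x : ℝ) : circleEmbed (x : UnitCircle) = Complex.exp (x * Complex.I) := by
  rw [circleEmbed, AddCircle.toCircle_apply_mk, Circle.coe_exp,
    div_self (by positivity : 2 * Real.pi ≠ 0), one_mul]

lemma continuous_circleEmbed : Continuous circleEmbed :=
  continuous_subtype_val.comp AddCircle.continuous_toCircle

lemma norm_circleEmbed (ζ : UnitCircle) : ‖circleEmbed ζ‖ = 1 :=
  Circle.norm_coe _

lemma measurable_nlog : Measurable nlog :=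
  Measurable.ite (measurableSet_singleton 0) measurable_const
    (ENNReal.measurable_ofReal.comp (Real.measurable_log.comp measurable_inv))

lemma neg_log_le_toReal_nlog {x : ℝ} (hx : 0 < x) : -Real.log x ≤ (nlog x).toReal := by
  rw [nlog, if_neg hx.ne', Real.log_inv, ENNReal.toReal_ofReal']
  exact le_max_left _ _

/-- Uniform lower bound for the logarithmic integral over a Carleson set. -/
lemma exists_logIntegral_ge {t β : ℝ} (ht : 0 < t) (hβ : -1 < β) {E : Set UnitCircle}
    (hE : IsCarlesonSet E) (hne : E.Nonempty) :
    ∃ K ε : ℝ, 0 < ε ∧ ∀ (p : Polynomial ℂ),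
      bergmanIntegral t β (fun z => p.eval z - 1) ≤ ENNReal.ofReal ε →
      ∀ δ ∈ Ioc (0:ℝ) 1,
        K ≤ ∫ ζ in E, Real.log (‖p.eval (circleEmbed ζ)‖ ^ 2 + δ) / 2 := by
  obtain ⟨x₀, a, b, ha, hab, hb, hd, hsum, hmem⟩ := hE.exists_intervals hne
  obtain ⟨B, hB, hBle⟩ := exists_smoothLog_le ht hβ
  obtain ⟨ε, hε, hεle⟩ := exists_smoothLog_one_bound ht hβ
  have hle : x₀ ≤ x₀ + 2 * Real.pi := by linarith [Real.pi_pos]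
  have hv := greenWeight_bump ha hb hd
  have hΛ := intervalIntegrable_logMajorant_bump ha hab hb hd hsum
  refine ⟨-(2 * Real.pi * 10 * (2 + 3 * 1500)) -
      B * (2 * Real.pi * (2 * (2 * 3600 + 4 * 1500) + 1) +
        2 * ∫ θ in x₀..(x₀ + 2 * Real.pi), logMajorant (fun x => bump a b x ^ 3) θ),
    min ε 1, by positivity, fun p hp δ hδ => ?_⟩
  obtain ⟨uss, ut, utt, hu⟩ := exists_cylinderSubharmonic p hδ.1
  have hp1 := hBle p (hp.trans (by simp)) δ hδ
  have hp2 := hεle p (hp.trans (ENNReal.ofReal_le_ofReal (min_le_left _ _))) δ hδ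
  have key := integral_zero_set_ge (by norm_num) hB hu hv hp1 hΛ hp2
  refine key.trans_eq ?_
  rw [← integral_indicator hE.1.measurableSet, intervalIntegral.integral_of_le hle,
    ← AddCircle.integral_preimage (2 * Real.pi) x₀]
  refine setIntegral_congr_fun measurableSet_Ioc fun x hx => ?_
  have hiff : bump a b x ^ 3 = 0 ↔ (x : UnitCircle) ∈ E := by
    rw [hmem x hx, pow_eq_zero_iff (by norm_num), bump_eq_zero_iff hd]
  by_cases hxE : (x : UnitCircle) ∈ E
  · simp only [if_pos (hiff.2 hxE), indicator_of_mem hxE]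
    rw [smoothLog, reDot_self, logEval, circleEmbed_coe]
    simp
  · simp only [if_neg (fun h => hxE (hiff.1 h)), indicator_of_notMem hxE]

lemma add_rpow_le_two_rpow_mul {x y s : ℝ} (hx : 0 ≤ x) (hy : 0 ≤ y) (hs : 0 ≤ s) :
    (x + y) ^ s ≤ 2 ^ s * (x ^ s + y ^ s) := by
  have h : (x + y) ^ s ≤ (2 * max x y) ^ s :=
    Real.rpow_le_rpow (by positivity) (by linarith [le_max_left x y, le_max_right x y]) hs
  refine h.trans ?_
  rw [Real.mul_rpow zero_le_two (le_max_of_le_left hx)]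
  gcongr
  have := Real.rpow_nonneg hx s
  have := Real.rpow_nonneg hy s
  rcases le_total x y with h | h
  · rw [max_eq_right h]; linarith
  · rw [max_eq_left h]; linarith

lemma integrable_continuous_mul {w : UnitCircle → ℝ} (hw1 : Integrable w volume)
    {f : UnitCircle → ℝ} (hf : Continuous f) : Integrable (fun ζ => f ζ * w ζ) volume := by
  obtain ⟨C, hC⟩ := isCompact_univ.exists_bound_of_continuousOn hf.continuousOn
  exact hw1.bdd_mul hf.aestronglyMeasurable (Eventually.of_forall fun ζ => hC ζ (mem_univ _))

/-- Upper bound for the logarithmic integral, by Jensen's inequality with a parameter. -/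
lemma logIntegral_le {t : ℝ} (ht : 0 < t) {w : UnitCircle → ℝ} (hw0 : ∀ ζ, 0 ≤ w ζ)
    (hw1 : Integrable w volume) {E : Set UnitCircle}
    (hfin : ∫⁻ ζ in E, nlog (w ζ) ≠ ⊤) (p : Polynomial ℂ) {δ η : ℝ} (hδ : 0 < δ) (hη : 0 < η) :
    t * ∫ ζ in E, Real.log (‖p.eval (circleEmbed ζ)‖ ^ 2 + δ) / 2 ≤
      2 ^ (t / 2) * ((∫ ζ, ‖p.eval (circleEmbed ζ)‖ ^ t * w ζ) + δ ^ (t / 2) * ∫ ζ, w ζ) / η +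
        (volume E).toReal * Real.log η + ∫ ζ in E, (nlog (w ζ)).toReal := by
  have hcp : Continuous fun ζ => ‖p.eval (circleEmbed ζ)‖ :=
    (p.continuous.comp continuous_circleEmbed).norm
  have hpos : ∀ ζ, 0 < ‖p.eval (circleEmbed ζ)‖ ^ 2 + δ := fun ζ => by positivity
  have hcU : Continuous fun ζ => Real.log (‖p.eval (circleEmbed ζ)‖ ^ 2 + δ) / 2 :=
    (((hcp.pow 2).add_const δ).log fun ζ => (hpos ζ).ne').div_const 2
  set Y : UnitCircle → ℝ := fun ζ => 2 ^ (t / 2) * (‖p.eval (circleEmbed ζ)‖ ^ t + δ ^ (t / 2)) with hY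
  have hct : Continuous fun ζ => ‖p.eval (circleEmbed ζ)‖ ^ t := hcp.rpow_const fun _ => Or.inr ht.le
  have hcY : Continuous Y := (hct.add_const _).const_mul _
  have hYw := integrable_continuous_mul hw1 hcY
  have hnm : AEMeasurable (fun ζ => nlog (w ζ)) (volume.restrict E) :=
    (measurable_nlog.comp_aemeasurable hw1.aemeasurable).restrict
  have hni : Integrable (fun ζ => (nlog (w ζ)).toReal) (volume.restrict E) :=
    integrable_toReal_of_lintegral_ne_top hnm hfin
  have hYle : ∀ ζ, (‖p.eval (circleEmbed ζ)‖ ^ 2 + δ) ^ (t / 2) ≤ Y ζ := by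
    intro ζ
    refine (add_rpow_le_two_rpow_mul (by positivity) hδ.le (by positivity)).trans_eq ?_
    simp only [hY]
    congr 2
    rw [← Real.rpow_natCast, ← Real.rpow_mul (norm_nonneg _)]
    congr 1; push_cast; ring
  have hae : ∀ᵐ ζ ∂(volume.restrict E), t * (Real.log (‖p.eval (circleEmbed ζ)‖ ^ 2 + δ) / 2) ≤
      Y ζ * w ζ / η + Real.log η + (nlog (w ζ)).toReal := by
    filter_upwards [ae_lt_top' hnm hfin] with ζ hζ
    have hwp : 0 < w ζ := by
      refine lt_of_le_of_ne (hw0 ζ) fun h => ?_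
      rw [← h, nlog, if_pos rfl] at hζ
      exact lt_irrefl _ hζ
    have hX : 0 < (‖p.eval (circleEmbed ζ)‖ ^ 2 + δ) ^ (t / 2) := Real.rpow_pos_of_pos (hpos ζ) _
    have e : t * (Real.log (‖p.eval (circleEmbed ζ)‖ ^ 2 + δ) / 2) =
        Real.log ((‖p.eval (circleEmbed ζ)‖ ^ 2 + δ) ^ (t / 2)) := by
      rw [Real.log_rpow (hpos ζ)]; ring
    have h1 := Real.log_le_sub_one_of_pos (show 0 < (‖p.eval (circleEmbed ζ)‖ ^ 2 + δ) ^ (t / 2) *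
      w ζ / η by positivity)
    rw [Real.log_div (by positivity) hη.ne', Real.log_mul hX.ne' hwp.ne'] at h1
    have h2 := neg_log_le_toReal_nlog hwp
    have h3 : (‖p.eval (circleEmbed ζ)‖ ^ 2 + δ) ^ (t / 2) * w ζ / η ≤ Y ζ * w ζ / η := by
      gcongr
      exact hYle ζ
    rw [e]; linarith
  have hUi : Integrable (fun ζ => Real.log (‖p.eval (circleEmbed ζ)‖ ^ 2 + δ) / 2)
      (volume.restrict E) :=
    (hcU.integrable_of_hasCompactSupport (HasCompactSupport.of_compactSpace _)).restrict
  have hYi : Integrable (fun ζ => Y ζ * w ζ / η) (volume.restrict E) := (hYw.div_const η).restrict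
  have hmono := integral_mono_ae (hUi.const_mul t)
    ((hYi.add (integrable_const (Real.log η))).add hni) hae
  rw [integral_const_mul] at hmono
  refine hmono.trans ?_
  rw [integral_add' (hYi.add (integrable_const (Real.log η))) hni,
    integral_add' hYi (integrable_const (Real.log η)), integral_const, integral_div]
  have hint : ∫ ζ, Y ζ * w ζ = 2 ^ (t / 2) * ((∫ ζ, ‖p.eval (circleEmbed ζ)‖ ^ t * w ζ) +
      δ ^ (t / 2) * ∫ ζ, w ζ) := by
    simp only [hY, mul_assoc, add_mul]
    rw [integral_const_mul, integral_add (integrable_continuous_mul hw1 hct) (hw1.const_mul _),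
      integral_const_mul]
  have hYE : ∫ ζ in E, Y ζ * w ζ ≤ ∫ ζ, Y ζ * w ζ :=
    setIntegral_le_integral hYw (Eventually.of_forall fun ζ =>
      mul_nonneg (by simp only [hY]; positivity) (hw0 ζ))
  rw [hint] at hYE
  simp only [smul_eq_mul, measureReal_restrict_apply_univ]
  exact add_le_add (add_le_add (div_le_div_of_nonneg_right hYE hη.le) le_rfl) le_rfl

theorem lintegral_nlog_eq_top_of_splits {t β : ℝ} (ht : 0 < t) (hβ : -1 < β)
    {w : UnitCircle → ℝ} (hw0 : ∀ ζ, 0 ≤ w ζ) (hw1 : Integrable w volume) {p : ℕ → Polynomial ℂ}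
    (h1 : Tendsto (fun k => ∫⁻ ζ, (‖(p k).eval (circleEmbed ζ)‖₊ : ENNReal) ^ t *
          ENNReal.ofReal (w ζ)) atTop (𝓝 0))
    (h2 : Tendsto (fun k => bergmanIntegral t β fun z => (p k).eval z - 1) atTop (𝓝 0))
    {E : Set UnitCircle} (hE : IsCarlesonSet E) (hpos : 0 < volume E) :
    ∫⁻ ζ in E, nlog (w ζ) = ⊤ := by
  by_contra hfin
  obtain ⟨K, ε, hε, hK⟩ := exists_logIntegral_ge ht hβ hE (nonempty_of_measure_ne_zero hpos.ne')
  set m := (volume E).toReal with hm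
  have hm0 : 0 < m := ENNReal.toReal_pos hpos.ne' (measure_ne_top _ _)
  set N := ∫ ζ in E, (nlog (w ζ)).toReal with hN
  set W := ∫ ζ, w ζ with hW
  have hW0 : 0 ≤ W := integral_nonneg hw0
  set A : ℝ := 2 ^ (t / 2) * 2 with hA
  set η := Real.exp (-((A + N - t * K + 1) / m)) with hη
  have hη0 : 0 < η := Real.exp_pos _
  obtain ⟨k, hk1, hk2⟩ := ((h1.eventually (ge_mem_nhds (ENNReal.ofReal_pos.2 hη0))).and
    (h2.eventually (ge_mem_nhds (ENNReal.ofReal_pos.2 hε)))).exists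
  have hδ : ∃ δ ∈ Ioc (0:ℝ) 1, δ ^ (t / 2) * W ≤ η := by
    have : Tendsto (fun δ : ℝ => δ ^ (t / 2) * W) (𝓝[>] 0) (𝓝 0) := by
      have hc : Continuous fun δ : ℝ => δ ^ (t / 2) * W :=
        (Real.continuous_rpow_const (by positivity)).mul_const W
      refine (hc.tendsto' 0 0 ?_).mono_left nhdsWithin_le_nhds
      rw [Real.zero_rpow (by positivity), zero_mul]
    obtain ⟨δ, hδ1, hδ2⟩ := ((this.eventually (ge_mem_nhds hη0)).and
      (Ioc_mem_nhdsGT (zero_lt_one' ℝ))).exists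
    exact ⟨δ, hδ2, hδ1⟩
  obtain ⟨δ, hδ1, hδ2⟩ := hδ
  have hlow := hK (p k) hk2 δ hδ1
  have hup := logIntegral_le ht hw0 hw1 hfin (p k) hδ1.1 hη0
  have hct : Continuous fun ζ => ‖(p k).eval (circleEmbed ζ)‖ ^ t :=
    ((p k).continuous.comp continuous_circleEmbed).norm.rpow_const fun _ => Or.inr ht.le
  have hI : ∫ ζ, ‖(p k).eval (circleEmbed ζ)‖ ^ t * w ζ ≤ η := by
    rw [← ENNReal.ofReal_le_ofReal_iff hη0.le, ofReal_integral_eq_lintegral_ofReal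
      (integrable_continuous_mul hw1 hct) (Eventually.of_forall fun ζ =>
        mul_nonneg (by positivity) (hw0 ζ))]
    refine le_trans (lintegral_mono fun ζ => ?_) hk1
    rw [coe_nnnorm_rpow ht.le, ENNReal.ofReal_mul (by positivity)]
  have hA' : 2 ^ (t / 2) * ((∫ ζ, ‖(p k).eval (circleEmbed ζ)‖ ^ t * w ζ) + δ ^ (t / 2) * W) / η ≤ A := by
    rw [div_le_iff₀ hη0, hA, mul_assoc]
    gcongr
    linarith
  have hlog : m * Real.log η = -(A + N - t * K + 1) := by
    rw [hη, Real.log_exp]; field_simp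
  have := mul_le_mul_of_nonneg_left hlow ht.le
  linarith

section

open scoped NNReal ENNReal

/-- The length `2π / 2 ^ m` of a dyadic arc of generation `m`. -/
def dyadicLen (m : ℕ) : ℝ := 2 * Real.pi / 2 ^ m

/-- The `j`-th dyadic arc of generation `m`. -/
def dyadicArc (m j : ℕ) : Set ℝ := Ico (j * dyadicLen m) ((j + 1) * dyadicLen m)

/-- The index of the dyadic arc of generation `m` that contains `x`. -/
def dyadicIdx (m : ℕ) (x : ℝ) : ℕ := ⌊x / dyadicLen m⌋₊

lemma dyadicLen_pos (m : ℕ) : 0 < dyadicLen m := by unfold dyadicLen; positivity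

lemma dyadicLen_eq_pow_mul {k m : ℕ} (h : k ≤ m) : dyadicLen k = 2 ^ (m - k) * dyadicLen m := by
  unfold dyadicLen
  obtain ⟨e, rfl⟩ := Nat.exists_eq_add_of_le h
  rw [Nat.add_sub_cancel_left, pow_add]; field_simp

lemma two_pow_mul_dyadicLen (m : ℕ) : 2 ^ m * dyadicLen m = 2 * Real.pi := by
  unfold dyadicLen; field_simp

lemma mem_dyadicArc_iff {m j : ℕ} {x : ℝ} (hx : 0 ≤ x) : x ∈ dyadicArc m j ↔ dyadicIdx m x = j := by
  have h := dyadicLen_pos m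
  rw [dyadicIdx, Nat.floor_eq_iff (by positivity), le_div_iff₀ h, div_lt_iff₀ h]
  rfl

lemma nonneg_of_mem_dyadicArc {m j : ℕ} {x : ℝ} (hx : x ∈ dyadicArc m j) : 0 ≤ x :=
  le_trans (mul_nonneg (Nat.cast_nonneg j) (dyadicLen_pos m).le) hx.1

lemma dyadicIdx_eq {m j : ℕ} {x : ℝ} (hx : x ∈ dyadicArc m j) : dyadicIdx m x = j :=
  (mem_dyadicArc_iff (nonneg_of_mem_dyadicArc hx)).1 hx

lemma mem_dyadicArc_dyadicIdx {m : ℕ} {x : ℝ} (hx : 0 ≤ x) : x ∈ dyadicArc m (dyadicIdx m x) :=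
  (mem_dyadicArc_iff hx).2 rfl

lemma dyadicIdx_div {k m : ℕ} (h : k ≤ m) (x : ℝ) :
    dyadicIdx k x = dyadicIdx m x / 2 ^ (m - k) := by
  unfold dyadicIdx
  have := Nat.floor_div_natCast (x / dyadicLen m) (2 ^ (m - k))
  rw [← this, dyadicLen_eq_pow_mul h]
  congr 1
  push_cast
  rw [div_div, mul_comm]

lemma measurableSet_dyadicArc (m j : ℕ) : MeasurableSet (dyadicArc m j) := measurableSet_Ico

lemma volume_dyadicArc (m j : ℕ) : volume (dyadicArc m j) = ENNReal.ofReal (dyadicLen m) := by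
  rw [dyadicArc, Real.volume_Ico]; congr 1; ring

lemma measurable_dyadicIdx (m : ℕ) : Measurable (dyadicIdx m) :=
  Nat.measurable_floor.comp (measurable_id.div_const _)

lemma disjoint_dyadicArc {m i j : ℕ} (h : i ≠ j) : Disjoint (dyadicArc m i) (dyadicArc m j) :=
  Set.disjoint_left.2 fun _ hi hj => h ((dyadicIdx_eq hi).symm.trans (dyadicIdx_eq hj))

lemma dyadicIdx_lt {m : ℕ} {x : ℝ} (hx : x ∈ Ico 0 (2 * Real.pi)) : dyadicIdx m x < 2 ^ m := by
  have h := dyadicLen_pos m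
  rw [dyadicIdx, Nat.floor_lt (div_nonneg hx.1 h.le), div_lt_iff₀ h]
  push_cast
  rw [two_pow_mul_dyadicLen]; exact hx.2

lemma dyadicArc_subset {m j : ℕ} (hj : j < 2 ^ m) : dyadicArc m j ⊆ Ico 0 (2 * Real.pi) := by
  intro x hx
  refine ⟨nonneg_of_mem_dyadicArc hx, hx.2.trans_le ?_⟩
  rw [← two_pow_mul_dyadicLen m]
  have : ((j : ℝ) + 1) ≤ 2 ^ m := by exact_mod_cast hj
  exact mul_le_mul_of_nonneg_right this (dyadicLen_pos m).le

lemma iUnion_dyadicArc (m : ℕ) : ⋃ j ∈ Finset.range (2 ^ m), dyadicArc m j = Ico 0 (2 * Real.pi) := by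
  ext x
  simp only [mem_iUnion, Finset.mem_range, exists_prop]
  exact ⟨fun ⟨j, hj, hx⟩ => dyadicArc_subset hj hx,
    fun hx => ⟨_, dyadicIdx_lt hx, mem_dyadicArc_dyadicIdx hx.1⟩⟩

lemma dyadicArc_split (m j : ℕ) :
    dyadicArc m j = dyadicArc (m + 1) (2 * j) ∪ dyadicArc (m + 1) (2 * j + 1) := by
  ext x
  by_cases hx : 0 ≤ x
  · rw [mem_union, mem_dyadicArc_iff hx, mem_dyadicArc_iff hx, mem_dyadicArc_iff hx,
      dyadicIdx_div (Nat.le_succ m), Nat.succ_eq_add_one, Nat.add_sub_cancel_left, pow_one]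
    omega
  · refine ⟨fun h => absurd (nonneg_of_mem_dyadicArc h) hx, ?_⟩
    rintro (h | h) <;> exact absurd (nonneg_of_mem_dyadicArc h) hx

/-- The capacity `c * m * |J|` of a dyadic arc `J` of generation `m`. -/
def dyadicCap (c : ℝ≥0) (m : ℕ) : ℝ≥0∞ := c * m * ENNReal.ofReal (dyadicLen m)

lemma dyadicCap_ne_top (c : ℝ≥0) (m : ℕ) : dyadicCap c m ≠ ⊤ := by
  unfold dyadicCap; finiteness

lemma dyadicCap_pos {c : ℝ≥0} (hc : 0 < c) {m : ℕ} (hm : 0 < m) : 0 < dyadicCap c m := by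
  have := dyadicLen_pos m
  unfold dyadicCap
  have h1 : (0 : ℝ≥0∞) < ENNReal.ofReal (dyadicLen m) := ENNReal.ofReal_pos.2 this
  have h2 : (0 : ℝ≥0∞) < c := by exact_mod_cast hc
  have h3 : (0 : ℝ≥0∞) < m := by exact_mod_cast hm
  positivity

/-- Starting from `min R (c * (m + d))`, cut the mass on the dyadic arcs of generations
`m + d - 1, …, m` down to their capacities. -/
def flow (c : ℝ≥0) (R : ℝ → ℝ≥0∞) : ℕ → ℕ → ℝ → ℝ≥0∞
  | 0, m => fun x => min (R x) (c * m)
  | d + 1, m => fun x => dyadicCap c m / max (dyadicCap c m)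
      (∫⁻ y in dyadicArc m (dyadicIdx m x), flow c R d (m + 1) y) * flow c R d (m + 1) x

variable {c : ℝ≥0} {R : ℝ → ℝ≥0∞}

lemma measurable_flow (hR : Measurable R) (d m : ℕ) : Measurable (flow c R d m) := by
  induction d generalizing m with
  | zero => exact hR.min measurable_const
  | succ d ih =>
    refine Measurable.mul ?_ (ih (m + 1))
    exact (measurable_from_nat (f := fun j => dyadicCap c m / max (dyadicCap c m)
      (∫⁻ y in dyadicArc m j, flow c R d (m + 1) y))).comp (measurable_dyadicIdx m)

lemma flow_succ_le (d m : ℕ) (x : ℝ) : flow c R (d + 1) m x ≤ flow c R d (m + 1) x := by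
  rw [flow]
  refine mul_le_of_le_one_left zero_le (ENNReal.div_le_of_le_mul ?_)
  rw [one_mul]; exact le_max_left _ _

lemma flow_le (d m : ℕ) (x : ℝ) : flow c R d m x ≤ min (R x) (c * (m + d : ℕ)) := by
  induction d generalizing m with
  | zero => exact le_rfl
  | succ d ih =>
    refine (flow_succ_le d m x).trans ((ih (m + 1)).trans_eq ?_)
    rw [show m + 1 + d = m + (d + 1) by ring]

lemma setLIntegral_le_dyadicCap {f : ℝ → ℝ≥0∞} {m k j : ℕ} (hf : ∀ x, f x ≤ c * m) (h : m ≤ k) :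
    ∫⁻ x in dyadicArc k j, f x ≤ dyadicCap c k := by
  calc ∫⁻ x in dyadicArc k j, f x ≤ ∫⁻ _ in dyadicArc k j, (c * m : ℝ≥0∞) := lintegral_mono hf
    _ = c * m * ENNReal.ofReal (dyadicLen k) := by rw [setLIntegral_const, volume_dyadicArc]
    _ ≤ _ := by unfold dyadicCap; gcongr

lemma setLIntegral_flow_succ (hc : 0 < c) {m : ℕ} (hm : 0 < m) (d j : ℕ) :
    ∫⁻ x in dyadicArc m j, flow c R (d + 1) m x =
      min (dyadicCap c m) (∫⁻ x in dyadicArc m j, flow c R d (m + 1) x) := by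
  set A := ∫⁻ x in dyadicArc m j, flow c R d (m + 1) x with hA
  have hκ := dyadicCap_pos hc hm
  have hκt := dyadicCap_ne_top c m
  have h0 : max (dyadicCap c m) A ≠ 0 := (hκ.trans_le (le_max_left _ _)).ne'
  have hfac : dyadicCap c m / max (dyadicCap c m) A ≠ ⊤ := ENNReal.div_ne_top hκt h0
  have h1 : ∫⁻ x in dyadicArc m j, flow c R (d + 1) m x =
      ∫⁻ x in dyadicArc m j, dyadicCap c m / max (dyadicCap c m) A * flow c R d (m + 1) x := by
    refine setLIntegral_congr_fun (measurableSet_dyadicArc m j) fun x hx => ?_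
    simp only [flow, dyadicIdx_eq hx, ← hA]
  rw [h1, lintegral_const_mul' _ _ hfac, ← hA]
  have hAt : A ≠ ⊤ := by
    refine ne_top_of_le_ne_top ?_ (lintegral_mono fun x => (flow_le d (m + 1) x).trans (min_le_right _ _))
    rw [setLIntegral_const, volume_dyadicArc]
    finiteness
  rcases le_total A (dyadicCap c m) with h | h
  · rw [max_eq_left h, min_eq_right h, ENNReal.div_self hκ.ne' hκt, one_mul]
  · rw [max_eq_right h, min_eq_left h, ENNReal.div_mul_cancel (hκ.trans_le h).ne' hAt]

lemma setLIntegral_split (f : ℝ → ℝ≥0∞) (m j : ℕ) : ∫⁻ x in dyadicArc m j, f x =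
    (∫⁻ x in dyadicArc (m + 1) (2 * j), f x) + ∫⁻ x in dyadicArc (m + 1) (2 * j + 1), f x := by
  rw [dyadicArc_split, lintegral_union (measurableSet_dyadicArc _ _) (disjoint_dyadicArc (by omega))]

lemma setLIntegral_flow_mono (hc : 0 < c) {m : ℕ} (hm : 0 < m) (j : ℕ) :
    Monotone fun d => ∫⁻ x in dyadicArc m j, flow c R d m x := by
  refine monotone_nat_of_le_succ fun d => ?_
  induction d generalizing m j with
  | zero =>
    rw [setLIntegral_flow_succ hc hm]
    refine le_min (setLIntegral_le_dyadicCap (fun x => min_le_right _ _) le_rfl)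
      (lintegral_mono fun x => ?_)
    simp only [flow]
    gcongr
    exact Nat.le_succ m
  | succ d ih =>
    rw [setLIntegral_flow_succ hc hm, setLIntegral_flow_succ hc hm, setLIntegral_split _ m j,
      setLIntegral_split _ m j]
    exact min_le_min_left _ (add_le_add (ih (Nat.succ_pos m) _) (ih (Nat.succ_pos m) _))

lemma setLIntegral_flow_le (hc : 0 < c) {m k : ℕ} (hm : 0 < m) (hk : m ≤ k) (d j : ℕ) :
    ∫⁻ x in dyadicArc k j, flow c R d m x ≤ dyadicCap c k := by
  induction d generalizing m with
  | zero => exact setLIntegral_le_dyadicCap (fun x => min_le_right _ _) hk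
  | succ d ih =>
    rcases hk.eq_or_lt with rfl | h
    · rw [setLIntegral_flow_succ hc hm]; exact min_le_left _ _
    · exact (lintegral_mono fun x => flow_succ_le d m x).trans (ih (Nat.succ_pos m) h)

/-- The arc `(m, j)` is filled up to its capacity by some `flow c R d m`. -/
def IsSaturated (c : ℝ≥0) (R : ℝ → ℝ≥0∞) (m j : ℕ) : Prop :=
  ∃ d, dyadicCap c m ≤ ∫⁻ x in dyadicArc m j, flow c R d m x

lemma flow_eq_of_not_isSaturated (hc : 0 < c) {m : ℕ} (hm : 0 < m) {x : ℝ} (d : ℕ)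
    (h : ¬ IsSaturated c R m (dyadicIdx m x)) : flow c R (d + 1) m x = flow c R d (m + 1) x := by
  have hlt : ∫⁻ y in dyadicArc m (dyadicIdx m x), flow c R (d + 1) m y < dyadicCap c m := by
    by_contra hcon
    exact h ⟨d + 1, not_lt.1 hcon⟩
  rw [setLIntegral_flow_succ hc hm, min_lt_iff] at hlt
  have hle := (hlt.resolve_left (lt_irrefl _)).le
  simp only [flow]
  rw [max_eq_left hle, ENNReal.div_self (dyadicCap_pos hc hm).ne' (dyadicCap_ne_top c m), one_mul]

lemma flow_eq_of_forall_not_isSaturated (hc : 0 < c) {n : ℕ} (hn : 0 < n) {x : ℝ}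
    (d e : ℕ) (h : ∀ k, n ≤ k → k < n + e → ¬ IsSaturated c R k (dyadicIdx k x)) :
    flow c R (d + e) n x = flow c R d (n + e) x := by
  induction e generalizing n with
  | zero => rfl
  | succ e ih =>
    rw [← add_assoc, flow_eq_of_not_isSaturated hc hn _ (h n le_rfl (by omega)),
      ih (Nat.succ_pos n) fun k h1 h2 => h k (by omega) (by omega)]
    congr 1; omega

end

section

open scoped NNReal ENNReal
variable {c : ℝ≥0} {R : ℝ → ℝ≥0∞}

/-- `p = (m, j)` is a maximal saturated arc among those of generation at least `n`. -/
def IsTopArc (c : ℝ≥0) (R : ℝ → ℝ≥0∞) (n : ℕ) (p : ℕ × ℕ) : Prop :=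
  n ≤ p.1 ∧ p.2 < 2 ^ p.1 ∧ IsSaturated c R p.1 p.2 ∧
    ∀ k, n ≤ k → k < p.1 → ¬ IsSaturated c R k (p.2 / 2 ^ (p.1 - k))

lemma IsTopArc.not_lt {n : ℕ} {p q : ℕ × ℕ} (hp : IsTopArc c R n p) (hq : IsTopArc c R n q) {x : ℝ}
    (hxp : x ∈ dyadicArc p.1 p.2) (hxq : x ∈ dyadicArc q.1 q.2) : ¬ p.1 < q.1 := by
  intro h
  have h1 := hq.2.2.2 p.1 hp.1 h
  rw [← dyadicIdx_eq hxq, ← dyadicIdx_div h.le, dyadicIdx_eq hxp] at h1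
  exact h1 hp.2.2.1

lemma IsTopArc.disjoint {n : ℕ} {p q : ℕ × ℕ} (hp : IsTopArc c R n p) (hq : IsTopArc c R n q)
    (hpq : p ≠ q) : Disjoint (dyadicArc p.1 p.2) (dyadicArc q.1 q.2) := by
  refine Set.disjoint_left.2 fun x hxp hxq => hpq ?_
  have h1 : p.1 = q.1 := le_antisymm (le_of_not_gt (hq.not_lt hp hxq hxp))
    (le_of_not_gt (hp.not_lt hq hxp hxq))
  refine Prod.ext h1 ?_
  rw [← dyadicIdx_eq hxp, ← dyadicIdx_eq hxq, h1]

lemma lintegral_flow_le (hc : 0 < c) {n : ℕ} (hn : 0 < n) (d : ℕ) :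
    ∫⁻ x in Ico 0 (2 * Real.pi), flow c R d n x ≤ c * n * ENNReal.ofReal (2 * Real.pi) := by
  rw [← iUnion_dyadicArc n, lintegral_biUnion_finset
    (fun i _ j _ h => disjoint_dyadicArc h) fun j _ => measurableSet_dyadicArc n j]
  refine (Finset.sum_le_sum fun j _ => setLIntegral_flow_le hc hn le_rfl d j).trans_eq ?_
  rw [Finset.sum_const, Finset.card_range, nsmul_eq_mul, dyadicCap, ← two_pow_mul_dyadicLen n,
    ENNReal.ofReal_mul (by positivity), ENNReal.ofReal_pow (by norm_num)]
  push_cast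
  rw [ENNReal.ofReal_ofNat]
  ring

lemma sum_dyadicCap_le (hc : 0 < c) {n : ℕ} (hn : 0 < n) (S : Finset (ℕ × ℕ))
    (hS : ∀ p ∈ S, IsTopArc c R n p) :
    ∑ p ∈ S, dyadicCap c p.1 ≤ c * n * ENNReal.ofReal (2 * Real.pi) := by
  have hex : ∀ p : ℕ × ℕ, ∃ d, p ∈ S → dyadicCap c p.1 ≤ ∫⁻ x in dyadicArc p.1 p.2, flow c R d p.1 x := by
    intro p
    by_cases hp : p ∈ S
    · obtain ⟨d, hd⟩ := (hS p hp).2.2.1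
      exact ⟨d, fun _ => hd⟩
    · exact ⟨0, fun h => absurd h hp⟩
  choose e he using hex
  set D := ∑ p ∈ S, (e p + p.1) with hD
  have hle : ∀ p ∈ S, e p + p.1 ≤ D := fun p hp =>
    Finset.single_le_sum (f := fun p => e p + p.1) (fun _ _ => Nat.zero_le _) hp
  have hstep : ∀ p ∈ S, dyadicCap c p.1 ≤ ∫⁻ x in dyadicArc p.1 p.2, flow c R (D - n) n x := by
    intro p hp
    have hT := hS p hp
    have h1 := hle p hp
    refine (he p hp).trans ((setLIntegral_flow_mono hc (hn.trans_le hT.1) p.2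
      (show e p ≤ D - p.1 by omega)).trans_eq ?_)
    refine setLIntegral_congr_fun (measurableSet_dyadicArc _ _) fun x hx => ?_
    have h2 := flow_eq_of_forall_not_isSaturated (R := R) hc hn (x := x) (D - p.1) (p.1 - n) ?_
    · have h3 := hT.1
      rw [show D - n = D - p.1 + (p.1 - n) by omega, h2, show n + (p.1 - n) = p.1 by omega]
    · intro k hk1 hk2
      have h3 := hT.1
      have h4 := hT.2.2.2 k hk1 (by omega)
      rwa [← dyadicIdx_eq hx, ← dyadicIdx_div (by omega)] at h4
  refine (Finset.sum_le_sum hstep).trans ?_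
  rw [← lintegral_biUnion_finset (fun p hp q hq h => (hS p hp).disjoint (hS q hq) h)
    fun p _ => measurableSet_dyadicArc _ _]
  refine (lintegral_mono_set ?_).trans (lintegral_flow_le (R := R) hc hn (D - n))
  exact iUnion₂_subset fun p hp => dyadicArc_subset (hS p hp).2.1

lemma tsum_dyadicCap_le (hc : 0 < c) {n : ℕ} (hn : 0 < n) :
    ∑' p : {p // IsTopArc c R n p}, dyadicCap c p.1.1 ≤ c * n * ENNReal.ofReal (2 * Real.pi) := by
  rw [ENNReal.tsum_eq_iSup_sum]
  refine iSup_le fun S => ?_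
  have := sum_dyadicCap_le hc hn (S.map (Function.Embedding.subtype (IsTopArc c R n))) (by
    intro p hp
    obtain ⟨q, _, rfl⟩ := Finset.mem_map.1 hp
    exact q.2)
  rwa [Finset.sum_map] at this

/-- The points that lie in no saturated arc of generation at least `n`. -/
def uncovered (c : ℝ≥0) (R : ℝ → ℝ≥0∞) (n : ℕ) : Set ℝ :=
  {x ∈ Ico 0 (2 * Real.pi) | ∀ k, n ≤ k → ¬ IsSaturated c R k (dyadicIdx k x)}

lemma measurableSet_uncovered (n : ℕ) : MeasurableSet (uncovered c R n) := by
  refine measurableSet_Ico.inter (measurableSet_setOfPred.2 ?_)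
  refine Measurable.forall fun k => Measurable.imp measurable_const ?_
  exact (measurable_from_nat (f := fun j => ¬ IsSaturated c R k j)).comp (measurable_dyadicIdx k)

lemma setLIntegral_uncovered_le (hc : 0 < c) (hR : Measurable R) {n : ℕ} (hn : 0 < n) :
    ∫⁻ x in uncovered c R n, R x ≤ c * n * ENNReal.ofReal (2 * Real.pi) := by
  have hsup : ∀ x, R x = ⨆ d : ℕ, min (R x) (c * (n + d : ℕ)) := by
    intro x
    have hc' : (c : ℝ≥0∞) ≠ 0 := by exact_mod_cast hc.ne'
    have : ⨆ d : ℕ, (c * (n + d : ℕ) : ℝ≥0∞) = ⊤ := by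
      rw [← ENNReal.mul_iSup]
      have h1 : ⨆ d : ℕ, ((n + d : ℕ) : ℝ≥0∞) = ⊤ := by
        refine top_le_iff.1 ?_
        rw [← ENNReal.iSup_natCast]
        exact iSup_mono fun d => by exact_mod_cast Nat.le_add_left d n
      rw [h1, ENNReal.mul_top hc']
    rw [← inf_iSup_eq, this, inf_top_eq]
  calc ∫⁻ x in uncovered c R n, R x
      = ∫⁻ x in uncovered c R n, ⨆ d : ℕ, min (R x) (c * (n + d : ℕ)) := by simp_rw [← hsup]
    _ = ⨆ d : ℕ, ∫⁻ x in uncovered c R n, min (R x) (c * (n + d : ℕ)) := by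
      refine lintegral_iSup (fun d => hR.min measurable_const) fun d e hde x => ?_
      simp only
      gcongr
    _ ≤ _ := by
      refine iSup_le fun d => ?_
      refine le_trans (le_of_eq ?_) ((lintegral_mono_set (inter_subset_left :
        uncovered c R n ⊆ Ico 0 (2 * Real.pi))).trans
        (lintegral_flow_le (R := R) hc hn d))
      refine setLIntegral_congr_fun (measurableSet_uncovered n) fun x hx => ?_
      have := flow_eq_of_forall_not_isSaturated (R := R) hc hn (x := x) 0 d
        fun k hk _ => hx.2 k hk
      rw [zero_add] at this
      rw [this]; rfl

lemma exists_isTopArc {n : ℕ} {x : ℝ} (hx : x ∈ Ico 0 (2 * Real.pi)) (hu : x ∉ uncovered c R n) :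
    ∃ p, IsTopArc c R n p ∧ x ∈ dyadicArc p.1 p.2 := by
  classical
  have h : ∃ k, n ≤ k ∧ IsSaturated c R k (dyadicIdx k x) := by
    by_contra hcon
    push Not at hcon
    exact hu ⟨hx, hcon⟩
  refine ⟨(Nat.find h, dyadicIdx (Nat.find h) x), ⟨(Nat.find_spec h).1, dyadicIdx_lt hx,
    (Nat.find_spec h).2, fun k hk1 hk2 => ?_⟩, mem_dyadicArc_dyadicIdx hx.1⟩
  have := Nat.find_min h hk2
  rw [← dyadicIdx_div hk2.le]
  tauto

/-- If almost every point lies in a saturated arc, then every arc of generation `n` is saturated. -/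
lemma isSaturated_of_volume_uncovered (hc : 0 < c) {n : ℕ} (hn : 0 < n)
    (h : volume (uncovered c R n) = 0) {j : ℕ} (hj : j < 2 ^ n) : IsSaturated c R n j := by
  have hvol : ENNReal.ofReal (2 * Real.pi) ≤
      ∑' p : {p // IsTopArc c R n p}, ENNReal.ofReal (dyadicLen p.1.1) := by
    calc ENNReal.ofReal (2 * Real.pi) = volume (Ico 0 (2 * Real.pi)) := by simp
      _ ≤ volume (uncovered c R n ∪ ⋃ p : {p // IsTopArc c R n p}, dyadicArc p.1.1 p.1.2) := by
        refine measure_mono fun x hx => ?_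
        by_cases hu : x ∈ uncovered c R n
        · exact Or.inl hu
        · obtain ⟨p, hp, hxp⟩ := exists_isTopArc hx hu
          exact Or.inr (mem_iUnion.2 ⟨⟨p, hp⟩, hxp⟩)
      _ ≤ volume (uncovered c R n) + ∑' p : {p // IsTopArc c R n p}, volume (dyadicArc p.1.1 p.1.2) :=
        (measure_union_le _ _).trans (add_le_add le_rfl (measure_iUnion_le _))
      _ = _ := by rw [h, zero_add]; simp_rw [volume_dyadicArc]
  have hsum := tsum_dyadicCap_le (R := R) hc hn
  have hall : ∀ p : {p // IsTopArc c R n p}, p.1.1 = n := by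
    intro p
    by_contra hp
    have hlt : n < p.1.1 := lt_of_le_of_ne p.2.1 (Ne.symm hp)
    have h1 : ∑' p : {p // IsTopArc c R n p}, c * n * ENNReal.ofReal (dyadicLen p.1.1) <
        ∑' p : {p // IsTopArc c R n p}, dyadicCap c p.1.1 := by
      have hle : ∀ q : {p // IsTopArc c R n p}, c * n * ENNReal.ofReal (dyadicLen q.1.1) ≤
          dyadicCap c q.1.1 := fun q => by
        have := q.2.1
        unfold dyadicCap; gcongr
      refine ENNReal.tsum_lt_tsum ?_ hle (i := p) ?_
      · exact ne_top_of_le_ne_top (by finiteness) ((ENNReal.tsum_le_tsum hle).trans hsum)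
      · unfold dyadicCap
        have h2 := dyadicLen_pos p.1.1
        have h3 : (c : ℝ≥0∞) ≠ 0 := by exact_mod_cast hc.ne'
        have h4 : ENNReal.ofReal (dyadicLen p.1.1) ≠ 0 := (ENNReal.ofReal_pos.2 h2).ne'
        refine ENNReal.mul_lt_mul_left h4 (by finiteness) (ENNReal.mul_lt_mul_right h3 (by finiteness) ?_)
        exact_mod_cast hlt
    rw [ENNReal.tsum_mul_left] at h1
    exact absurd (h1.trans_le hsum) (not_lt.2 (mul_le_mul_right hvol _))
  have hpos : ¬ dyadicArc n j ⊆ uncovered c R n := fun hsub => by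
    have := measure_mono_null hsub h
    rw [volume_dyadicArc, ENNReal.ofReal_eq_zero] at this
    exact absurd (dyadicLen_pos n) (not_lt.2 this)
  obtain ⟨x, hx, hu⟩ := Set.not_subset.1 hpos
  obtain ⟨p, hp, hxp⟩ := exists_isTopArc (dyadicArc_subset hj hx) hu
  have h1 := hall ⟨p, hp⟩
  have h2 := hp.2.2.1
  simp only at h1
  rw [← dyadicIdx_eq hxp, h1, dyadicIdx_eq hx] at h2
  exact h2

lemma measurePreserving_coe_Ico :
    MeasurePreserving (fun x : ℝ => (x : UnitCircle)) (volume.restrict (Ico 0 (2 * Real.pi))) volume := by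
  have := AddCircle.measurePreserving_mk (2 * Real.pi) 0
  rwa [zero_add, ← Measure.restrict_congr_set (Ico_ae_eq_Ioc (a := (0 : ℝ)) (b := 2 * Real.pi))] at this

lemma coe_injOn_Ico : InjOn (fun x : ℝ => (x : UnitCircle)) (Ico 0 (2 * Real.pi)) := by
  intro x hx y hy h
  have e : (2 * Real.pi) = 0 + 2 * Real.pi := (zero_add _).symm
  rw [e] at hx hy
  exact (AddCircle.coe_eq_coe_iff_of_mem_Ico hx hy).1 h

/-- The open arc of the circle given by the interior of the dyadic arc `p = (m, j)`. -/
def openArc (p : ℕ × ℕ) : Set UnitCircle :=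
  (fun x : ℝ => (x : UnitCircle)) '' Ioo (p.2 * dyadicLen p.1) ((p.2 + 1) * dyadicLen p.1)

lemma isOpen_openArc (p : ℕ × ℕ) : IsOpen (openArc p) := QuotientAddGroup.isOpenMap_coe _ isOpen_Ioo

lemma isPreconnected_openArc (p : ℕ × ℕ) : IsPreconnected (openArc p) :=
  isPreconnected_Ioo.image _ (AddCircle.continuous_mk' _).continuousOn

lemma coe_mem_openArc {p : ℕ × ℕ} (hp : p.2 < 2 ^ p.1) {x : ℝ} (hx : x ∈ Ico 0 (2 * Real.pi)) :
    (x : UnitCircle) ∈ openArc p ↔ x ∈ Ioo (p.2 * dyadicLen p.1) ((p.2 + 1) * dyadicLen p.1) := by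
  refine ⟨?_, fun h => ⟨x, h, rfl⟩⟩
  rintro ⟨y, hy, hyx⟩
  rwa [← coe_injOn_Ico (dyadicArc_subset hp (Ioo_subset_Ico_self hy)) hx hyx]

lemma volume_openArc {p : ℕ × ℕ} (hp : p.2 < 2 ^ p.1) :
    volume (openArc p) = ENNReal.ofReal (dyadicLen p.1) := by
  rw [← measurePreserving_coe_Ico.measure_preimage (isOpen_openArc p).measurableSet.nullMeasurableSet,
    Measure.restrict_apply ((isOpen_openArc p).measurableSet.preimage measurePreserving_coe_Ico.measurable)]
  have : (fun x : ℝ => (x : UnitCircle)) ⁻¹' openArc p ∩ Ico 0 (2 * Real.pi) =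
      Ioo (p.2 * dyadicLen p.1) ((p.2 + 1) * dyadicLen p.1) := by
    ext x
    refine ⟨fun h => (coe_mem_openArc hp h.2).1 h.1, fun h => ?_⟩
    exact ⟨⟨x, h, rfl⟩, dyadicArc_subset hp (Ioo_subset_Ico_self h)⟩
  rw [this, Real.volume_Ioo]
  congr 1; ring

lemma disjoint_openArc {p q : ℕ × ℕ} (hp : p.2 < 2 ^ p.1) (hq : q.2 < 2 ^ q.1)
    (h : Disjoint (dyadicArc p.1 p.2) (dyadicArc q.1 q.2)) : Disjoint (openArc p) (openArc q) := by
  refine Set.disjoint_left.2 ?_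
  rintro _ ⟨x, hx, rfl⟩ hxq
  have := (coe_mem_openArc hq (dyadicArc_subset hp (Ioo_subset_Ico_self hx))).1 hxq
  exact Set.disjoint_left.1 h (Ioo_subset_Ico_self hx) (Ioo_subset_Ico_self this)

lemma dyadicLen_mul_log_le (m : ℕ) : dyadicLen m * Real.log (1 / dyadicLen m) ≤ m * dyadicLen m := by
  rw [mul_comm]
  refine mul_le_mul_of_nonneg_right ?_ (dyadicLen_pos m).le
  have h1 : 1 / dyadicLen m ≤ 2 ^ m := by
    rw [dyadicLen, one_div_div]
    refine div_le_self (by positivity) ?_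
    linarith [Real.pi_gt_three]
  calc Real.log (1 / dyadicLen m) ≤ Real.log (2 ^ m) :=
        Real.log_le_log (one_div_pos.2 (dyadicLen_pos m)) h1
    _ = m * Real.log 2 := Real.log_pow _ _
    _ ≤ m * 1 := by gcongr; linarith [Real.log_two_lt_d9]
    _ = m := mul_one _

variable {c : ℝ≥0} {R : ℝ → ℝ≥0∞}

/-- The complement of the maximal saturated open arcs. -/
def residualSet (c : ℝ≥0) (R : ℝ → ℝ≥0∞) (n : ℕ) : Set UnitCircle :=
  (⋃ p : {p // IsTopArc c R n p}, openArc p.1)ᶜ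

open Classical in
/-- An enumeration of the maximal saturated open arcs, padded with empty sets. -/
def topArcSeq (c : ℝ≥0) (R : ℝ → ℝ≥0∞) (n k : ℕ) : Set UnitCircle :=
  if IsTopArc c R n (Nat.pairEquiv.symm k) then openArc (Nat.pairEquiv.symm k) else ∅

lemma topArcSeq_of_isTopArc {n k : ℕ} (h : IsTopArc c R n (Nat.pairEquiv.symm k)) :
    topArcSeq c R n k = openArc (Nat.pairEquiv.symm k) := if_pos h

lemma topArcSeq_of_not_isTopArc {n k : ℕ} (h : ¬ IsTopArc c R n (Nat.pairEquiv.symm k)) :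
    topArcSeq c R n k = ∅ := if_neg h

lemma tsum_topArcSeq_lt_top (hc : 0 < c) {n : ℕ} (hn : 0 < n) :
    ∑' k, ENNReal.ofReal ((volume (topArcSeq c R n k)).toReal *
      Real.log (1 / (volume (topArcSeq c R n k)).toReal)) < ⊤ := by
  have hterm : ∀ k : ℕ, ENNReal.ofReal ((volume (topArcSeq c R n k)).toReal *
      Real.log (1 / (volume (topArcSeq c R n k)).toReal)) ≤
      {p | IsTopArc c R n p}.indicator (fun p => (c : ℝ≥0∞)⁻¹ * dyadicCap c p.1)
        (Nat.pairEquiv.symm k) := by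
    intro k
    by_cases h : IsTopArc c R n (Nat.pairEquiv.symm k)
    · rw [topArcSeq_of_isTopArc h, indicator_of_mem (s := {p | IsTopArc c R n p}) h,
        volume_openArc h.2.1, ENNReal.toReal_ofReal (dyadicLen_pos _).le, dyadicCap, mul_assoc,
        ← mul_assoc, ENNReal.inv_mul_cancel (by exact_mod_cast hc.ne') ENNReal.coe_ne_top, one_mul,
        ← ENNReal.ofReal_natCast, ← ENNReal.ofReal_mul (Nat.cast_nonneg _)]
      exact ENNReal.ofReal_le_ofReal (dyadicLen_mul_log_le _)
    · rw [topArcSeq_of_not_isTopArc h]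
      simp
  refine (ENNReal.tsum_le_tsum hterm).trans_lt ?_
  rw [Nat.pairEquiv.symm.tsum_eq ({p | IsTopArc c R n p}.indicator
    (fun p => (c : ℝ≥0∞)⁻¹ * dyadicCap c p.1)), ← tsum_subtype, ENNReal.tsum_mul_left]
  have h1 : (c : ℝ≥0∞)⁻¹ ≠ ⊤ := ENNReal.inv_ne_top.2 (by exact_mod_cast hc.ne')
  refine ENNReal.mul_lt_top h1.lt_top ((tsum_dyadicCap_le (R := R) hc hn).trans_lt ?_)
  finiteness

lemma iUnion_topArcSeq (n : ℕ) : ⋃ k, topArcSeq c R n k = (residualSet c R n)ᶜ := by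
  rw [residualSet, compl_compl]
  ext ζ
  simp only [mem_iUnion]
  constructor
  · rintro ⟨k, hk⟩
    by_cases h : IsTopArc c R n (Nat.pairEquiv.symm k)
    · rw [topArcSeq_of_isTopArc h] at hk
      exact ⟨⟨_, h⟩, hk⟩
    · rw [topArcSeq_of_not_isTopArc h] at hk
      exact absurd hk (notMem_empty _)
  · rintro ⟨⟨p, hp⟩, hζ⟩
    obtain ⟨k, rfl⟩ := Nat.pairEquiv.symm.surjective p
    exact ⟨k, by rwa [topArcSeq_of_isTopArc hp]⟩

lemma disjoint_topArcSeq {n k l : ℕ} (hkl : k ≠ l) :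
    Disjoint (topArcSeq c R n k) (topArcSeq c R n l) := by
  by_cases h1 : IsTopArc c R n (Nat.pairEquiv.symm k)
  · by_cases h2 : IsTopArc c R n (Nat.pairEquiv.symm l)
    · rw [topArcSeq_of_isTopArc h1, topArcSeq_of_isTopArc h2]
      exact disjoint_openArc h1.2.1 h2.2.1
        (h1.disjoint h2 fun h => hkl (Nat.pairEquiv.symm.injective h))
    · rw [topArcSeq_of_not_isTopArc h2]
      exact disjoint_empty _
  · rw [topArcSeq_of_not_isTopArc h1]
    exact empty_disjoint _

lemma isOpen_isPreconnected_topArcSeq (n k : ℕ) :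
    IsOpen (topArcSeq c R n k) ∧ IsPreconnected (topArcSeq c R n k) := by
  by_cases h : IsTopArc c R n (Nat.pairEquiv.symm k)
  · rw [topArcSeq_of_isTopArc h]
    exact ⟨isOpen_openArc _, isPreconnected_openArc _⟩
  · rw [topArcSeq_of_not_isTopArc h]
    exact ⟨isOpen_empty, isPreconnected_empty⟩

lemma isCarlesonSet_residualSet (hc : 0 < c) {n : ℕ} (hn : 0 < n) :
    IsCarlesonSet (residualSet c R n) :=
  ⟨(isOpen_iUnion fun p : {p // IsTopArc c R n p} => isOpen_openArc p.1).isClosed_compl,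
    topArcSeq c R n, isOpen_isPreconnected_topArcSeq n, fun _ _ => disjoint_topArcSeq,
    iUnion_topArcSeq n, tsum_topArcSeq_lt_top hc hn⟩

lemma coe_mem_residualSet {n : ℕ} {x : ℝ} (hx : x ∈ uncovered c R n) :
    (x : UnitCircle) ∈ residualSet c R n := by
  simp only [residualSet, mem_compl_iff, mem_iUnion, not_exists]
  rintro ⟨p, hp⟩ h
  have h1 := Ioo_subset_Ico_self ((coe_mem_openArc hp.2.1 hx.1).1 h)
  have h2 := hx.2 p.1 hp.1
  rw [dyadicIdx_eq h1] at h2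
  exact h2 hp.2.2.1

lemma ae_mem_uncovered (n : ℕ) : ∀ᵐ x : ℝ, x ∈ Ico 0 (2 * Real.pi) →
    (x : UnitCircle) ∈ residualSet c R n → x ∈ uncovered c R n := by
  have hcount : (range fun p : ℕ × ℕ => (p.2 : ℝ) * dyadicLen p.1).Countable := countable_range _
  filter_upwards [measure_eq_zero_iff_ae_notMem.1 (hcount.measure_zero volume)] with x hxe hx hxE
  by_contra hu
  obtain ⟨p, hp, hxp⟩ := exists_isTopArc hx hu
  refine hxE (mem_iUnion.2 ⟨⟨p, hp⟩, x, ⟨lt_of_le_of_ne hxp.1 fun h => hxe ⟨p, h⟩, hxp.2⟩, rfl⟩)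

/-- If `nlog ∘ w` is dominated by `A * R + B` and diverges on Carleson sets of positive measure, then
almost every point is covered by a saturated arc. -/
lemma volume_uncovered_eq_zero (hc : 0 < c) (hR : Measurable R) {n : ℕ} (hn : 0 < n)
    {f : UnitCircle → ℝ≥0∞} (hf : Measurable f) {A B : ℝ≥0} (hAB : ∀ x : ℝ, f x ≤ A * R x + B)
    (hdiv : ∀ E : Set UnitCircle, IsCarlesonSet E → 0 < volume E → ∫⁻ ζ in E, f ζ = ⊤) :
    volume (uncovered c R n) = 0 := by
  have hE := isCarlesonSet_residualSet (R := R) hc hn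
  have hm := hE.1.measurableSet
  have hzero : volume (residualSet c R n) = 0 := by
    by_contra h0
    refine absurd (hdiv _ hE (pos_iff_ne_zero.2 h0)) (ne_of_lt ?_)
    rw [← lintegral_indicator hm, ← measurePreserving_coe_Ico.lintegral_comp (hf.indicator hm)]
    calc ∫⁻ x in Ico 0 (2 * Real.pi), (residualSet c R n).indicator f (x : UnitCircle)
        ≤ ∫⁻ x in Ico 0 (2 * Real.pi), (uncovered c R n).indicator (fun x => A * R x + B) x := by
          refine lintegral_mono_ae ?_
          rw [ae_restrict_iff' measurableSet_Ico]
          filter_upwards [ae_mem_uncovered (c := c) (R := R) n] with x hx hxI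
          by_cases hxE : (x : UnitCircle) ∈ residualSet c R n
          · rw [indicator_of_mem hxE, indicator_of_mem (hx hxI hxE)]
            exact hAB x
          · rw [indicator_of_notMem hxE]; exact zero_le
      _ ≤ ∫⁻ x, (uncovered c R n).indicator (fun x => A * R x + B) x := setLIntegral_le_lintegral _ _
      _ = ∫⁻ x in uncovered c R n, (A * R x + B) := lintegral_indicator (measurableSet_uncovered n) _
      _ = A * (∫⁻ x in uncovered c R n, R x) + B * volume (uncovered c R n) := by
          rw [lintegral_add_right _ measurable_const, lintegral_const_mul _ hR, setLIntegral_const]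
      _ ≤ A * (c * n * ENNReal.ofReal (2 * Real.pi)) + B * volume (Ico 0 (2 * Real.pi)) := by
          gcongr
          · exact setLIntegral_uncovered_le hc hR hn
          · exact inter_subset_left
      _ < ⊤ := by rw [Real.volume_Ico]; finiteness
  rw [← measurePreserving_coe_Ico.measure_preimage hm.nullMeasurableSet,
    Measure.restrict_apply (hm.preimage measurePreserving_coe_Ico.measurable)] at hzero
  refine measure_mono_null (fun x hx => ?_) hzero
  exact ⟨coe_mem_residualSet hx, hx.1⟩

/-- Existence of a bounded function below `R` with prescribed mass on all dyadic arcs of generation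
`n` and controlled mass on all smaller ones. -/
lemma exists_dyadic_density (hc : 0 < c) (hR : Measurable R) {n : ℕ} (hn : 0 < n)
    (h : volume (uncovered c R n) = 0) :
    ∃ (M : ℕ) (G : ℝ → ℝ≥0∞), n ≤ M ∧ Measurable G ∧ (∀ x, G x ≤ min (R x) (c * M)) ∧
      (∀ m j, n ≤ m → ∫⁻ x in dyadicArc m j, G x ≤ dyadicCap c m) ∧
      ∀ j < 2 ^ n, ∫⁻ x in dyadicArc n j, G x = dyadicCap c n := by
  have hex : ∀ j, ∃ d, j < 2 ^ n → dyadicCap c n ≤ ∫⁻ x in dyadicArc n j, flow c R d n x := by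
    intro j
    by_cases hj : j < 2 ^ n
    · obtain ⟨d, hd⟩ := isSaturated_of_volume_uncovered hc hn h hj
      exact ⟨d, fun _ => hd⟩
    · exact ⟨0, fun h => absurd h hj⟩
  choose e he using hex
  set D := ∑ j ∈ Finset.range (2 ^ n), e j with hD
  refine ⟨n + D, flow c R D n, Nat.le_add_right _ _, measurable_flow hR D n, flow_le D n,
    fun m j hm => setLIntegral_flow_le hc hn hm D j, fun j hj =>
    le_antisymm (setLIntegral_flow_le hc hn le_rfl D j) ((he j hj).trans ?_)⟩
  exact setLIntegral_flow_mono hc hn j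
    (Finset.single_le_sum (f := e) (fun _ _ => Nat.zero_le _) (Finset.mem_range.2 hj))

end

section

open scoped NNReal ENNReal

/-- The Poisson kernel of the unit disk at `z`, as a function of the angle. -/
def diskPoisson (z : ℂ) (τ : ℝ) : ℝ := (1 - ‖z‖ ^ 2) / ‖Complex.exp (τ * Complex.I) - z‖ ^ 2

lemma one_sub_norm_le_norm_exp_sub (z : ℂ) (τ : ℝ) : 1 - ‖z‖ ≤ ‖Complex.exp (τ * Complex.I) - z‖ := by
  have := norm_sub_norm_le (Complex.exp (τ * Complex.I)) z
  rwa [Complex.norm_exp_ofReal_mul_I] at this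

lemma norm_exp_sub_pos {z : ℂ} (hz : ‖z‖ < 1) (τ : ℝ) : 0 < ‖Complex.exp (τ * Complex.I) - z‖ :=
  (sub_pos.2 hz).trans_le (one_sub_norm_le_norm_exp_sub z τ)

lemma diskPoisson_pos {z : ℂ} (hz : ‖z‖ < 1) (τ : ℝ) : 0 < diskPoisson z τ := by
  have := norm_exp_sub_pos hz τ
  have h2 : ‖z‖ ^ 2 < 1 := by nlinarith [norm_nonneg z]
  unfold diskPoisson
  exact div_pos (by linarith) (by positivity)

lemma diskPoisson_le {z : ℂ} (hz : ‖z‖ < 1) (τ : ℝ) : diskPoisson z τ ≤ 2 / (1 - ‖z‖) := by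
  have h1 := one_sub_norm_le_norm_exp_sub z τ
  have h0 : 0 < 1 - ‖z‖ := sub_pos.2 hz
  unfold diskPoisson
  rw [div_le_div_iff₀ (by have := norm_exp_sub_pos hz τ; positivity) h0]
  have h2 : (1 - ‖z‖) ^ 2 ≤ ‖Complex.exp (τ * Complex.I) - z‖ ^ 2 := by gcongr
  nlinarith [norm_nonneg z]

lemma continuous_diskPoisson {z : ℂ} (hz : ‖z‖ < 1) : Continuous (diskPoisson z) := by
  unfold diskPoisson
  refine Continuous.div continuous_const (by fun_prop) fun τ => ?_
  have := norm_exp_sub_pos hz τ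
  positivity

lemma diskPoisson_eq_re (z : ℂ) (τ : ℝ) : diskPoisson z τ =
    ((Complex.exp (τ * Complex.I) + z) / (Complex.exp (τ * Complex.I) - z)).re := by
  have h := (congrFun (poissonKernel_eq_re_herglotzRieszKernel (c := 0) (w := z))
    (Complex.exp (τ * Complex.I)))
  simpa [poissonKernel_def, herglotzRieszKernel_def, Complex.norm_exp_ofReal_mul_I, diskPoisson]
    using h

lemma norm_exp_sub_exp_le (σ τ : ℝ) :
    ‖Complex.exp (σ * Complex.I) - Complex.exp (τ * Complex.I)‖ ≤ |σ - τ| := by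
  have h : Complex.exp (σ * Complex.I) - Complex.exp (τ * Complex.I) =
      Complex.exp (τ * Complex.I) * (Complex.exp (Complex.I * ((σ - τ : ℝ) : ℂ)) - 1) := by
    rw [mul_sub, ← Complex.exp_add, mul_one]
    congr 2
    push_cast; ring
  rw [h, norm_mul, Complex.norm_exp_ofReal_mul_I, one_mul]
  exact Real.norm_exp_I_mul_ofReal_sub_one_le

lemma abs_diskPoisson_sub_le {z : ℂ} (hz : ‖z‖ < 1) (σ τ : ℝ) :
    |diskPoisson z σ - diskPoisson z τ| ≤ 2 / (1 - ‖z‖) ^ 2 * |σ - τ| := by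
  rw [diskPoisson_eq_re z, diskPoisson_eq_re z, ← Complex.sub_re]
  refine (Complex.abs_re_le_norm _).trans ?_
  have h1 := one_sub_norm_le_norm_exp_sub z σ
  have h2 := one_sub_norm_le_norm_exp_sub z τ
  have h3 := norm_exp_sub_exp_le σ τ
  have h0 : 0 < 1 - ‖z‖ := sub_pos.2 hz
  have hσ : Complex.exp (σ * Complex.I) - z ≠ 0 := norm_pos_iff.1 (norm_exp_sub_pos hz σ)
  have hτ : Complex.exp (τ * Complex.I) - z ≠ 0 := norm_pos_iff.1 (norm_exp_sub_pos hz τ)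
  set a := Complex.exp (σ * Complex.I)
  set b := Complex.exp (τ * Complex.I)
  have e : (a + z) / (a - z) - (b + z) / (b - z) = 2 * z * (b - a) / ((a - z) * (b - z)) := by
    field_simp; ring
  rw [e, norm_div, norm_mul, norm_mul, norm_mul, Complex.norm_ofNat, norm_sub_rev b a]
  calc 2 * ‖z‖ * ‖a - b‖ / (‖a - z‖ * ‖b - z‖) ≤ 2 * 1 * |σ - τ| / ((1 - ‖z‖) * (1 - ‖z‖)) := by
        gcongr
    _ = _ := by field_simp

lemma diskPoisson_le_mul {z : ℂ} (hz : ‖z‖ < 1) {σ τ : ℝ} (h : |σ - τ| ≤ 2 * Real.pi * (1 - ‖z‖)) :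
    diskPoisson z σ ≤ 64 * diskPoisson z τ := by
  have h1 := one_sub_norm_le_norm_exp_sub z σ
  have h3 := norm_exp_sub_exp_le τ σ
  have hp := norm_exp_sub_pos hz σ
  have hq := norm_exp_sub_pos hz τ
  have h4 : ‖Complex.exp (τ * Complex.I) - z‖ ≤ 8 * ‖Complex.exp (σ * Complex.I) - z‖ := by
    have h5 := norm_sub_le_norm_sub_add_norm_sub (Complex.exp (τ * Complex.I))
      (Complex.exp (σ * Complex.I)) z
    rw [abs_sub_comm] at h3
    nlinarith [Real.pi_lt_d2]
  unfold diskPoisson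
  have h2 : ‖z‖ ^ 2 < 1 := by nlinarith [norm_nonneg z]
  rw [← mul_div_assoc, div_le_div_iff₀ (by positivity) (by positivity)]
  have h6 : ‖Complex.exp (τ * Complex.I) - z‖ ^ 2 ≤ (8 * ‖Complex.exp (σ * Complex.I) - z‖) ^ 2 := by
    gcongr
  nlinarith

lemma re_eval_eq_integral {z : ℂ} (hz : ‖z‖ < 1) (H : Polynomial ℂ) : (H.eval z).re = (2 * Real.pi)⁻¹ *
    ∫ τ in Ico 0 (2 * Real.pi), diskPoisson z τ * (H.eval (Complex.exp (τ * Complex.I))).re := by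
  have hd : DiffContOnCl ℂ (fun w => H.eval w) (Metric.ball 0 1) := H.differentiable.diffContOnCl
  have h := hd.circleAverage_poissonKernel_smul (by simpa using hz : z ∈ Metric.ball 0 1)
  rw [Real.circleAverage_def] at h
  have h2 := congrArg Complex.re h
  rw [← h2, Complex.smul_re, smul_eq_mul, intervalIntegral.integral_of_le Real.two_pi_pos.le,
    integral_Ico_eq_integral_Ioc]
  congr 1
  have hint : Integrable (fun τ : ℝ => (diskPoisson z τ : ℂ) * H.eval (Complex.exp (τ * Complex.I)))
      (volume.restrict (Ioc 0 (2 * Real.pi))) := by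
    have hcont : Continuous fun τ : ℝ => (diskPoisson z τ : ℂ) *
        H.eval (Complex.exp (τ * Complex.I)) :=
      (Complex.continuous_ofReal.comp (continuous_diskPoisson hz)).mul
        (H.continuous.comp (by fun_prop))
    exact (hcont.integrableOn_Icc).mono_set Ioc_subset_Icc_self
  have e := integral_re hint
  simp only [RCLike.re_to_complex, Complex.re_ofReal_mul] at e
  rw [e]
  congr 1
  refine integral_congr_ae (Eventually.of_forall fun τ => ?_)
  simp [circleMap, poissonKernel_def, diskPoisson, Complex.norm_exp_ofReal_mul_I]

lemma integral_diskPoisson {z : ℂ} (hz : ‖z‖ < 1) : ∫ τ in Ico 0 (2 * Real.pi), diskPoisson z τ = 2 * Real.pi := by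
  have := re_eval_eq_integral hz 1
  simp only [Polynomial.eval_one, Complex.one_re, mul_one] at this
  have hpi := Real.two_pi_pos
  field_simp at this
  linarith

lemma integrableOn_diskPoisson_mul {z : ℂ} (hz : ‖z‖ < 1) {f : ℝ → ℝ} {s : Set ℝ}
    (hf : IntegrableOn f s) :
    IntegrableOn (fun τ => diskPoisson z τ * f τ) s := by
  refine Integrable.bdd_mul (c := 2 / (1 - ‖z‖)) hf
    (continuous_diskPoisson hz).aestronglyMeasurable (Eventually.of_forall fun τ => ?_)
  rw [Real.norm_of_nonneg (diskPoisson_pos hz τ).le]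
  exact diskPoisson_le hz τ

lemma integral_Ico_eq_sum {f : ℝ → ℝ} (m : ℕ) (hf : IntegrableOn f (Ico 0 (2 * Real.pi))) :
    ∫ x in Ico 0 (2 * Real.pi), f x = ∑ j ∈ Finset.range (2 ^ m), ∫ x in dyadicArc m j, f x := by
  rw [← iUnion_dyadicArc m, integral_biUnion_finset _ (fun j _ => measurableSet_dyadicArc m j)
    (fun i _ j _ h => disjoint_dyadicArc h)]
  exact fun j hj => hf.mono_set (dyadicArc_subset (Finset.mem_range.1 hj))

lemma abs_sub_le_of_mem_dyadicArc {m j : ℕ} {x y : ℝ} (hx : x ∈ dyadicArc m j)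
    (hy : y ∈ dyadicArc m j) : |x - y| ≤ dyadicLen m := by
  have h1 := hx.1; have h2 := hx.2; have h3 := hy.1; have h4 := hy.2
  rw [abs_le]; constructor <;> linarith

lemma volume_real_dyadicArc (m j : ℕ) : volume.real (dyadicArc m j) = dyadicLen m := by
  rw [Measure.real, volume_dyadicArc, ENNReal.toReal_ofReal (dyadicLen_pos m).le]

lemma integral_diskPoisson_mul_le {z : ℂ} (hz : ‖z‖ < 1) {f : ℝ → ℝ} (hf : IntegrableOn f (Ico 0 (2 * Real.pi)))
    (hf0 : ∀ x, 0 ≤ f x) {m : ℕ} {A : ℝ}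
    (hm : dyadicLen m ≤ 2 * Real.pi * (1 - ‖z‖))
    (hJ : ∀ j < 2 ^ m, ∫ x in dyadicArc m j, f x ≤ A * dyadicLen m) :
    ∫ τ in Ico 0 (2 * Real.pi), diskPoisson z τ * f τ ≤ 64 * A * (2 * Real.pi) := by
  have hPi : IntegrableOn (diskPoisson z) (Ico 0 (2 * Real.pi)) :=
    (continuous_diskPoisson hz).integrableOn_Icc.mono_set Ico_subset_Icc_self
  have hl := dyadicLen_pos m
  rw [integral_Ico_eq_sum m (integrableOn_diskPoisson_mul hz hf)]
  rw [← integral_diskPoisson hz, integral_Ico_eq_sum m hPi, Finset.mul_sum]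
  refine Finset.sum_le_sum fun j hj => ?_
  have hj := Finset.mem_range.1 hj
  have hsub := dyadicArc_subset hj
  have hPJ := hPi.mono_set hsub
  have hfJ := hf.mono_set hsub
  set I := ∫ x in dyadicArc m j, diskPoisson z x with hI
  have hI0 : 0 ≤ I := setIntegral_nonneg (measurableSet_dyadicArc m j) fun x _ =>
    (diskPoisson_pos hz x).le
  have hpt : ∀ τ ∈ dyadicArc m j, diskPoisson z τ ≤ 64 * I / dyadicLen m := by
    intro τ hτ
    rw [le_div_iff₀ hl]
    have : ∫ _ in dyadicArc m j, diskPoisson z τ ≤ ∫ x in dyadicArc m j, 64 * diskPoisson z x := by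
      refine setIntegral_mono_on (integrableOn_const (by rw [volume_dyadicArc]; finiteness))
        (hPJ.const_mul 64) (measurableSet_dyadicArc m j) fun x hx => ?_
      exact diskPoisson_le_mul hz ((abs_sub_le_of_mem_dyadicArc hτ hx).trans hm)
    rw [setIntegral_const, integral_const_mul, volume_real_dyadicArc, smul_eq_mul] at this
    linarith
  calc ∫ x in dyadicArc m j, diskPoisson z x * f x
      ≤ ∫ x in dyadicArc m j, 64 * I / dyadicLen m * f x := by
        refine setIntegral_mono_on (integrableOn_diskPoisson_mul hz hfJ)
          (hfJ.const_mul _) (measurableSet_dyadicArc m j) fun x hx => ?_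
        exact mul_le_mul_of_nonneg_right (hpt x hx) (hf0 x)
    _ = 64 * I / dyadicLen m * ∫ x in dyadicArc m j, f x := integral_const_mul _ _
    _ ≤ 64 * I / dyadicLen m * (A * dyadicLen m) := by
        gcongr
        exact hJ j hj
    _ = 64 * A * I := by field_simp

lemma abs_integral_diskPoisson_mul_le {z : ℂ} (hz : ‖z‖ < 1) {f : ℝ → ℝ} (hf : IntegrableOn f (Ico 0 (2 * Real.pi)))
    {n : ℕ} {A : ℝ} (h0 : ∀ j < 2 ^ n, ∫ x in dyadicArc n j, f x = 0)
    (hJ : ∀ j < 2 ^ n, ∫ x in dyadicArc n j, |f x| ≤ A * dyadicLen n) :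
    |∫ τ in Ico 0 (2 * Real.pi), diskPoisson z τ * f τ| ≤
      2 * (2 * Real.pi) ^ 2 * A / (2 ^ n * (1 - ‖z‖) ^ 2) := by
  have hl := dyadicLen_pos n
  have hh : 0 < 1 - ‖z‖ := sub_pos.2 hz
  rw [integral_Ico_eq_sum n (integrableOn_diskPoisson_mul hz hf)]
  have key : ∀ j ∈ Finset.range (2 ^ n), |∫ x in dyadicArc n j, diskPoisson z x * f x| ≤
      2 / (1 - ‖z‖) ^ 2 * dyadicLen n * (A * dyadicLen n) := by
    intro j hj
    have hj := Finset.mem_range.1 hj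
    have hfJ := hf.mono_set (dyadicArc_subset hj)
    have hPf := integrableOn_diskPoisson_mul hz hfJ
    set s : ℝ := j * dyadicLen n with hs
    have hsJ : s ∈ dyadicArc n j := ⟨le_rfl, by rw [hs]; nlinarith⟩
    have e : ∫ x in dyadicArc n j, diskPoisson z x * f x =
        ∫ x in dyadicArc n j, (diskPoisson z x - diskPoisson z s) * f x := by
      simp_rw [sub_mul]
      rw [integral_sub hPf (hfJ.const_mul _), integral_const_mul, h0 j hj, mul_zero, sub_zero]
    rw [e]
    refine (abs_integral_le_integral_abs).trans ?_
    calc ∫ x in dyadicArc n j, |(diskPoisson z x - diskPoisson z s) * f x|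
        ≤ ∫ x in dyadicArc n j, 2 / (1 - ‖z‖) ^ 2 * dyadicLen n * |f x| := by
          refine setIntegral_mono_on ?_ (hfJ.abs.const_mul _) (measurableSet_dyadicArc n j)
            fun x hx => ?_
          · have := (hPf.sub (hfJ.const_mul (diskPoisson z s))).abs
            refine this.congr (Eventually.of_forall fun x => ?_)
            simp [sub_mul]
          · rw [abs_mul]
            refine mul_le_mul_of_nonneg_right ((abs_diskPoisson_sub_le hz x s).trans ?_) (abs_nonneg _)
            gcongr
            exact abs_sub_le_of_mem_dyadicArc hx hsJ
      _ = 2 / (1 - ‖z‖) ^ 2 * dyadicLen n * ∫ x in dyadicArc n j, |f x| := integral_const_mul _ _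
      _ ≤ _ := by gcongr; exact hJ j hj
  refine (Finset.abs_sum_le_sum_abs _ _).trans ((Finset.sum_le_sum key).trans_eq ?_)
  rw [Finset.sum_const, Finset.card_range, nsmul_eq_mul, dyadicLen]
  push_cast
  field_simp

end

section

open scoped NNReal ENNReal

/-- `G - c * n` is a mean-zero density on the dyadic arcs of generation `n`, whose positive part has
mass at most `c * m * |J|` on dyadic arcs `J` of generation `m ≥ n`, and the boundary values of `Re H`
are close to it. -/
structure ApproximatesDensity (c : ℝ) (n M : ℕ) (G : ℝ → ℝ) (H : Polynomial ℂ) : Prop where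
  c_pos : 0 < c
  c_le : c ≤ 1
  n_pos : 0 < n
  le : n ≤ M
  nonneg : ∀ x, 0 ≤ G x
  integrable : IntegrableOn G (Ico 0 (2 * Real.pi))
  mass_le : ∀ m j, n ≤ m → ∫ x in dyadicArc m j, G x ≤ c * m * dyadicLen m
  mass_eq : ∀ j < 2 ^ n, ∫ x in dyadicArc n j, G x = c * n * dyadicLen n
  close : ∫ τ in Ico 0 (2 * Real.pi),
    |(H.eval (Complex.exp (τ * Complex.I))).re - (G τ - c * n)| ≤ 1 / (n * 2 ^ M)
  le_sup : ∀ τ : ℝ, (H.eval (Complex.exp (τ * Complex.I))).re ≤ c * M + 1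

namespace ApproximatesDensity
variable {c : ℝ} {n M : ℕ} {G : ℝ → ℝ} {H : Polynomial ℂ} {z : ℂ}

lemma re_eval_le_sup (h : ApproximatesDensity c n M G H) (hz : ‖z‖ < 1) :
    (H.eval z).re ≤ c * M + 1 := by
  rw [re_eval_eq_integral hz]
  have hcont : Continuous fun τ : ℝ => (H.eval (Complex.exp (τ * Complex.I))).re :=
    Complex.continuous_re.comp (H.continuous.comp (by fun_prop))
  have hP := continuous_diskPoisson hz
  have : ∫ τ in Ico 0 (2 * Real.pi), diskPoisson z τ * (H.eval (Complex.exp (τ * Complex.I))).re ≤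
      ∫ τ in Ico 0 (2 * Real.pi), diskPoisson z τ * (c * M + 1) := by
    refine setIntegral_mono_on ((hP.mul hcont).integrableOn_Icc.mono_set Ico_subset_Icc_self)
      ((hP.mul continuous_const).integrableOn_Icc.mono_set Ico_subset_Icc_self) measurableSet_Ico
      fun τ _ => mul_le_mul_of_nonneg_left (h.le_sup τ) (diskPoisson_pos hz τ).le
  rw [integral_mul_const, integral_diskPoisson hz] at this
  have hpi := Real.two_pi_pos
  rw [inv_mul_le_iff₀ hpi]
  exact this

lemma integrable_sub (h : ApproximatesDensity c n M G H) :
    IntegrableOn (fun τ => G τ - c * n) (Ico 0 (2 * Real.pi)) :=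
  h.integrable.sub (integrableOn_const (by rw [Real.volume_Ico]; finiteness))

lemma abs_re_eval_sub_le (h : ApproximatesDensity c n M G H) (hz : ‖z‖ < 1)
    (hM : 1 / 2 ^ M ≤ 1 - ‖z‖) : |(H.eval z).re - (2 * Real.pi)⁻¹ *
      ∫ τ in Ico 0 (2 * Real.pi), diskPoisson z τ * (G τ - c * n)| ≤ 1 / n := by
  have hh : 0 < 1 - ‖z‖ := sub_pos.2 hz
  have hn : (0 : ℝ) < n := by exact_mod_cast h.n_pos
  have hcont : Continuous fun τ : ℝ => (H.eval (Complex.exp (τ * Complex.I))).re :=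
    Complex.continuous_re.comp (H.continuous.comp (by fun_prop))
  have hqi : IntegrableOn (fun τ : ℝ => (H.eval (Complex.exp (τ * Complex.I))).re)
    (Ico 0 (2 * Real.pi)) := hcont.integrableOn_Icc.mono_set Ico_subset_Icc_self
  rw [re_eval_eq_integral hz, ← mul_sub, ← integral_sub (integrableOn_diskPoisson_mul hz hqi)
    (integrableOn_diskPoisson_mul hz h.integrable_sub), abs_mul, abs_of_pos (by positivity)]
  simp_rw [← mul_sub]
  have hi : IntegrableOn (fun τ : ℝ => |(H.eval (Complex.exp (τ * Complex.I))).re - (G τ - c * n)|)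
    (Ico 0 (2 * Real.pi)) := (hqi.sub h.integrable_sub).abs
  have h1 : |∫ τ in Ico 0 (2 * Real.pi), diskPoisson z τ *
      ((H.eval (Complex.exp (τ * Complex.I))).re - (G τ - c * n))| ≤
      2 / (1 - ‖z‖) * (1 / (n * 2 ^ M)) := by
    refine abs_integral_le_integral_abs.trans ?_
    refine le_trans (b := ∫ τ in Ico 0 (2 * Real.pi), 2 / (1 - ‖z‖) *
      |(H.eval (Complex.exp (τ * Complex.I))).re - (G τ - c * n)|) ?_ ?_
    · refine integral_mono (integrableOn_diskPoisson_mul hz (hqi.sub h.integrable_sub)).abs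
        (hi.const_mul _) fun τ => ?_
      simp only [abs_mul, abs_of_pos (diskPoisson_pos hz τ)]
      gcongr
      exact diskPoisson_le hz τ
    · rw [integral_const_mul]
      gcongr
      exact h.close
  have h2 : 1 / (2 ^ M * (1 - ‖z‖)) ≤ 1 := by
    rw [div_le_one (by positivity)]
    rwa [div_le_iff₀ (by positivity), mul_comm] at hM
  calc (2 * Real.pi)⁻¹ * _ ≤ (2 * Real.pi)⁻¹ * (2 / (1 - ‖z‖) * (1 / (n * 2 ^ M))) := by gcongr
    _ = Real.pi⁻¹ * (1 / n) * (1 / (2 ^ M * (1 - ‖z‖))) := by field_simp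
    _ ≤ 1 * (1 / n) * 1 := by
      gcongr
      exact inv_le_one_of_one_le₀ (by linarith [Real.pi_gt_three])
    _ = 1 / n := by ring

lemma integral_le_of_dyadicLen_le (h : ApproximatesDensity c n M G H) (hz : ‖z‖ < 1) {m : ℕ}
    (hnm : n ≤ m) (hm : 1 / 2 ^ m ≤ 1 - ‖z‖) : (2 * Real.pi)⁻¹ *
      ∫ τ in Ico 0 (2 * Real.pi), diskPoisson z τ * (G τ - c * n) ≤ 64 * (c * m) := by
  have hpi := Real.two_pi_pos
  have hc := h.c_pos
  have hlen : dyadicLen m ≤ 2 * Real.pi * (1 - ‖z‖) := by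
    rw [dyadicLen, div_eq_mul_one_div]; gcongr
  have h1 := integral_diskPoisson_mul_le hz h.integrable h.nonneg hlen
    (fun j _ => h.mass_le m j hnm)
  have h2 : ∫ τ in Ico 0 (2 * Real.pi), diskPoisson z τ * (G τ - c * n) ≤
      ∫ τ in Ico 0 (2 * Real.pi), diskPoisson z τ * G τ := by
    refine integral_mono (integrableOn_diskPoisson_mul hz h.integrable_sub)
      (integrableOn_diskPoisson_mul hz h.integrable) fun τ => ?_
    refine mul_le_mul_of_nonneg_left ?_ (diskPoisson_pos hz τ).le
    have : 0 ≤ c * n := by positivity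
    linarith
  rw [inv_mul_le_iff₀ hpi]
  linarith

lemma abs_integral_le (h : ApproximatesDensity c n M G H) (hz : ‖z‖ < 1) : |(2 * Real.pi)⁻¹ *
      ∫ τ in Ico 0 (2 * Real.pi), diskPoisson z τ * (G τ - c * n)| ≤
      26 * c * n / (2 ^ n * (1 - ‖z‖) ^ 2) := by
  have hc := h.c_pos
  have hh : 0 < 1 - ‖z‖ := sub_pos.2 hz
  have hn : (0 : ℝ) < n := by exact_mod_cast h.n_pos
  have hint : ∀ j < 2 ^ n, IntegrableOn G (dyadicArc n j) := fun j hj =>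
    h.integrable.mono_set (dyadicArc_subset hj)
  have hci : ∀ j, IntegrableOn (fun _ => c * n) (dyadicArc n j) := fun j =>
    integrableOn_const (by rw [volume_dyadicArc]; finiteness)
  have hcint : ∀ j, ∫ _ in dyadicArc n j, c * n = c * n * dyadicLen n := fun j => by
    rw [setIntegral_const, volume_real_dyadicArc, smul_eq_mul, mul_comm]
  have h1 := abs_integral_diskPoisson_mul_le (A := 2 * (c * n)) hz h.integrable_sub (fun j hj => by
      rw [integral_sub (hint j hj) (hci j), h.mass_eq j hj, hcint, sub_self]) (fun j hj => by
      refine le_trans (b := ∫ x in dyadicArc n j, (G x + c * n)) ?_ ?_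
      · refine integral_mono ((hint j hj).sub (hci j)).abs ((hint j hj).add (hci j)) fun x => ?_
        have h1 := h.nonneg x
        have h2 : 0 ≤ c * n := by positivity
        simp only [abs_le]
        constructor <;> linarith
      · rw [integral_add (hint j hj) (hci j), h.mass_eq j hj, hcint]
        linarith)
  rw [abs_mul, abs_of_pos (by positivity)]
  refine (mul_le_mul_of_nonneg_left h1 (by positivity)).trans ?_
  have e : (2 * Real.pi)⁻¹ * (2 * (2 * Real.pi) ^ 2 * (2 * (c * n)) / (2 ^ n * (1 - ‖z‖) ^ 2)) =
      (8 * Real.pi) * c * n / (2 ^ n * (1 - ‖z‖) ^ 2) := by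
    field_simp; norm_num
  rw [e]
  gcongr
  linarith [Real.pi_lt_d2]

lemma abs_re_eval_le (h : ApproximatesDensity c n M G H) (hz : ‖z‖ < 1) (hn : 1 / 2 ^ n ≤ 1 - ‖z‖) :
    |(H.eval z).re| ≤ 1 / n + 26 * c * n / (2 ^ n * (1 - ‖z‖) ^ 2) := by
  have hM : (1 : ℝ) / 2 ^ M ≤ 1 / 2 ^ n :=
    one_div_le_one_div_of_le (by positivity) (pow_le_pow_right₀ (by norm_num) h.le)
  have h1 := h.abs_re_eval_sub_le hz (hM.trans hn)
  have h2 := h.abs_integral_le hz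
  rw [abs_le] at *
  constructor <;> linarith

lemma re_eval_le_log (h : ApproximatesDensity c n M G H) (hz : ‖z‖ < 1) :
    (H.eval z).re ≤ 400 * c * Real.log (1 / (1 - ‖z‖)) + 300 := by
  have hc := h.c_pos
  have hc1 := h.c_le
  have hh : 0 < 1 - ‖z‖ := sub_pos.2 hz
  have hnp : (1 : ℝ) ≤ n := by exact_mod_cast h.n_pos
  set L := Real.log (1 / (1 - ‖z‖)) with hL
  have hL0 : 0 ≤ L := Real.log_nonneg (by
    rw [le_div_iff₀ hh]; linarith [norm_nonneg z])
  have hlog2 := Real.log_two_gt_d9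
  have hpow : ∀ k : ℕ, 1 - ‖z‖ ≤ 1 / 2 ^ k → (k : ℝ) ≤ 2 * L := by
    intro k hk
    have : Real.log (2 ^ k) ≤ L := by
      refine Real.log_le_log (by positivity) ?_
      rw [le_div_iff₀ hh]
      rwa [le_div_iff₀ (by positivity), mul_comm] at hk
    rw [Real.log_pow] at this
    have hk0 : (0 : ℝ) ≤ k := Nat.cast_nonneg k
    nlinarith
  by_cases hM : 1 - ‖z‖ ≤ 1 / 2 ^ M
  · have h1 := h.re_eval_le_sup hz
    have h2 := hpow M hM
    nlinarith
  have hsub := (abs_le.1 (h.abs_re_eval_sub_le hz (not_le.1 hM).le)).2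
  have hn1 : (1 : ℝ) / n ≤ 1 := by rw [div_le_one (by linarith)]; exact hnp
  by_cases hn : 1 - ‖z‖ ≤ 1 / 2 ^ n
  · -- the scale of `z` is finer than generation `n`
    have hex : ∃ m : ℕ, 1 / 2 ^ m ≤ 1 - ‖z‖ := ⟨M, (not_le.1 hM).le⟩
    classical
    set m := Nat.find hex with hm
    have hspec : (1 : ℝ) / 2 ^ m ≤ 1 - ‖z‖ := Nat.find_spec hex
    have hnm : n ≤ m := by
      by_contra hlt
      have h3 : (1 : ℝ) / 2 ^ n < 1 / 2 ^ m :=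
        one_div_lt_one_div_of_lt (by positivity) (pow_lt_pow_right₀ (by norm_num) (not_le.1 hlt))
      linarith
    have hmp : 0 < m := h.n_pos.trans_le hnm
    have hpred := Nat.find_min hex (m := m - 1) (by omega)
    have h4 := hpow (m - 1) (not_le.1 hpred).le
    rw [Nat.cast_sub hmp, Nat.cast_one] at h4
    have h5 := h.integral_le_of_dyadicLen_le hz hnm hspec
    nlinarith
  · have hn' := (not_le.1 hn).le
    by_cases hq : (n : ℝ) / 2 ^ n ≤ (1 - ‖z‖) ^ 2
    · have h5 := (abs_le.1 (h.abs_integral_le hz)).2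
      have h6 : 26 * c * n / (2 ^ n * (1 - ‖z‖) ^ 2) ≤ 26 * c := by
        rw [div_le_iff₀ (by positivity)]
        rw [div_le_iff₀ (by positivity)] at hq
        nlinarith
      nlinarith
    · have h5 := h.integral_le_of_dyadicLen_le hz le_rfl hn'
      have h6 : (n : ℝ) ≤ 6 * L + 3 := by
        have h7 := Real.log_le_log (by positivity) (not_le.1 hq).le
        rw [Real.log_pow, Real.log_div (by positivity) (by positivity), Real.log_pow] at h7
        have h8 : Real.log (1 - ‖z‖) = -L := by rw [hL, one_div, Real.log_inv]; ring
        have h9 := Real.log_le_sub_one_of_pos (show (0 : ℝ) < n / 3 by positivity)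
        rw [Real.log_div (by positivity) (by norm_num)] at h9
        have h10 := Real.log_le_sub_one_of_pos (show (0 : ℝ) < 3 by norm_num)
        rw [h8] at h7
        push_cast at h7
        nlinarith
      nlinarith

end ApproximatesDensity

lemma fourier_natCast_apply (n : ℕ) (ζ : UnitCircle) : fourier (n : ℤ) ζ = circleEmbed ζ ^ n := by
  simp [fourier_apply, circleEmbed, AddCircle.toCircle_nsmul]

/-- The real part of a trigonometric polynomial is the real part of an analytic polynomial. -/
lemma exists_polynomial_re_eq {s : C(UnitCircle, ℂ)}
    (hs : s ∈ Submodule.span ℂ (range (fourier : ℤ → C(UnitCircle, ℂ)))) (a : ℂ) :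
    ∃ H : Polynomial ℂ, (H.eval 0).im = 0 ∧ ∀ ζ, (H.eval (circleEmbed ζ)).re = (a * s ζ).re := by
  induction hs using Submodule.span_induction generalizing a with
  | mem s h =>
    obtain ⟨n, rfl⟩ := h
    rcases eq_or_ne n 0 with rfl | hn
    · exact ⟨Polynomial.C (a.re : ℂ), by simp, by simp⟩
    obtain ⟨k, rfl | rfl⟩ := n.eq_nat_or_neg
    · have hk : k ≠ 0 := by simpa using hn
      refine ⟨Polynomial.C a * Polynomial.X ^ k, by simp [hk], fun ζ => ?_⟩
      rw [fourier_natCast_apply]; simp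
    · have hk : k ≠ 0 := by simpa using hn
      refine ⟨Polynomial.C (starRingEnd ℂ a) * Polynomial.X ^ k, by simp [hk], fun ζ => ?_⟩
      rw [fourier_neg, fourier_natCast_apply, ← Complex.conj_re (a * _), map_mul, Complex.conj_conj]
      simp
  | zero => exact ⟨0, by simp, by simp⟩
  | add s r _ _ ihs ihr =>
    obtain ⟨H, hH0, hH⟩ := ihs a
    obtain ⟨K, hK0, hK⟩ := ihr a
    refine ⟨H + K, by simp [hH0, hK0], fun ζ => ?_⟩
    rw [Polynomial.eval_add, Complex.add_re, hH, hK, ContinuousMap.add_apply, mul_add, Complex.add_re]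
  | smul b s _ ih =>
    obtain ⟨H, hH0, hH⟩ := ih (a * b)
    refine ⟨H, hH0, fun ζ => ?_⟩
    rw [hH, ContinuousMap.smul_apply, smul_eq_mul, mul_assoc]

lemma exists_polynomial_abs_re_sub_le (φ : C(UnitCircle, ℝ)) {ε : ℝ} (hε : 0 < ε) :
    ∃ H : Polynomial ℂ, (H.eval 0).im = 0 ∧ ∀ ζ, |(H.eval (circleEmbed ζ)).re - φ ζ| ≤ ε := by
  let ψ : C(UnitCircle, ℂ) := ⟨fun ζ => (φ ζ : ℂ), by fun_prop⟩
  have hψ : ψ ∈ (Submodule.span ℂ (range (fourier : ℤ → C(UnitCircle, ℂ)))).topologicalClosure := by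
    rw [span_fourier_closure_eq_top]; trivial
  obtain ⟨s, hs, hd⟩ := Metric.mem_closure_iff.1 hψ ε hε
  obtain ⟨H, hH0, hH⟩ := exists_polynomial_re_eq hs 1
  refine ⟨H, hH0, fun ζ => ?_⟩
  have h1 := (ContinuousMap.dist_apply_le_dist (f := ψ) (g := s) ζ).trans hd.le
  rw [hH, one_mul, abs_sub_comm]
  refine le_trans ?_ h1
  rw [dist_eq_norm]
  simpa [ψ] using Complex.abs_re_le_norm (ψ ζ - s ζ)

lemma exp_le_exp_add_mul_abs_sub {a b B : ℝ} (ha : a ≤ B) :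
    Real.exp a ≤ Real.exp b + Real.exp B * |a - b| := by
  have h1 : Real.exp a - Real.exp b ≤ Real.exp a * (a - b) := by
    have h2 := Real.add_one_le_exp (b - a)
    have h3 : Real.exp b = Real.exp a * Real.exp (b - a) := by rw [← Real.exp_add]; ring_nf
    rw [h3]
    nlinarith [Real.exp_pos a]
  have h4 : Real.exp a * (a - b) ≤ Real.exp B * |a - b| :=
    (mul_le_mul_of_nonneg_left (le_abs_self _) (Real.exp_pos a).le).trans
      (mul_le_mul_of_nonneg_right (Real.exp_le_exp.2 ha) (abs_nonneg _))
  linarith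

lemma exists_polynomial_approx {t : ℝ} (ht : 0 < t) {w : UnitCircle → ℝ} (hwm : Measurable w)
    (hw1 : Integrable w volume) {g : UnitCircle → ℝ} (hg : Measurable g) {B : ℝ}
    (hgB : ∀ ζ, |g ζ| ≤ B) {ε : ℝ} (hε : 0 < ε) :
    ∃ H : Polynomial ℂ, (H.eval 0).im = 0 ∧ (∀ ζ, (H.eval (circleEmbed ζ)).re ≤ B + 1) ∧
      ∫⁻ ζ, ENNReal.ofReal |(H.eval (circleEmbed ζ)).re - g ζ| ≤ ENNReal.ofReal ε ∧
      ∫⁻ ζ, ENNReal.ofReal (Real.exp (t * (H.eval (circleEmbed ζ)).re)) * ENNReal.ofReal (w ζ) ≤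
        ENNReal.ofReal (Real.exp t) *
          ((∫⁻ ζ, ENNReal.ofReal (Real.exp (t * g ζ)) * ENNReal.ofReal (w ζ)) + ENNReal.ofReal ε) := by
  have hpi := Real.two_pi_pos
  let ν : Measure UnitCircle := volume.withDensity fun ζ => ENNReal.ofReal (w ζ)
  have hνfin : IsFiniteMeasure ν := isFiniteMeasure_withDensity_ofReal hw1.2
  set K := Real.exp (t * B) * t with hK
  have hKpos : 0 < K := by positivity
  set η := min (ε / 2) (ε / K) with hη
  have hηpos : 0 < η := by positivity
  have hgi : Integrable g (volume + ν) :=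
    Integrable.of_bound hg.aestronglyMeasurable B (ae_of_all _ hgB)
  obtain ⟨φ, hφ, -⟩ := hgi.exists_boundedContinuous_lintegral_sub_le
    (ε := ENNReal.ofReal η) (by simpa using hηpos)
  rw [lintegral_add_measure] at hφ
  let φ' : C(UnitCircle, ℝ) := ⟨fun ζ => min (φ ζ) B, by fun_prop⟩
  have hφB : ∀ ζ, φ' ζ ≤ B := fun ζ => min_le_right _ _
  have hφg : ∀ ζ, ENNReal.ofReal |φ' ζ - g ζ| ≤ ‖g ζ - φ ζ‖ₑ := by
    intro ζ
    rw [← ofReal_norm, Real.norm_eq_abs, abs_sub_comm (g ζ)]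
    refine ENNReal.ofReal_le_ofReal ?_
    have hgB' : min (g ζ) B = g ζ := min_eq_left ((abs_le.1 (hgB ζ)).2)
    change |min (φ ζ) B - g ζ| ≤ _
    conv_lhs => rw [← hgB']
    exact abs_min_sub_min_le_max _ _ _ _ |>.trans (by simp)
  have hvol : ∫⁻ ζ, ENNReal.ofReal |φ' ζ - g ζ| ≤ ENNReal.ofReal η :=
    (lintegral_mono hφg).trans (le_self_add.trans hφ)
  have hν : ∫⁻ ζ, ENNReal.ofReal |φ' ζ - g ζ| * ENNReal.ofReal (w ζ) ≤ ENNReal.ofReal η := by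
    refine le_trans (lintegral_mono fun ζ => mul_le_mul_left (hφg ζ) _) ?_
    refine le_trans (le_of_eq ?_) (le_add_self.trans hφ)
    have hm : Measurable fun ζ => ‖g ζ - φ ζ‖ₑ := (hg.sub φ.continuous.measurable).enorm
    rw [lintegral_withDensity_eq_lintegral_mul _ hwm.ennreal_ofReal hm]
    exact lintegral_congr fun ζ => mul_comm _ _
  obtain ⟨H, hH0, hH⟩ := exists_polynomial_abs_re_sub_le φ'
    (ε := min 1 (ε / (4 * Real.pi))) (by positivity)
  refine ⟨H, hH0, fun ζ => ?_, ?_, ?_⟩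
  · linarith [(abs_le.1 (hH ζ)).2, hφB ζ, min_le_left 1 (ε / (4 * Real.pi))]
  · calc ∫⁻ ζ, ENNReal.ofReal |(H.eval (circleEmbed ζ)).re - g ζ|
        ≤ ∫⁻ ζ, (ENNReal.ofReal (ε / (4 * Real.pi)) + ENNReal.ofReal |φ' ζ - g ζ|) := by
          refine lintegral_mono fun ζ => ?_
          rw [← ENNReal.ofReal_add (by positivity) (by positivity)]
          refine ENNReal.ofReal_le_ofReal ((abs_sub_le _ (φ' ζ) _).trans ?_)
          gcongr
          exact (hH ζ).trans (min_le_right _ _)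
      _ ≤ ENNReal.ofReal (ε / 2) + ENNReal.ofReal (ε / 2) := by
          rw [lintegral_add_left measurable_const, lintegral_const, AddCircle.measure_univ,
            ← ENNReal.ofReal_mul (by positivity)]
          refine add_le_add (ENNReal.ofReal_le_ofReal (le_of_eq (by field_simp; norm_num)))
            (hvol.trans (ENNReal.ofReal_le_ofReal (min_le_left _ _)))
      _ = ENNReal.ofReal ε := by rw [← ENNReal.ofReal_add (by positivity) (by positivity), add_halves]
  · have hpt : ∀ ζ, ENNReal.ofReal (Real.exp (t * (H.eval (circleEmbed ζ)).re)) *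
        ENNReal.ofReal (w ζ) ≤ ENNReal.ofReal (Real.exp t) *
          (ENNReal.ofReal (Real.exp (t * g ζ)) * ENNReal.ofReal (w ζ) +
            ENNReal.ofReal K * (ENNReal.ofReal |φ' ζ - g ζ| * ENNReal.ofReal (w ζ))) := by
      intro ζ
      rw [← mul_assoc (ENNReal.ofReal K), ← add_mul, ← mul_assoc, ← ENNReal.ofReal_mul hKpos.le,
        ← ENNReal.ofReal_add (by positivity) (by positivity),
        ← ENNReal.ofReal_mul (Real.exp_pos t).le]
      refine mul_le_mul_left (ENNReal.ofReal_le_ofReal ?_) _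
      have h1 : t * (H.eval (circleEmbed ζ)).re ≤ t + t * φ' ζ := by
        nlinarith [(abs_le.1 (hH ζ)).2, min_le_left 1 (ε / (4 * Real.pi))]
      have h2 := exp_le_exp_add_mul_abs_sub (b := t * g ζ)
        (mul_le_mul_of_nonneg_left (hφB ζ) ht.le)
      rw [← mul_sub, abs_mul, abs_of_pos ht, ← mul_assoc] at h2
      calc _ ≤ Real.exp (t + t * φ' ζ) := Real.exp_le_exp.2 h1
        _ = Real.exp t * Real.exp (t * φ' ζ) := Real.exp_add _ _
        _ ≤ _ := by gcongr
    refine (lintegral_mono hpt).trans ?_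
    rw [lintegral_const_mul' _ _ ENNReal.ofReal_ne_top]
    gcongr
    have hm : Measurable fun ζ => ENNReal.ofReal (Real.exp (t * g ζ)) * ENNReal.ofReal (w ζ) :=
      (Real.measurable_exp.comp (hg.const_mul t)).ennreal_ofReal.mul hwm.ennreal_ofReal
    rw [lintegral_add_left hm, lintegral_const_mul' _ _ ENNReal.ofReal_ne_top]
    gcongr
    calc ENNReal.ofReal K * _ ≤ ENNReal.ofReal K * ENNReal.ofReal (ε / K) := by
          gcongr
          exact hν.trans (ENNReal.ofReal_le_ofReal (min_le_right _ _))
      _ = ENNReal.ofReal ε := by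
          rw [← ENNReal.ofReal_mul hKpos.le, mul_div_cancel₀ _ hKpos.ne']

end

section

open scoped NNReal ENNReal

/-- The representative in `[0, 2π)` of a point of the circle. -/
def circleArg (ζ : UnitCircle) : ℝ := (AddCircle.measurableEquivIco (2 * Real.pi) 0 ζ : ℝ)

lemma measurable_circleArg : Measurable circleArg :=
  measurable_subtype_coe.comp (AddCircle.measurableEquivIco (2 * Real.pi) 0).measurable

lemma circleArg_mem (ζ : UnitCircle) : circleArg ζ ∈ Ico 0 (2 * Real.pi) := by
  have := (AddCircle.measurableEquivIco (2 * Real.pi) 0 ζ).2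
  exact ⟨this.1, this.2.trans_eq (zero_add _)⟩

lemma coe_circleArg (ζ : UnitCircle) : (circleArg ζ : UnitCircle) = ζ :=
  (AddCircle.measurableEquivIco (2 * Real.pi) 0).symm_apply_apply ζ

lemma circleArg_coe {x : ℝ} (hx : x ∈ Ico 0 (2 * Real.pi)) : circleArg (x : UnitCircle) = x :=
  coe_injOn_Ico (circleArg_mem _) hx (coe_circleArg _)

lemma exp_toReal_mul_le {t : ℝ} (ht : 0 < t) {x : ℝ} (hx : 0 ≤ x) {a : ℝ≥0∞}
    (ha : a ≤ ENNReal.ofReal t⁻¹ * nlog x) : Real.exp (t * a.toReal) * x ≤ 1 + x := by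
  rcases hx.eq_or_lt with rfl | hx0
  · simp
  have h1 : a.toReal ≤ t⁻¹ * max (Real.log x⁻¹) 0 := by
    refine ENNReal.toReal_le_of_le_ofReal (by positivity) (ha.trans ?_)
    rw [nlog, if_neg hx0.ne', ENNReal.ofReal_mul (by positivity)]
    gcongr
    exact le_max_left _ _
  have h2 : t * a.toReal ≤ max (Real.log x⁻¹) 0 := by
    rwa [← le_inv_mul_iff₀ ht]
  have h3 : Real.exp (t * a.toReal) ≤ max x⁻¹ 1 := by
    refine (Real.exp_le_exp.2 h2).trans ?_
    rcases le_total (Real.log x⁻¹) 0 with h | h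
    · rw [max_eq_right h, Real.exp_zero]; exact le_max_right _ _
    · rw [max_eq_left h, Real.exp_log (by positivity)]; exact le_max_left _ _
  refine (mul_le_mul_of_nonneg_right h3 hx).trans ?_
  rw [max_mul_of_nonneg _ _ hx, inv_mul_cancel₀ hx0.ne', one_mul]
  exact max_le (by linarith) (by linarith)

lemma exists_approximatesDensity {t : ℝ} (ht : 0 < t) {w : UnitCircle → ℝ} (hw0 : ∀ ζ, 0 ≤ w ζ)
    (hwm : Measurable w) (hw1 : Integrable w volume)
    (hdiv : ∀ E, IsCarlesonSet E → 0 < volume E → ∫⁻ ζ in E, nlog (w ζ) = ⊤)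
    {c : ℝ≥0} (hc : 0 < c) (hc1 : c ≤ 1) {n : ℕ} (hn : 0 < n) :
    ∃ (M : ℕ) (G : ℝ → ℝ) (H : Polynomial ℂ), ApproximatesDensity c n M G H ∧ (H.eval 0).im = 0 ∧
      ∫⁻ ζ, ENNReal.ofReal (Real.exp (t * (H.eval (circleEmbed ζ)).re)) * ENNReal.ofReal (w ζ) ≤
        ENNReal.ofReal (Real.exp t) * (ENNReal.ofReal (Real.exp (-(t * (c * n)))) *
          (ENNReal.ofReal (2 * Real.pi) + ∫⁻ ζ, ENNReal.ofReal (w ζ)) + ENNReal.ofReal (1 / n)) := by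
  have hnR : (0 : ℝ) < n := by exact_mod_cast hn
  have hcR : (0 : ℝ) < c := by exact_mod_cast hc
  set R : ℝ → ℝ≥0∞ := fun x => ENNReal.ofReal t⁻¹ * nlog (w x) with hR
  have hcoe : Measurable fun x : ℝ => (x : UnitCircle) := AddCircle.measurable_mk'
  have hRm : Measurable R := (measurable_nlog.comp (hwm.comp hcoe)).const_mul _
  have hunc := volume_uncovered_eq_zero hc hRm hn (measurable_nlog.comp hwm)
    (A := t.toNNReal) (B := 0) (fun x => by
      rw [hR]
      simp only [Function.comp_apply, ENNReal.coe_zero, add_zero]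
      rw [← mul_assoc, ← ENNReal.ofReal, ← ENNReal.ofReal_mul ht.le, mul_inv_cancel₀ ht.ne',
        ENNReal.ofReal_one, one_mul]) hdiv
  obtain ⟨M, G, hnM, hGm, hGle, hGmass, hGeq⟩ := exists_dyadic_density hc hRm hn hunc
  have hGtop : ∀ x, G x ≠ ⊤ := fun x => ne_top_of_le_ne_top
    (ENNReal.mul_ne_top ENNReal.coe_ne_top (ENNReal.natCast_ne_top M)) ((hGle x).trans (min_le_right _ _))
  have hGM : ∀ x, (G x).toReal ≤ c * M := fun x => by
    have := ENNReal.toReal_mono (by finiteness) ((hGle x).trans (min_le_right _ _))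
    simpa using this
  have hMR : (n : ℝ) ≤ M := by exact_mod_cast hnM
  have hgm : Measurable fun ζ => (G (circleArg ζ)).toReal - c * n :=
    ((hGm.comp measurable_circleArg).ennreal_toReal).sub_const _
  obtain ⟨H, hH0, hHB, hHclose, hHexp⟩ := exists_polynomial_approx ht hwm hw1 hgm
    (B := c * M) (ε := 1 / (n * 2 ^ M)) (fun ζ => by
      have h1 := hGM (circleArg ζ)
      have h2 : 0 ≤ (G (circleArg ζ)).toReal := ENNReal.toReal_nonneg
      have h3 : (c : ℝ) * n ≤ c * M := by gcongr
      have h4 : (0 : ℝ) ≤ c * n := by positivity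
      rw [abs_le]; constructor <;> linarith) (by positivity)
  have hint : ∀ s, ∫ x in s, (G x).toReal = (∫⁻ x in s, G x).toReal := fun s =>
    integral_toReal hGm.aemeasurable (ae_of_all _ fun x => (hGtop x).lt_top)
  have hcap : ∀ m, (dyadicCap c m).toReal = c * m * dyadicLen m := fun m => by
    simp [dyadicCap, (dyadicLen_pos m).le]
  refine ⟨M, fun x => (G x).toReal, H, ⟨hcR, by exact_mod_cast hc1, hn, hnM,
    fun x => ENNReal.toReal_nonneg, ?_, fun m j hm => ?_, fun j hj => ?_, ?_, fun τ => ?_⟩, hH0, ?_⟩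
  · refine Integrable.of_bound (C := c * M) hGm.ennreal_toReal.aestronglyMeasurable
      (ae_of_all _ fun x => ?_)
    rw [Real.norm_of_nonneg ENNReal.toReal_nonneg]; exact hGM x
  · rw [hint, ← hcap]
    exact ENNReal.toReal_mono (dyadicCap_ne_top c m) (hGmass m j hm)
  · rw [hint, ← hcap, hGeq j hj]
  · have hmF : Measurable fun ζ => ENNReal.ofReal
        |(H.eval (circleEmbed ζ)).re - ((G (circleArg ζ)).toReal - c * n)| :=
      (((Complex.continuous_re.comp (H.continuous.comp continuous_circleEmbed)).measurable.sub
        hgm).norm).ennreal_ofReal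
    rw [← measurePreserving_coe_Ico.lintegral_comp hmF] at hHclose
    rw [integral_eq_lintegral_of_nonneg_ae (ae_of_all _ fun _ => abs_nonneg _)]
    · refine ENNReal.toReal_le_of_le_ofReal (by positivity) (le_trans (le_of_eq ?_) hHclose)
      refine setLIntegral_congr_fun measurableSet_Ico fun x hx => ?_
      simp only [circleEmbed_coe, circleArg_coe hx]
    · refine Measurable.aestronglyMeasurable (Measurable.norm (Measurable.sub ?_
        (hGm.ennreal_toReal.sub_const _)))
      exact (Complex.continuous_re.comp (H.continuous.comp (by fun_prop))).measurable
  · rw [← circleEmbed_coe]; exact hHB τ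
  · refine hHexp.trans ?_
    gcongr
    · calc ∫⁻ ζ, ENNReal.ofReal (Real.exp (t * ((G (circleArg ζ)).toReal - c * n))) *
            ENNReal.ofReal (w ζ)
          ≤ ∫⁻ ζ, ENNReal.ofReal (Real.exp (-(t * (c * n)))) * (1 + ENNReal.ofReal (w ζ)) := by
            refine lintegral_mono fun ζ => ?_
            have h1 := exp_toReal_mul_le ht (hw0 ζ) (a := G (circleArg ζ)) (by
              have := (hGle (circleArg ζ)).trans (min_le_left _ _)
              simpa only [hR, coe_circleArg] using this)
            rw [← ENNReal.ofReal_one, ← ENNReal.ofReal_add zero_le_one (hw0 ζ),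
              ← ENNReal.ofReal_mul (Real.exp_pos _).le, ← ENNReal.ofReal_mul (Real.exp_pos _).le]
            refine ENNReal.ofReal_le_ofReal ?_
            rw [mul_sub, sub_eq_neg_add, Real.exp_add, mul_assoc]
            gcongr
        _ = _ := by
            rw [lintegral_const_mul' _ _ ENNReal.ofReal_ne_top, lintegral_add_left measurable_const,
              lintegral_const, AddCircle.measure_univ, one_mul]
    · exact le_mul_of_one_le_right hnR.le (one_le_pow₀ (by norm_num))

lemma exists_polynomial_norm_sub_exp_le (H : Polynomial ℂ) {ε : ℝ} (hε : 0 < ε) :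
    ∃ p : Polynomial ℂ, ∀ z : ℂ, ‖z‖ ≤ 1 → ‖p.eval z - Complex.exp (H.eval z)‖ ≤ ε := by
  obtain ⟨B, hB⟩ := (isCompact_closedBall (0 : ℂ) 1).exists_bound_of_continuousOn
    H.continuous.continuousOn
  have h1 := (FloorSemiring.tendsto_pow_div_factorial_atTop B).mul_const 2
  rw [zero_mul] at h1
  obtain ⟨N, hN1, hN2⟩ := ((h1.eventually (ge_mem_nhds hε)).and
    (tendsto_natCast_atTop_atTop.eventually (eventually_ge_atTop (2 * B)))).exists
  refine ⟨∑ m ∈ Finset.range N, Polynomial.C ((m.factorial : ℂ)⁻¹) * H ^ m, fun z hz => ?_⟩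
  have hzB := hB z (by simpa using hz)
  have h2 : ‖H.eval z‖ / N.succ ≤ 1 / 2 := by
    rw [div_le_iff₀ (by positivity)]
    push_cast
    linarith
  have h3 := Complex.exp_bound' h2
  rw [norm_sub_rev, Polynomial.eval_finsetSum]
  have h4 : ∑ m ∈ Finset.range N, (Polynomial.C ((m.factorial : ℂ)⁻¹) * H ^ m).eval z =
      ∑ m ∈ Finset.range N, H.eval z ^ m / m.factorial := by
    refine Finset.sum_congr rfl fun m _ => ?_
    simp [div_eq_inv_mul]
  rw [h4]
  refine h3.trans (le_trans ?_ hN1)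
  gcongr

lemma ApproximatesDensity.tendsto_eval {c : ℝ} {M : ℕ → ℕ} {G : ℕ → ℝ → ℝ} {H : ℕ → Polynomial ℂ}
    (h : ∀ k, ApproximatesDensity c (k + 1) (M k) (G k) (H k)) (h0 : ∀ k, ((H k).eval 0).im = 0)
    {z : ℂ} (hz : ‖z‖ < 1) : Tendsto (fun k => (H k).eval z) atTop (𝓝 0) := by
  have hc := (h 0).c_pos
  set δ := (1 - ‖z‖) / 2 with hδ
  have hδ0 : 0 < δ := by rw [hδ]; linarith
  set m : ℕ → ℝ := fun k => 1 / (k + 1 : ℕ) + 26 * c * (k + 1 : ℕ) / (2 ^ (k + 1) * δ ^ 2) with hm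
  have hmpos : ∀ k, 0 < m k := fun k => by simp only [hm]; positivity
  have hmlim : Tendsto m atTop (𝓝 0) := by
    have e1 : Tendsto (fun n : ℕ => 1 / (n : ℝ) + 26 * c / δ ^ 2 * (n * (1 / 2 : ℝ) ^ n)) atTop (𝓝 0) := by
      simpa using (tendsto_const_div_atTop_nhds_zero_nat (1 : ℝ)).add
        ((tendsto_self_mul_const_pow_of_lt_one (r := 1 / 2) (by norm_num) (by norm_num)).const_mul
          (26 * c / δ ^ 2))
    refine (e1.comp (tendsto_add_atTop_nat 1)).congr fun k => ?_
    simp only [hm, Function.comp_apply, one_div, inv_pow]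
    field_simp
  have hsmall : ∀ᶠ k : ℕ in atTop, (1 : ℝ) / 2 ^ (k + 1) ≤ δ := by
    have e1 := (tendsto_pow_atTop_nhds_zero_of_lt_one (r := (1 / 2 : ℝ)) (by norm_num)
      (by norm_num)).comp (tendsto_add_atTop_nat 1)
    filter_upwards [e1.eventually (ge_mem_nhds hδ0)] with k hk
    simpa using hk
  set r := ‖z‖ + δ with hr
  have hr0 : 0 < r := by positivity
  have hbound : ∀ᶠ k in atTop, ‖(H k).eval z‖ ≤ m k * ((2 * ‖z‖ + (r + ‖z‖)) / δ) := by
    filter_upwards [hsmall] with k hk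
    have hre : ∀ x : ℂ, ‖x‖ < r → |((H k).eval x).re| ≤ m k := by
      intro x hx
      have hxδ : δ ≤ 1 - ‖x‖ := by linarith
      refine ((h k).abs_re_eval_le (by linarith) (hk.trans hxδ)).trans ?_
      simp only [hm]
      gcongr
    have hzero : ‖(H k).eval 0‖ ≤ m k := by
      have e : (H k).eval 0 = (((H k).eval 0).re : ℂ) := by
        apply Complex.ext <;> simp [h0 k]
      rw [e, Complex.norm_real]
      exact hre 0 (by simpa using hr0)
    have hbc := Complex.borelCaratheodory (hmpos k) (f := fun x => (H k).eval x)
      (R := r) (z := z) (H k).differentiable.differentiableOn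
      (fun x hx => (abs_le.1 (hre x (by simpa using hx))).2) hr0 (by simpa using by linarith)
    refine hbc.trans ?_
    have e : r - ‖z‖ = δ := by rw [hr]; ring
    rw [e]
    calc _ ≤ 2 * m k * ‖z‖ / δ + m k * (r + ‖z‖) / δ := by gcongr
      _ = _ := by field_simp
  refine squeeze_zero_norm' hbound ?_
  simpa using hmlim.mul_const ((2 * ‖z‖ + (r + ‖z‖)) / δ)

lemma lintegral_one_sub_norm_rpow_lt_top {s : ℝ} (hs : -1 < s) :
    ∫⁻ z in Metric.ball (0 : ℂ) 1, ENNReal.ofReal ((1 - ‖z‖) ^ s) < ⊤ := by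
  have h1 : IntegrableOn (fun y : ℝ => (1 - y) ^ s) (Ioo 0 1) := by
    have e := (intervalIntegral.intervalIntegrable_rpow' (a := 0) (b := 1) hs).comp_sub_left 1
    simp only [sub_zero, sub_self] at e
    rw [intervalIntegrable_iff, uIoc_of_ge zero_le_one] at e
    exact e.mono_set Ioo_subset_Ioc_self
  have h2 : IntegrableOn (fun y : ℝ => y ^ (Module.finrank ℝ ℂ - 1) • (1 - y) ^ s) (Ioo 0 1) := by
    refine Integrable.mono h1 ?_ ?_
    · exact (((measurable_id.pow_const _).smul
        ((measurable_const.sub measurable_id).pow_const s))).aestronglyMeasurable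
    · refine (ae_restrict_iff' measurableSet_Ioo).2 (ae_of_all _ fun y hy => ?_)
      rw [norm_smul]
      refine mul_le_of_le_one_left (norm_nonneg _) ?_
      rw [norm_pow, Real.norm_of_nonneg hy.1.le]
      exact pow_le_one₀ hy.1.le hy.2.le
  have h3 : IntegrableOn (fun z : ℂ => (1 - ‖z‖) ^ s) (Metric.ball 0 1) :=
    (integrableOn_fun_norm_addHaar volume).2 h2
  exact h3.lintegral_lt_top

lemma ApproximatesDensity.exp_re_le {c : ℝ} {n M : ℕ} {G : ℝ → ℝ} {H : Polynomial ℂ}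
    (h : ApproximatesDensity c n M G H) {z : ℂ} (hz : ‖z‖ < 1) :
    Real.exp (H.eval z).re ≤ Real.exp 300 * (1 - ‖z‖) ^ (-(400 * c)) := by
  have hh : 0 < 1 - ‖z‖ := sub_pos.2 hz
  refine (Real.exp_le_exp.2 (h.re_eval_le_log hz)).trans (le_of_eq ?_)
  rw [Real.rpow_def_of_pos hh, ← Real.exp_add, one_div, Real.log_inv]
  ring_nf

lemma tendsto_bergmanIntegral_sub_one {t β c : ℝ} (ht : 0 < t) (hβ : -1 < β)
    (hc : 400 * c * t ≤ (β + 1) / 2) {M : ℕ → ℕ} {G : ℕ → ℝ → ℝ} {H p : ℕ → Polynomial ℂ}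
    (h : ∀ k, ApproximatesDensity c (k + 1) (M k) (G k) (H k)) (h0 : ∀ k, ((H k).eval 0).im = 0)
    (hp : ∀ k (z : ℂ), ‖z‖ ≤ 1 → ‖(p k).eval z - Complex.exp ((H k).eval z)‖ ≤ 1 / (k + 1 : ℕ)) :
    Tendsto (fun k => bergmanIntegral t β fun z => (p k).eval z - 1) atTop (𝓝 0) := by
  have hc0 := (h 0).c_pos
  set A : ℝ := (Real.exp 300 + 2) ^ t with hA
  have key := tendsto_lintegral_of_dominated_convergence
    (μ := volume.restrict (Metric.ball (0 : ℂ) 1))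
    (F := fun k z => (‖(p k).eval z - 1‖₊ : ENNReal) ^ t * ENNReal.ofReal ((1 - ‖z‖) ^ β))
    (f := fun _ => 0)
    (fun z => ENNReal.ofReal A * ENNReal.ofReal ((1 - ‖z‖) ^ (β - (β + 1) / 2)))
    (fun k => ?_) (fun k => ?_) ?_ ?_
  · simpa [bergmanIntegral] using key
  · refine Measurable.mul (Measurable.pow_const ?_ _)
      (Measurable.ennreal_ofReal (by fun_prop))
    exact ((p k).continuous.measurable.sub_const 1).nnnorm.coe_nnreal_ennreal
  · refine (ae_restrict_iff' measurableSet_ball).2 (ae_of_all _ fun z hz => ?_)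
    have hz1 : ‖z‖ < 1 := by simpa using hz
    have hh : 0 < 1 - ‖z‖ := sub_pos.2 hz1
    have hh1 : 1 - ‖z‖ ≤ 1 := by linarith [norm_nonneg z]
    have hone : 1 ≤ (1 - ‖z‖) ^ (-(400 * c)) :=
      Real.one_le_rpow_of_pos_of_le_one_of_nonpos hh hh1 (by linarith)
    have e1 : ‖(p k).eval z - 1‖ ≤ (Real.exp 300 + 2) * (1 - ‖z‖) ^ (-(400 * c)) := by
      have e2 := hp k z hz1.le
      have e3 : (1 : ℝ) / (k + 1 : ℕ) ≤ 1 := by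
        rw [div_le_one (by positivity)]
        push_cast
        linarith [(Nat.cast_nonneg k : (0 : ℝ) ≤ k)]
      have e4 := (h k).exp_re_le hz1
      rw [← Complex.norm_exp] at e4
      calc ‖(p k).eval z - 1‖ = ‖((p k).eval z - Complex.exp ((H k).eval z)) +
            (Complex.exp ((H k).eval z) - 1)‖ := by congr 1; ring
        _ ≤ ‖(p k).eval z - Complex.exp ((H k).eval z)‖ + (‖Complex.exp ((H k).eval z)‖ + ‖(1 : ℂ)‖) :=
          (norm_add_le _ _).trans (by gcongr; exact norm_sub_le _ _)
        _ ≤ _ := by rw [norm_one]; linarith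
    simp only [coe_nnnorm_rpow ht.le]
    rw [← ENNReal.ofReal_mul (by positivity), ← ENNReal.ofReal_mul (by positivity)]
    refine ENNReal.ofReal_le_ofReal ?_
    have e5 : ‖(p k).eval z - 1‖ ^ t ≤ A * (1 - ‖z‖) ^ (-((β + 1) / 2)) := by
      refine (Real.rpow_le_rpow (norm_nonneg _) e1 ht.le).trans ?_
      rw [Real.mul_rpow (by positivity) (by positivity), ← Real.rpow_mul hh.le]
      gcongr ?_ * ?_
      exact Real.rpow_le_rpow_of_exponent_ge hh hh1 (by linarith)
    calc _ ≤ A * (1 - ‖z‖) ^ (-((β + 1) / 2)) * (1 - ‖z‖) ^ β := by gcongr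
      _ = _ := by rw [mul_assoc, ← Real.rpow_add hh]; ring_nf
  · rw [lintegral_const_mul' _ _ ENNReal.ofReal_ne_top]
    exact ENNReal.mul_ne_top ENNReal.ofReal_ne_top
      (lintegral_one_sub_norm_rpow_lt_top (by linarith)).ne
  · refine (ae_restrict_iff' measurableSet_ball).2 (ae_of_all _ fun z hz => ?_)
    have hz1 : ‖z‖ < 1 := by simpa using hz
    have e1 : Tendsto (fun k => (p k).eval z - 1) atTop (𝓝 0) := by
      have e2 : Tendsto (fun k => (p k).eval z - Complex.exp ((H k).eval z)) atTop (𝓝 0) :=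
        squeeze_zero_norm (fun k => hp k z hz1.le)
          ((tendsto_const_div_atTop_nhds_zero_nat (1 : ℝ)).comp (tendsto_add_atTop_nat 1))
      have e3 := (Complex.continuous_exp.tendsto 0).comp (ApproximatesDensity.tendsto_eval h h0 hz1)
      rw [Complex.exp_zero] at e3
      simpa using e2.add (e3.sub_const 1)
    have e4 : Tendsto (fun k => ‖(p k).eval z - 1‖ ^ t) atTop (𝓝 0) := by
      simpa [Real.zero_rpow ht.ne'] using e1.norm.rpow_const (Or.inr ht.le)
    simp only [coe_nnnorm_rpow ht.le, ← ENNReal.ofReal_mul (Real.rpow_nonneg (norm_nonneg _) t)]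
    have e5 := ENNReal.tendsto_ofReal (e4.mul_const ((1 - ‖z‖) ^ β))
    rwa [zero_mul, ENNReal.ofReal_zero] at e5

lemma tendsto_boundary_lintegral {t c : ℝ} (ht : 0 < t) (hc : 0 < c) {w : UnitCircle → ℝ}
    (hw0 : ∀ ζ, 0 ≤ w ζ) (hwm : Measurable w) (hw1 : Integrable w volume) {H p : ℕ → Polynomial ℂ}
    (hH : ∀ k, ∫⁻ ζ, ENNReal.ofReal (Real.exp (t * ((H k).eval (circleEmbed ζ)).re)) *
        ENNReal.ofReal (w ζ) ≤
      ENNReal.ofReal (Real.exp t) * (ENNReal.ofReal (Real.exp (-(t * (c * (k + 1 : ℕ))))) *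
        (ENNReal.ofReal (2 * Real.pi) + ∫⁻ ζ, ENNReal.ofReal (w ζ)) +
          ENNReal.ofReal (1 / (k + 1 : ℕ))))
    (hp : ∀ k (z : ℂ), ‖z‖ ≤ 1 → ‖(p k).eval z - Complex.exp ((H k).eval z)‖ ≤ 1 / (k + 1 : ℕ)) :
    Tendsto (fun k => ∫⁻ ζ, (‖(p k).eval (circleEmbed ζ)‖₊ : ENNReal) ^ t *
      ENNReal.ofReal (w ζ)) atTop (𝓝 0) := by
  have hpi := Real.two_pi_pos
  set W := ∫ ζ, w ζ with hW
  have hW0 : 0 ≤ W := integral_nonneg hw0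
  have hWl : ∫⁻ ζ, ENNReal.ofReal (w ζ) = ENNReal.ofReal W :=
    (ofReal_integral_eq_lintegral_ofReal hw1 (ae_of_all _ hw0)).symm
  set b : ℕ → ℝ := fun n => 2 ^ t * (Real.exp t * (Real.exp (-(t * (c * n))) *
    (2 * Real.pi + W) + 1 / n) + (1 / n) ^ t * W) with hb
  have hblim : Tendsto b atTop (𝓝 0) := by
    have e1 : Tendsto (fun n : ℕ => 1 / (n : ℝ)) atTop (𝓝 0) := tendsto_const_div_atTop_nhds_zero_nat 1
    have e2 : Tendsto (fun n : ℕ => (1 / (n : ℝ)) ^ t) atTop (𝓝 0) := by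
      simpa [Real.zero_rpow ht.ne'] using e1.rpow_const (Or.inr ht.le)
    have e3 : Tendsto (fun n : ℕ => Real.exp (-(t * (c * n)))) atTop (𝓝 0) := by
      refine Real.tendsto_exp_neg_atTop_nhds_zero.comp ?_
      exact (tendsto_natCast_atTop_atTop.const_mul_atTop hc).const_mul_atTop ht
    simpa [hb, one_div] using ((((e3.mul_const (2 * Real.pi + W)).add e1).const_mul (Real.exp t)).add
      (e2.mul_const W)).const_mul (2 ^ t)
  have hlim := ENNReal.tendsto_ofReal (hblim.comp (tendsto_add_atTop_nat 1))
  rw [ENNReal.ofReal_zero] at hlim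
  refine tendsto_of_tendsto_of_tendsto_of_le_of_le tendsto_const_nhds hlim (fun _ => zero_le) fun k => ?_
  have hpt : ∀ ζ, (‖(p k).eval (circleEmbed ζ)‖₊ : ENNReal) ^ t * ENNReal.ofReal (w ζ) ≤
      ENNReal.ofReal (2 ^ t) * (ENNReal.ofReal (Real.exp (t * ((H k).eval (circleEmbed ζ)).re)) *
        ENNReal.ofReal (w ζ) + ENNReal.ofReal ((1 / (k + 1 : ℕ)) ^ t) * ENNReal.ofReal (w ζ)) := by
    intro ζ
    rw [coe_nnnorm_rpow ht.le, ← add_mul, ← mul_assoc,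
      ← ENNReal.ofReal_add (by positivity) (by positivity),
      ← ENNReal.ofReal_mul (p := 2 ^ t) (by positivity)]
    refine mul_le_mul_left (ENNReal.ofReal_le_ofReal ?_) _
    have e1 : ‖(p k).eval (circleEmbed ζ)‖ ≤
        Real.exp ((H k).eval (circleEmbed ζ)).re + 1 / (k + 1 : ℕ) := by
      have e2 := hp k _ (norm_circleEmbed ζ).le
      have e3 := norm_le_norm_add_norm_sub' ((p k).eval (circleEmbed ζ))
        (Complex.exp ((H k).eval (circleEmbed ζ)))
      rw [Complex.norm_exp] at e3
      linarith
    refine (Real.rpow_le_rpow (norm_nonneg _) e1 ht.le).trans ?_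
    refine (add_rpow_le_two_rpow_mul (by positivity) (by positivity) ht.le).trans (le_of_eq ?_)
    rw [← Real.exp_mul, mul_comm t]
  refine (lintegral_mono hpt).trans ?_
  rw [lintegral_const_mul' _ _ ENNReal.ofReal_ne_top, lintegral_add_right _
    (hwm.ennreal_ofReal.const_mul _), lintegral_const_mul' _ _ ENNReal.ofReal_ne_top, hWl]
  have hk := hH k
  rw [hWl, ← ENNReal.ofReal_add hpi.le hW0, ← ENNReal.ofReal_mul (by positivity),
    ← ENNReal.ofReal_add (by positivity) (by positivity), ← ENNReal.ofReal_mul (by positivity)] at hk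
  refine (mul_le_mul_right (add_le_add_left hk _) _).trans (le_of_eq ?_)
  rw [← ENNReal.ofReal_mul (by positivity), ← ENNReal.ofReal_add (by positivity) (by positivity),
    ← ENNReal.ofReal_mul (by positivity)]
  rfl

lemma exists_splitting_polynomials {t β : ℝ} (ht : 0 < t) (hβ : -1 < β) {w : UnitCircle → ℝ}
    (hw0 : ∀ ζ, 0 ≤ w ζ) (hwm : Measurable w) (hw1 : Integrable w volume)
    (hdiv : ∀ E, IsCarlesonSet E → 0 < volume E → ∫⁻ ζ in E, nlog (w ζ) = ⊤) :
    ∃ p : ℕ → Polynomial ℂ,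
      Tendsto (fun k => ∫⁻ ζ, (‖(p k).eval (circleEmbed ζ)‖₊ : ENNReal) ^ t *
        ENNReal.ofReal (w ζ)) atTop (𝓝 0) ∧
      Tendsto (fun k => bergmanIntegral t β fun z => (p k).eval z - 1) atTop (𝓝 0) := by
  have hc0 : 0 < min 1 ((β + 1) / (800 * t)) :=
    lt_min one_pos (div_pos (by linarith) (by positivity))
  set c : ℝ≥0 := ⟨min 1 ((β + 1) / (800 * t)), hc0.le⟩ with hc
  have hct : 400 * (c : ℝ) * t ≤ (β + 1) / 2 := by
    have h1 : (c : ℝ) ≤ (β + 1) / (800 * t) := min_le_right _ _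
    rw [le_div_iff₀ (by positivity)] at h1
    linarith
  have hc1 : c ≤ 1 := NNReal.coe_le_coe.1 (min_le_left _ _)
  choose M G H h h0 hexp using fun k : ℕ => exists_approximatesDensity ht hw0 hwm hw1 hdiv
    (c := c) hc0 hc1 k.succ_pos
  choose p hp using fun k : ℕ => exists_polynomial_norm_sub_exp_le (H k)
    (ε := 1 / (k + 1 : ℕ)) (by positivity)
  exact ⟨p, tendsto_boundary_lintegral ht hc0 hw0 hwm hw1 hexp hp,
    tendsto_bergmanIntegral_sub_one ht hβ hct h h0 hp⟩

end

/-- For `dμ = (1-|z|)^β dA + w |dz|`, the space `P^t(μ)` splits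
(equivalently, there are polynomials `p_k → 0` in `L^t(w|dz|)` and `p_k → 1` in
`L^t((1-|z|)^β dA)`) if and only if `∫_E log w |dz| = -∞` for every Carleson set
`E ⊆ 𝕋` of positive arclength measure. -/
theorem splitting_beta (t β : ℝ) (ht : 0 < t) (hβ : -1 < β)
    (w : UnitCircle → ℝ) (hw0 : ∀ ζ, 0 ≤ w ζ) (hw1 : Integrable w volume) :
    (∃ p : ℕ → Polynomial ℂ,
      Tendsto (fun k => ∫⁻ ζ, (‖(p k).eval (circleEmbed ζ)‖₊ : ENNReal) ^ t *
          ENNReal.ofReal (w ζ)) atTop (𝓝 0) ∧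
      Tendsto (fun k => ∫⁻ z in Metric.ball (0 : ℂ) 1,
          (‖(p k).eval z - 1‖₊ : ENNReal) ^ t * ENNReal.ofReal ((1 - ‖z‖) ^ β))
        atTop (𝓝 0)) ↔
    (∀ E : Set UnitCircle, IsCarlesonSet E → 0 < volume E →
      ∫⁻ ζ in E, nlog (w ζ) = ⊤) := by
  constructor
  · rintro ⟨p, h1, h2⟩ E hE hpos
    exact lintegral_nlog_eq_top_of_splits ht hβ hw0 hw1 h1 h2 hE hpos
  · intro hdiv
    set v : UnitCircle → ℝ := fun ζ => max (hw1.aestronglyMeasurable.mk w ζ) 0 with hv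
    have hwv : w =ᵐ[volume] v := by
      filter_upwards [hw1.aestronglyMeasurable.ae_eq_mk] with ζ hζ
      rw [hv]
      simp only [← hζ, max_eq_left (hw0 ζ)]
    have hvm : Measurable v :=
      hw1.aestronglyMeasurable.stronglyMeasurable_mk.measurable.max measurable_const
    obtain ⟨p, h1, h2⟩ := exists_splitting_polynomials ht hβ (fun ζ => le_max_right _ _) hvm
      (hw1.congr hwv) fun E hE hpos => by
        rw [← hdiv E hE hpos]
        refine lintegral_congr_ae (ae_restrict_of_ae ?_)
        filter_upwards [hwv] with ζ hζ
        rw [hζ]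
    refine ⟨p, h1.congr fun k => lintegral_congr_ae ?_, h2⟩
    filter_upwards [hwv] with ζ hζ
    rw [hζ]
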